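/- Let Ω = (0,1)² ⊆ ℝ², let φ be the Euclidean norm, let m > 4, let u be a minimizer of problem (1) with mass m, let j̄ = ‖u‖_∞, and let E_j = {u ≥ j}. Then j̄ ∈ { ⌊((2+√π)/(2√π))·m⌋ , ⌊((2+√π)/(2√π))·m⌋ + 1 }, and cl(E_j) = cl(Ω^r) for all 1 ≤ j ≤ j̄, where r = √((1 − m/j̄)/(4−π)). -/

import Mathlib

open MeasureTheory Set ENNReal Filter

noncomputable section

/-- `φ` is a norm on `ℝⁿ` (represented as `Fin n → ℝ`). -/
structure IsNorm {n : ℕ} (φ : (Fin n → ℝ) → ℝ) : Prop where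
  nonneg : ∀ x, 0 ≤ φ x
  eq_zero_iff : ∀ x, φ x = 0 ↔ x = 0
  smul_eq : ∀ (a : ℝ) (x : Fin n → ℝ), φ (a • x) = |a| * φ x
  add_le : ∀ x y, φ (x + y) ≤ φ x + φ y

/-- The divergence of a vector field `η : ℝⁿ → ℝⁿ`. -/
def diverg {n : ℕ} (η : (Fin n → ℝ) → (Fin n → ℝ)) (x : Fin n → ℝ) : ℝ :=
  ∑ i, fderiv ℝ η x (Pi.single i 1) i

/-- The anisotropic total variation `∫ φ*(Du)` of `u : ℝⁿ → ℝ`: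
`sup { ∫ u div η dx : η ∈ C¹_c(ℝⁿ;ℝⁿ), φ(η(x)) ≤ 1 ∀ x }`, as an extended real. -/
def anisoTV {n : ℕ} (φ : (Fin n → ℝ) → ℝ) (u : (Fin n → ℝ) → ℝ) : ℝ≥0∞ :=
  ⨆ η ∈ {η : (Fin n → ℝ) → (Fin n → ℝ) |
      ContDiff ℝ 1 η ∧ HasCompactSupport η ∧ ∀ x, φ (η x) ≤ 1},
    ENNReal.ofReal (∫ x, u x * diverg η x)

/-- `u ∈ BV(ℝⁿ)` (with respect to the anisotropic total variation). -/
def IsBV {n : ℕ} (φ : (Fin n → ℝ) → ℝ) (u : (Fin n → ℝ) → ℝ) : Prop :=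
  Integrable u volume ∧ anisoTV φ u ≠ ⊤

/-- `u` is admissible for problem (1): `u ∈ BV(ℝⁿ)`, `u = 0` a.e. outside `Ω`,
`u` is a.e. `ℕ`-valued, and `∫_Ω u = m`. -/
def Admissible {n : ℕ} (φ : (Fin n → ℝ) → ℝ) (Ω : Set (Fin n → ℝ)) (m : ℝ)
    (u : (Fin n → ℝ) → ℝ) : Prop :=
  IsBV φ u ∧ (∀ᵐ x ∂volume, x ∉ Ω → u x = 0) ∧
    (∀ᵐ x ∂volume, ∃ k : ℕ, u x = k) ∧ (∫ x in Ω, u x) = m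

/-- `u` is a minimizer of problem (1). -/
def IsMinimizer {n : ℕ} (φ : (Fin n → ℝ) → ℝ) (Ω : Set (Fin n → ℝ)) (m : ℝ)
    (u : (Fin n → ℝ) → ℝ) : Prop :=
  Admissible φ Ω m u ∧ ∀ v, Admissible φ Ω m v → anisoTV φ u ≤ anisoTV φ v

/-- The anisotropic perimeter `P_φ(E)` of a set `E ⊆ ℝⁿ`. -/
def anisoPerimeter {n : ℕ} (φ : (Fin n → ℝ) → ℝ) (E : Set (Fin n → ℝ)) : ℝ≥0∞ :=
  anisoTV φ (E.indicator (1 : (Fin n → ℝ) → ℝ))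

/-- The Wulff ball `W_r(x) = {y : φ(y-x) < r}`. -/
def wulffBall {n : ℕ} (φ : (Fin n → ℝ) → ℝ) (x : Fin n → ℝ) (r : ℝ) : Set (Fin n → ℝ) :=
  {y | φ (y - x) < r}

/-- `E` satisfies the `rW_φ`-condition. -/
def rWCond {n : ℕ} (φ : (Fin n → ℝ) → ℝ) (E : Set (Fin n → ℝ)) (r : ℝ) : Prop :=
  ∀ x ∈ frontier E, ∃ y, wulffBall φ y r ⊆ E ∧ x ∈ frontier (wulffBall φ y r)

/-- The Wulff plaquette `E^r`, the union of all Wulff balls of radius `r` contained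
in `E` (with `E^0 = E`). -/
def plaquette {n : ℕ} (φ : (Fin n → ℝ) → ℝ) (E : Set (Fin n → ℝ)) (r : ℝ) :
    Set (Fin n → ℝ) :=
  if r = 0 then E else ⋃ (x) (_ : wulffBall φ x r ⊆ E), wulffBall φ x r

/-- `R_Ω`: the maximal `R > 0` such that some Wulff ball of radius `R` is contained in `Ω`. -/
def maxInradius {n : ℕ} (φ : (Fin n → ℝ) → ℝ) (Ω : Set (Fin n → ℝ)) : ℝ :=
  sSup {R | 0 < R ∧ ∃ x, wulffBall φ x R ⊆ Ω}

/-- `r_Ω`: the maximal `r > 0` such that `Ω` satisfies the `rW_φ`-condition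
(`0` if there is none, since `sSup ∅ = 0`). -/
def maxRollRadius {n : ℕ} (φ : (Fin n → ℝ) → ℝ) (Ω : Set (Fin n → ℝ)) : ℝ :=
  sSup {r | 0 < r ∧ rWCond φ Ω r}

/-- The set of points of Lebesgue density `1` of `E`. -/
def densityPoints {n : ℕ} (E : Set (Fin n → ℝ)) : Set (Fin n → ℝ) :=
  {x | Tendsto (fun r : ℝ => volume (E ∩ Metric.ball x r) / volume (Metric.ball x r))
    (nhdsWithin 0 (Ioi 0)) (nhds 1)}

/-- `E` is a minimizer of problem (10): the constrained isoperimetric problem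
minimizing `P_φ` among measurable subsets of `Ω` of prescribed measure `m`. -/
def IsIsopMinimizer {n : ℕ} (φ : (Fin n → ℝ) → ℝ) (Ω : Set (Fin n → ℝ)) (m : ℝ)
    (E : Set (Fin n → ℝ)) : Prop :=
  MeasurableSet E ∧ E ⊆ Ω ∧ (volume E).toReal = m ∧
    ∀ F, MeasurableSet F → F ⊆ Ω → (volume F).toReal = m →
      anisoPerimeter φ E ≤ anisoPerimeter φ F

/-- The Euclidean norm on `ℝ²`. -/
def euclNorm (v : Fin 2 → ℝ) : ℝ := Real.sqrt (v 0 ^ 2 + v 1 ^ 2)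

/-- The crystalline norm `φ(ν) = |ν₁| + |ν₂|` on `ℝ²`. -/
def crysNorm (v : Fin 2 → ℝ) : ℝ := |v 0| + |v 1|

/-- The open unit square `(0,1)² ⊆ ℝ²`. -/
def unitSquare : Set (Fin 2 → ℝ) := univ.pi fun _ => Ioo (0 : ℝ) 1

/-- The closed unit square `[0,1]² ⊆ ℝ²`. -/
def closedUnitSquare : Set (Fin 2 → ℝ) := univ.pi fun _ => Icc (0 : ℝ) 1

/-- `j` is the essential supremum `‖u‖_∞` of `u`. -/
def IsEssSup (u : (Fin 2 → ℝ) → ℝ) (j : ℕ) : Prop :=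
  (∀ᵐ x ∂volume, u x ≤ (j : ℝ)) ∧ ∀ c : ℝ, (∀ᵐ x ∂volume, u x ≤ c) → (j : ℝ) ≤ c

/-- A pairing of the first-order data of two functions on the plane. -/
def gradPair (ξ : Fin 2 → (Fin 2 → ℝ) → ℝ) (ψ : (Fin 2 → ℝ) → ℝ) (x : Fin 2 → ℝ) : ℝ :=
  ∑ i, ξ i x * fderiv ℝ ψ x (Pi.single i 1)

/-- The mollification of `w` by a bump function. -/
def mollify (φ : ContDiffBump (0 : Fin 2 → ℝ)) (w : (Fin 2 → ℝ) → ℝ) : (Fin 2 → ℝ) → ℝ :=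
  convolution (φ.normed volume) w (ContinuousLinearMap.lsmul ℝ ℝ) volume

lemma mollify_apply (φ : ContDiffBump (0 : Fin 2 → ℝ)) (w : (Fin 2 → ℝ) → ℝ) (x : Fin 2 → ℝ) :
    mollify φ w x = ∫ t, φ.normed volume (x - t) * w t := by
  simp only [mollify, convolution_eq_swap, ContinuousLinearMap.lsmul_apply, smul_eq_mul]

lemma contDiff_mollify (φ : ContDiffBump (0 : Fin 2 → ℝ)) {w : (Fin 2 → ℝ) → ℝ}
    (hw : LocallyIntegrable w) : ContDiff ℝ 1 (mollify φ w) :=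
  φ.hasCompactSupport_normed.contDiff_convolution_left _ (φ.contDiff_normed (n := 1)) hw

lemma hasCompactSupport_mollify (φ : ContDiffBump (0 : Fin 2 → ℝ)) {w : (Fin 2 → ℝ) → ℝ}
    (hw : HasCompactSupport w) : HasCompactSupport (mollify φ w) :=
  φ.hasCompactSupport_normed.convolution _ hw

lemma continuous_fderiv_normed (φ : ContDiffBump (0 : Fin 2 → ℝ)) :
    Continuous (fderiv ℝ (φ.normed volume)) :=
  (φ.contDiff_normed (n := 1)).continuous_fderiv one_ne_zero

lemma fderiv_mollify (φ : ContDiffBump (0 : Fin 2 → ℝ)) {w : (Fin 2 → ℝ) → ℝ}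
    (hw : LocallyIntegrable w) (x v : Fin 2 → ℝ) :
    fderiv ℝ (mollify φ w) x v = ∫ t, fderiv ℝ (φ.normed volume) (x - t) v * w t := by
  have h := φ.hasCompactSupport_normed.hasFDerivAt_convolution_left
    (ContinuousLinearMap.lsmul ℝ ℝ) (φ.contDiff_normed (n := 1) (μ := volume)) hw x
  have h2 : fderiv ℝ (mollify φ w) x = _ := h.fderiv
  rw [h2, convolution_eq_swap, ContinuousLinearMap.integral_apply]
  · simp [ContinuousLinearMap.precompL_apply]
  · have : ConvolutionExists (fderiv ℝ (φ.normed volume)) w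
        ((ContinuousLinearMap.lsmul ℝ ℝ).precompL (Fin 2 → ℝ)) volume :=
      (φ.hasCompactSupport_normed.fderiv ℝ).convolutionExists_left _
        (continuous_fderiv_normed φ) hw
    exact (this x).integrable_swap

lemma fderiv_normed_neg (φ : ContDiffBump (0 : Fin 2 → ℝ)) (x v : Fin 2 → ℝ) :
    fderiv ℝ (φ.normed volume) (-x) v = - fderiv ℝ (φ.normed volume) x v := by
  have h : (fun y => φ.normed (volume : Measure (Fin 2 → ℝ)) (-y)) = φ.normed volume := by
    funext y; exact φ.normed_neg y
  have h1 : HasFDerivAt (φ.normed (volume : Measure (Fin 2 → ℝ)))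
      (fderiv ℝ (φ.normed volume) (-x)) (-x) :=
    ((φ.contDiff_normed (n := 1)).differentiable one_ne_zero _).hasFDerivAt
  have h2 := h1.comp x (hasFDerivAt_id x).neg
  have h3 : (φ.normed (volume : Measure (Fin 2 → ℝ)) ∘ Neg.neg) = φ.normed volume := h
  rw [h3] at h2
  rw [h2.fderiv]; simp

lemma integral_mul_fderiv_mollify (φ : ContDiffBump (0 : Fin 2 → ℝ)) {u w : (Fin 2 → ℝ) → ℝ}
    (hu : Integrable u) (hw : Integrable w) (v : Fin 2 → ℝ) :
    ∫ x, u x * fderiv ℝ (mollify φ w) x v = - ∫ x, w x * fderiv ℝ (mollify φ u) x v := by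
  simp_rw [fderiv_mollify φ hu.locallyIntegrable, fderiv_mollify φ hw.locallyIntegrable,
    ← integral_const_mul]
  rw [integral_integral_swap, ← integral_neg]
  · congr 1; funext t
    rw [← integral_neg]
    congr 1; funext x
    rw [← neg_sub t x, fderiv_normed_neg]; ring
  · have hc := continuous_fderiv_normed φ
    obtain ⟨C, hC⟩ := (φ.hasCompactSupport_normed (μ := volume)).fderiv ℝ
      |>.exists_bound_of_continuous hc
    have h1 : Integrable (fun p : (Fin 2 → ℝ) × (Fin 2 → ℝ) => u p.1 * w p.2)
        (volume.prod volume) := hu.mul_prod hw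
    have h2 := h1.bdd_mul (c := C * ‖v‖)
      (f := fun p : (Fin 2 → ℝ) × (Fin 2 → ℝ) => fderiv ℝ (φ.normed volume) (p.1 - p.2) v) ?_ ?_
    · refine h2.congr (Eventually.of_forall fun p => ?_)
      simp only [Function.uncurry]; ring
    · have : Continuous fun p : (Fin 2 → ℝ) × (Fin 2 → ℝ) =>
          fderiv ℝ (φ.normed volume) (p.1 - p.2) v := by fun_prop
      exact this.aestronglyMeasurable
    · exact Eventually.of_forall fun p =>
        (ContinuousLinearMap.le_opNorm _ _).trans (by gcongr; exact hC _)

lemma mollify_pair_sq_le (φ : ContDiffBump (0 : Fin 2 → ℝ)) {ξ : Fin 2 → (Fin 2 → ℝ) → ℝ}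
    (hint : ∀ i, Integrable (ξ i)) (hb : ∀ x, ξ 0 x ^ 2 + ξ 1 x ^ 2 ≤ 1) (x : Fin 2 → ℝ) :
    mollify φ (ξ 0) x ^ 2 + mollify φ (ξ 1) x ^ 2 ≤ 1 := by
  set a := mollify φ (ξ 0) x with ha
  set b := mollify φ (ξ 1) x with hb'
  have hi : ∀ i, Integrable (fun t => φ.normed volume (x - t) * ξ i t) := fun i => by
    have := φ.hasCompactSupport_normed.convolutionExists_left
      (ContinuousLinearMap.lsmul ℝ ℝ) (φ.continuous_normed (μ := volume))
      (hint i).locallyIntegrable x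
    simpa using this.integrable_swap
  have key : a ^ 2 + b ^ 2 ≤ √(a ^ 2 + b ^ 2) := by
    have h1 : a ^ 2 + b ^ 2 = ∫ t, φ.normed volume (x - t) * (a * ξ 0 t + b * ξ 1 t) := by
      have : (fun t => φ.normed volume (x - t) * (a * ξ 0 t + b * ξ 1 t)) = fun t =>
          a * (φ.normed volume (x - t) * ξ 0 t) + b * (φ.normed volume (x - t) * ξ 1 t) := by
        funext t; ring
      rw [this, integral_add ((hi 0).const_mul a) ((hi 1).const_mul b), integral_const_mul,
        integral_const_mul, ← mollify_apply, ← mollify_apply]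
      ring
    have h2 : ∫ t, φ.normed volume (x - t) * √(a ^ 2 + b ^ 2) = √(a ^ 2 + b ^ 2) := by
      rw [integral_mul_const, integral_sub_left_eq_self (fun t => φ.normed volume t),
        φ.integral_normed, one_mul]
    rw [h1]
    conv_rhs => rw [← h1, ← h2]
    refine integral_mono ?_ ?_ fun t => ?_
    · have := ((hi 0).const_mul a).add ((hi 1).const_mul b)
      refine this.congr (Eventually.of_forall fun t => ?_)
      simp only [Pi.add_apply]; ring
    · exact (φ.integrable_normed.comp_sub_left x).mul_const _
    · refine mul_le_mul_of_nonneg_left ?_ (φ.nonneg_normed _)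
      refine Real.le_sqrt_of_sq_le ?_
      nlinarith [sq_nonneg (a * ξ 1 t - b * ξ 0 t), hb t, sq_nonneg a, sq_nonneg b]
  have h0 : 0 ≤ a ^ 2 + b ^ 2 := by positivity
  have := Real.sq_sqrt h0
  nlinarith [Real.sqrt_nonneg (a ^ 2 + b ^ 2)]

/-- Testing the gradient of a mollification against a bounded measurable field. -/
lemma ofReal_neg_integral_gradPair_le (φ : ContDiffBump (0 : Fin 2 → ℝ)) {u : (Fin 2 → ℝ) → ℝ}
    (hu : Integrable u) {ξ : Fin 2 → (Fin 2 → ℝ) → ℝ} (hint : ∀ i, Integrable (ξ i))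
    (hcs : ∀ i, HasCompactSupport (ξ i)) (hb : ∀ x, ξ 0 x ^ 2 + ξ 1 x ^ 2 ≤ 1) :
    ENNReal.ofReal (- ∫ x, gradPair ξ (mollify φ u) x) ≤ anisoTV euclNorm u := by
  let η : (Fin 2 → ℝ) → (Fin 2 → ℝ) := fun x i => mollify φ (ξ i) x
  have hη1 : ContDiff ℝ 1 η := contDiff_pi.2 fun i => contDiff_mollify φ (hint i).locallyIntegrable
  have hη2 : HasCompactSupport η := by
    have h : ∀ i, HasCompactSupport (mollify φ (ξ i)) := fun i =>
      hasCompactSupport_mollify φ (hcs i)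
    refine HasCompactSupport.intro ((h 0).isCompact.union (h 1).isCompact) fun x hx => ?_
    funext i
    fin_cases i
    · change mollify φ (ξ 0) x = 0
      exact image_eq_zero_of_notMem_tsupport fun h => hx (Or.inl h)
    · change mollify φ (ξ 1) x = 0
      exact image_eq_zero_of_notMem_tsupport fun h => hx (Or.inr h)
  have hη3 : ∀ x, euclNorm (η x) ≤ 1 := fun x =>
    Real.sqrt_le_one.2 (mollify_pair_sq_le φ hint hb x)
  have hdiv : ∀ x, diverg η x = ∑ i, fderiv ℝ (mollify φ (ξ i)) x (Pi.single i 1) := by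
    intro x
    refine Finset.sum_congr rfl fun i _ => ?_
    have : HasFDerivAt η (ContinuousLinearMap.pi fun i => fderiv ℝ (mollify φ (ξ i)) x) x :=
      hasFDerivAt_pi.2 fun i => ((contDiff_mollify φ
        (hint i).locallyIntegrable).differentiable one_ne_zero x).hasFDerivAt
    rw [this.fderiv]; rfl
  have hcd : ∀ w : (Fin 2 → ℝ) → ℝ, LocallyIntegrable w → ∀ v,
      Continuous fun x => fderiv ℝ (mollify φ w) x v := fun w hw v =>
    ((contDiff_mollify φ hw).continuous_fderiv one_ne_zero).clm_apply continuous_const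
  have key : ∫ x, u x * diverg η x = - ∫ x, gradPair ξ (mollify φ u) x := by
    simp_rw [hdiv, gradPair, Finset.mul_sum]
    rw [integral_finsetSum, integral_finsetSum, ← Finset.sum_neg_distrib]
    · exact Finset.sum_congr rfl fun i _ => integral_mul_fderiv_mollify φ hu (hint i) _
    · intro i _
      obtain ⟨C, hC⟩ := ((hcs i).isCompact).exists_bound_of_continuousOn
        (hcd u hu.locallyIntegrable (Pi.single i 1)).continuousOn
      have h1 : Integrable (fun x => (tsupport (ξ i)).indicator
          (fun x => fderiv ℝ (mollify φ u) x (Pi.single i 1)) x * ξ i x) := by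
        refine (hint i).bdd_mul (c := max C 0) ?_ (Eventually.of_forall fun x => ?_)
        · exact ((hcd u hu.locallyIntegrable _).aestronglyMeasurable).indicator
            (isClosed_tsupport _).measurableSet
        · by_cases hx : x ∈ tsupport (ξ i)
          · simp only [indicator_of_mem hx]; exact (hC x hx).trans (le_max_left _ _)
          · simp [indicator_of_notMem hx]
      refine h1.congr (Eventually.of_forall fun x => ?_)
      by_cases hx : x ∈ tsupport (ξ i)
      · simp only [indicator_of_mem hx]; ring
      · simp [image_eq_zero_of_notMem_tsupport hx]
    · intro i _
      have hc := hcd (ξ i) (hint i).locallyIntegrable (Pi.single i 1)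
      have hs : HasCompactSupport fun x => fderiv ℝ (mollify φ (ξ i)) x (Pi.single i 1) :=
        (hasCompactSupport_mollify φ (hcs i)).fderiv_apply (𝕜 := ℝ) _
      obtain ⟨C, hC⟩ := hs.exists_bound_of_continuous hc
      refine (hu.bdd_mul (c := C) hc.aestronglyMeasurable (Eventually.of_forall hC)).congr
        (Eventually.of_forall fun x => ?_)
      ring
  rw [← key]
  exact le_iSup₂_of_le η ⟨hη1, hη2, hη3⟩ le_rfl

/-- A measurable field of Euclidean norm at most one with locally integrable weak divergence. -/
structure IsCalib (ξ : Fin 2 → (Fin 2 → ℝ) → ℝ) (g : (Fin 2 → ℝ) → ℝ) : Prop where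
  meas : ∀ i, Measurable (ξ i)
  bound : ∀ x, ξ 0 x ^ 2 + ξ 1 x ^ 2 ≤ 1
  locInt : LocallyIntegrable g
  weak : ∀ ψ : (Fin 2 → ℝ) → ℝ, ContDiff ℝ 1 ψ → HasCompactSupport ψ →
    ∫ x, gradPair ξ ψ x = - ∫ x, g x * ψ x

/-- A continuous trapezoid supported in `[0,1]`. -/
def trapezoid (κ t : ℝ) : ℝ := max 0 (min 1 (min (t / κ) ((1 - t) / κ)))

/-- The primitive of the trapezoid: a `C¹` step. -/
def ramp (κ t : ℝ) : ℝ := ∫ s in (0 : ℝ)..t, trapezoid κ s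

lemma continuous_trapezoid (κ : ℝ) : Continuous (trapezoid κ) := by
  unfold trapezoid; fun_prop

lemma trapezoid_nonneg (κ t : ℝ) : 0 ≤ trapezoid κ t := le_max_left _ _

lemma trapezoid_le_one (κ t : ℝ) : trapezoid κ t ≤ 1 :=
  max_le zero_le_one (min_le_left _ _)

lemma trapezoid_eq_zero {κ t : ℝ} (hκ : 0 < κ) (h : t ≤ 0 ∨ 1 ≤ t) : trapezoid κ t = 0 := by
  refine max_eq_left ((min_le_right _ _).trans ?_)
  rcases h with h | h
  · exact (min_le_left _ _).trans (div_nonpos_of_nonpos_of_nonneg h hκ.le)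
  · exact (min_le_right _ _).trans (div_nonpos_of_nonpos_of_nonneg (by linarith) hκ.le)

lemma hasDerivAt_ramp (κ t : ℝ) : HasDerivAt (ramp κ) (trapezoid κ t) t :=
  intervalIntegral.integral_hasDerivAt_right ((continuous_trapezoid κ).intervalIntegrable _ _)
    ((continuous_trapezoid κ).stronglyMeasurableAtFilter _ _) (continuous_trapezoid κ).continuousAt

lemma contDiff_ramp (κ : ℝ) : ContDiff ℝ 1 (ramp κ) := by
  rw [contDiff_one_iff_deriv]
  refine ⟨fun t => (hasDerivAt_ramp κ t).differentiableAt, ?_⟩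
  have : deriv (ramp κ) = trapezoid κ := funext fun t => (hasDerivAt_ramp κ t).deriv
  rw [this]; exact continuous_trapezoid κ

lemma monotone_ramp (κ : ℝ) : Monotone (ramp κ) :=
  monotone_of_hasDerivAt_nonneg (hasDerivAt_ramp κ) (trapezoid_nonneg κ)

lemma ramp_of_nonpos {κ t : ℝ} (hκ : 0 < κ) (h : t ≤ 0) : ramp κ t = 0 := by
  refine intervalIntegral.integral_zero_ae (Eventually.of_forall fun s hs => ?_)
  rw [uIoc_of_ge h] at hs
  exact trapezoid_eq_zero hκ (Or.inl hs.2)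

lemma ramp_of_one_le {κ t : ℝ} (hκ : 0 < κ) (h : 1 ≤ t) : ramp κ t = ramp κ 1 := by
  have h1 := intervalIntegral.integral_add_adjacent_intervals
    ((continuous_trapezoid κ).intervalIntegrable (μ := volume) 0 1)
    ((continuous_trapezoid κ).intervalIntegrable (μ := volume) 1 t)
  have h2 : ∫ s in (1 : ℝ)..t, trapezoid κ s = 0 := by
    refine intervalIntegral.integral_zero_ae (Eventually.of_forall fun s hs => ?_)
    rw [uIoc_of_le h] at hs
    exact trapezoid_eq_zero hκ (Or.inr hs.1.le)
  unfold ramp; rw [← h1, h2, add_zero]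

lemma ramp_one_le (κ : ℝ) : ramp κ 1 ≤ 1 := by
  have := intervalIntegral.integral_mono_on (μ := volume) (zero_le_one' ℝ)
    ((continuous_trapezoid κ).intervalIntegrable 0 1)
    (continuous_const (y := (1 : ℝ)).intervalIntegrable 0 1) fun t _ => trapezoid_le_one κ t
  simpa [ramp] using this

lemma le_ramp_one {κ : ℝ} (hκ : 0 < κ) (hκ2 : κ < 1 / 2) : 1 - 2 * κ ≤ ramp κ 1 := by
  have hi : ∀ a b : ℝ, IntervalIntegrable (trapezoid κ) volume a b :=
    fun a b => (continuous_trapezoid κ).intervalIntegrable a b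
  have h1 : (1 - κ) - κ ≤ ∫ s in κ..(1 - κ), trapezoid κ s := by
    have := intervalIntegral.integral_mono_on (μ := volume) (a := κ) (b := 1 - κ) (by linarith)
      (continuous_const (y := (1 : ℝ)).intervalIntegrable _ _) (hi _ _) fun t ht => by
        refine le_max_of_le_right (le_min le_rfl (le_min ?_ ?_))
        · rw [le_div_iff₀ hκ]; linarith [ht.1]
        · rw [le_div_iff₀ hκ]; linarith [ht.2]
    simpa using this
  have h2 : 0 ≤ ∫ s in (0 : ℝ)..κ, trapezoid κ s :=
    intervalIntegral.integral_nonneg hκ.le fun t _ => trapezoid_nonneg κ t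
  have h3 : 0 ≤ ∫ s in (1 - κ)..1, trapezoid κ s :=
    intervalIntegral.integral_nonneg (by linarith) fun t _ => trapezoid_nonneg κ t
  have h4 := intervalIntegral.integral_add_adjacent_intervals (hi 0 κ) (hi κ (1 - κ))
  have h5 := intervalIntegral.integral_add_adjacent_intervals (hi 0 (1 - κ)) (hi (1 - κ) 1)
  unfold ramp; linarith

lemma ramp_nonneg {κ : ℝ} (hκ : 0 < κ) (t : ℝ) : 0 ≤ ramp κ t := by
  rcases le_total t 0 with h | h
  · exact (ramp_of_nonpos hκ h).ge
  · rw [← ramp_of_nonpos hκ le_rfl]; exact monotone_ramp κ h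

lemma ramp_le_one {κ : ℝ} (hκ : 0 < κ) (t : ℝ) : ramp κ t ≤ 1 := by
  refine le_trans ?_ (ramp_one_le κ)
  rcases le_total 1 t with h | h
  · exact (ramp_of_one_le hκ h).le
  · exact monotone_ramp κ h

lemma ramp_nat_sub {κ : ℝ} (hκ : 0 < κ) (k j : ℕ) :
    ramp κ (k - j) = if (j : ℝ) + 1 ≤ k then ramp κ 1 else 0 := by
  split_ifs with h
  · exact ramp_of_one_le hκ (by linarith)
  · refine ramp_of_nonpos hκ ?_
    have : k ≤ j := by
      by_contra h'
      exact h (by exact_mod_cast not_le.1 h')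
    have : (k : ℝ) ≤ j := by exact_mod_cast this
    linarith

lemma sum_trapezoid_sq_le {κ : ℝ} (hκ : 0 < κ) (J : ℕ) (t : ℝ) (a b : ℕ → ℝ)
    (hab : ∀ j, a j ^ 2 + b j ^ 2 ≤ 1) :
    (∑ j ∈ Finset.range J, trapezoid κ (t - j) * a j) ^ 2 +
      (∑ j ∈ Finset.range J, trapezoid κ (t - j) * b j) ^ 2 ≤ 1 := by
  by_cases h : ∃ j₀ ∈ Finset.range J, trapezoid κ (t - j₀) ≠ 0
  · obtain ⟨j₀, hj₀, hne⟩ := h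
    have hj : 0 < t - j₀ ∧ t - j₀ < 1 := by
      constructor <;> by_contra h' <;> push Not at h'
      · exact hne (trapezoid_eq_zero hκ (Or.inl h'))
      · exact hne (trapezoid_eq_zero hκ (Or.inr h'))
    have hz : ∀ j : ℕ, j ≠ j₀ → trapezoid κ (t - j) = 0 := by
      intro j hjj
      refine trapezoid_eq_zero hκ ?_
      rcases lt_or_gt_of_ne hjj with h' | h'
      · right
        have : (j : ℝ) + 1 ≤ j₀ := by exact_mod_cast h'
        linarith
      · left
        have : (j₀ : ℝ) + 1 ≤ j := by exact_mod_cast h'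
        linarith
    rw [Finset.sum_eq_single_of_mem j₀ hj₀ fun j _ hjj => by rw [hz j hjj, zero_mul],
      Finset.sum_eq_single_of_mem j₀ hj₀ fun j _ hjj => by rw [hz j hjj, zero_mul]]
    have h0 := trapezoid_nonneg κ (t - j₀)
    have h1 := trapezoid_le_one κ (t - j₀)
    have h2 : trapezoid κ (t - j₀) ^ 2 ≤ 1 := by nlinarith
    nlinarith [hab j₀, sq_nonneg (a j₀), sq_nonneg (b j₀)]
  · push Not at h
    rw [Finset.sum_eq_zero fun j hj => by rw [h j hj, zero_mul],
      Finset.sum_eq_zero fun j hj => by rw [h j hj, zero_mul]]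
    norm_num

lemma IsCalib.abs_le {ξ : Fin 2 → (Fin 2 → ℝ) → ℝ} {g : (Fin 2 → ℝ) → ℝ} (h : IsCalib ξ g)
    (i : Fin 2) (x : Fin 2 → ℝ) : ‖ξ i x‖ ≤ 1 := by
  have := h.bound x
  rw [Real.norm_eq_abs, abs_le_one_iff_mul_self_le_one]
  fin_cases i <;> simp only [Fin.zero_eta, Fin.mk_one] <;>
    nlinarith [sq_nonneg (ξ 0 x), sq_nonneg (ξ 1 x)]

lemma IsCalib.integrable_gradPair {ξ : Fin 2 → (Fin 2 → ℝ) → ℝ} {g : (Fin 2 → ℝ) → ℝ}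
    (h : IsCalib ξ g) {ψ : (Fin 2 → ℝ) → ℝ} (hψ : ContDiff ℝ 1 ψ) (hs : HasCompactSupport ψ) :
    Integrable (gradPair ξ ψ) := by
  refine integrable_finsetSum _ fun i _ => ?_
  refine Integrable.bdd_mul (c := 1) ?_ (h.meas i).aestronglyMeasurable
    (Eventually.of_forall (h.abs_le i))
  exact ((hψ.continuous_fderiv one_ne_zero).clm_apply
    continuous_const).integrable_of_hasCompactSupport (hs.fderiv_apply (𝕜 := ℝ) _)

/-- Approximate lower bound of the total variation by calibrations of the layers. -/
lemma ofReal_sum_mollify_le {κ : ℝ} (hκ : 0 < κ) (φ : ContDiffBump (0 : Fin 2 → ℝ))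
    {u : (Fin 2 → ℝ) → ℝ} (hu : Integrable u) (hus : HasCompactSupport u) (J : ℕ)
    {ξ : ℕ → Fin 2 → (Fin 2 → ℝ) → ℝ} {g : ℕ → (Fin 2 → ℝ) → ℝ}
    (hc : ∀ j, IsCalib (ξ j) (g j)) :
    ENNReal.ofReal (∑ j ∈ Finset.range J, ∫ x, g j x * ramp κ (mollify φ u x - j)) ≤
      anisoTV euclNorm u := by
  set v := mollify φ u with hv
  have hv1 : ContDiff ℝ 1 v := contDiff_mollify φ hu.locallyIntegrable
  have hv2 : HasCompactSupport v := hasCompactSupport_mollify φ hus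
  let Ξ : Fin 2 → (Fin 2 → ℝ) → ℝ := fun i x =>
    ∑ j ∈ Finset.range J, trapezoid κ (v x - j) * ξ j i x
  have hΞs : ∀ i x, v x = 0 → Ξ i x = 0 := fun i x hx => by
    refine Finset.sum_eq_zero fun j _ => ?_
    rw [hx, trapezoid_eq_zero hκ (Or.inl (by simp)), zero_mul]
  have hΞb : ∀ x, Ξ 0 x ^ 2 + Ξ 1 x ^ 2 ≤ 1 := fun x =>
    sum_trapezoid_sq_le hκ J (v x) (fun j => ξ j 0 x) (fun j => ξ j 1 x) fun j => (hc j).bound x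
  have hΞc : ∀ i, HasCompactSupport (Ξ i) := fun i =>
    hv2.mono fun x hx hx' => hx (hΞs i x hx')
  have hΞm : ∀ i, Measurable (Ξ i) := fun i =>
    Finset.measurable_fun_sum _ fun j _ =>
      ((continuous_trapezoid κ).measurable.comp
        (hv1.continuous.measurable.sub_const _)).mul ((hc j).meas i)
  have hΞ1 : ∀ i x, ‖Ξ i x‖ ≤ 1 := fun i x => by
    have := hΞb x
    rw [Real.norm_eq_abs, abs_le_one_iff_mul_self_le_one]
    fin_cases i <;> simp only [Fin.zero_eta, Fin.mk_one] <;>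
      nlinarith [sq_nonneg (Ξ 0 x), sq_nonneg (Ξ 1 x)]
  have hΞi : ∀ i, Integrable (Ξ i) := fun i => by
    have h1 : IntegrableOn (Ξ i) (tsupport (Ξ i)) :=
      Measure.integrableOn_of_bounded (hΞc i).isCompact.measure_lt_top.ne
        (hΞm i).aestronglyMeasurable (Eventually.of_forall (hΞ1 i))
    exact (integrableOn_iff_integrable_of_support_subset (subset_tsupport _)).1 h1
  have hcomp1 : ∀ j : ℕ, ContDiff ℝ 1 fun x => ramp κ (v x - j) := fun j =>
    (contDiff_ramp κ).comp (hv1.sub contDiff_const)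
  have hcomp2 : ∀ j : ℕ, HasCompactSupport fun x => ramp κ (v x - j) := fun j =>
    hv2.mono fun x hx hx' => hx (by
      simp only [hx']; exact ramp_of_nonpos hκ (by simp))
  have hgp : ∀ x, gradPair Ξ v x =
      ∑ j ∈ Finset.range J, gradPair (ξ j) (fun x => ramp κ (v x - j)) x := by
    intro x
    have hf : ∀ j : ℕ, fderiv ℝ (fun x => ramp κ (v x - j)) x =
        trapezoid κ (v x - j) • fderiv ℝ v x := fun j => by
      have h1 := ((hv1.differentiable one_ne_zero x).hasFDerivAt).sub_const (j : ℝ)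
      exact ((hasDerivAt_ramp κ (v x - j)).comp_hasFDerivAt x h1).fderiv
    simp only [gradPair, Ξ, hf, Finset.sum_mul]
    rw [Finset.sum_comm]
    refine Finset.sum_congr rfl fun j _ => Finset.sum_congr rfl fun i _ => ?_
    simp only [smul_apply, smul_eq_mul]; ring
  have h := ofReal_neg_integral_gradPair_le φ hu hΞi hΞc hΞb
  rw [← hv] at h
  simp_rw [hgp] at h
  rw [integral_finsetSum _ fun j _ => (hc j).integrable_gradPair (hcomp1 j) (hcomp2 j),
    ← Finset.sum_neg_distrib] at h
  refine le_trans (le_of_eq ?_) h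
  congr 1
  refine Finset.sum_congr rfl fun j _ => ?_
  rw [(hc j).weak _ (hcomp1 j) (hcomp2 j), neg_neg]

open scoped Pointwise in
/-- Lower bound of the total variation of an integer valued function by calibrations of its
superlevel sets. -/
lemma ofReal_sum_calib_le {u : (Fin 2 → ℝ) → ℝ} (hu : Integrable u) (hus : HasCompactSupport u)
    (hnat : ∀ᵐ x, ∃ k : ℕ, u x = k) (J : ℕ)
    {ξ : ℕ → Fin 2 → (Fin 2 → ℝ) → ℝ} {g : ℕ → (Fin 2 → ℝ) → ℝ}
    (hc : ∀ j, IsCalib (ξ j) (g j)) :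
    ENNReal.ofReal (∑ j ∈ Finset.range J, ∫ x in {x | (j : ℝ) + 1 ≤ u x}, g j x) ≤
      anisoTV euclNorm u := by
  have hE : ∀ j : ℕ, NullMeasurableSet {x | (j : ℝ) + 1 ≤ u x} := fun j =>
    nullMeasurableSet_le aemeasurable_const hu.aemeasurable
  let φ : ℕ → ContDiffBump (0 : Fin 2 → ℝ) := fun n =>
    ⟨1 / (2 * ((n : ℝ) + 1)), 1 / ((n : ℝ) + 1), by positivity, by
      apply one_div_lt_one_div_of_lt <;> linarith [(n.cast_nonneg : (0 : ℝ) ≤ n)]⟩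
  have hφ0 : Tendsto (fun n => (φ n).rOut) atTop (nhds 0) := tendsto_one_div_add_atTop_nhds_zero_nat
  have hφ1 : ∀ n, (φ n).rOut ≤ 1 := fun n => by
    change 1 / ((n : ℝ) + 1) ≤ 1
    rw [div_le_one (by positivity)]; linarith [(n.cast_nonneg : (0 : ℝ) ≤ n)]
  have hlim : ∀ᵐ x, Tendsto (fun n => mollify (φ n) u x) atTop (nhds (u x)) :=
    ContDiffBump.ae_convolution_tendsto_right_of_locallyIntegrable (K := 2) hφ0
      (Eventually.of_forall fun n => by
        change 1 / ((n : ℝ) + 1) ≤ 2 * (1 / (2 * ((n : ℝ) + 1)))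
        apply le_of_eq; field_simp) hu.locallyIntegrable
  set K := Metric.closedBall (0 : Fin 2 → ℝ) 1 + tsupport u with hK
  have hKc : IsCompact K := (isCompact_closedBall _ _).add hus.isCompact
  have hsupp : ∀ n x, x ∉ K → mollify (φ n) u x = 0 := by
    intro n x hx
    by_contra hne
    have := support_convolution_subset (ContinuousLinearMap.lsmul ℝ ℝ) (μ := volume)
      (f := (φ n).normed volume) (g := u) hne
    refine hx (Set.add_subset_add ?_ (subset_tsupport u) this)
    rw [(φ n).support_normed_eq]
    exact Metric.ball_subset_closedBall.trans (Metric.closedBall_subset_closedBall (hφ1 n))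
  set S := ∑ j ∈ Finset.range J, ∫ x in {x | (j : ℝ) + 1 ≤ u x}, g j x with hS
  have main : ∀ κ : ℝ, 0 < κ → ENNReal.ofReal (ramp κ 1 * S) ≤ anisoTV euclNorm u := by
    intro κ hκ
    have ht : Tendsto (fun n => ∑ j ∈ Finset.range J,
        ∫ x, g j x * ramp κ (mollify (φ n) u x - j)) atTop (nhds (ramp κ 1 * S)) := by
      rw [hS, Finset.mul_sum]
      refine tendsto_finsetSum _ fun j _ => ?_
      have hval : ramp κ 1 * ∫ x in {x | (j : ℝ) + 1 ≤ u x}, g j x =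
          ∫ x, g j x * ramp κ (u x - j) := by
        rw [← integral_const_mul, ← integral_indicator₀ (hE j)]
        refine integral_congr_ae ?_
        filter_upwards [hnat] with x ⟨k, hk⟩
        rw [hk, ramp_nat_sub hκ]
        by_cases h : (j : ℝ) + 1 ≤ k
        · rw [if_pos h, indicator_of_mem (by simpa [hk] using h)]; ring
        · rw [if_neg h, indicator_of_notMem (by simpa [hk] using h)]; ring
      rw [hval]
      refine tendsto_integral_of_dominated_convergence (fun x => K.indicator (fun x => ‖g j x‖) x)
        ?_ ?_ ?_ ?_
      · intro n
        refine (hc j).locInt.aestronglyMeasurable.mul ?_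
        exact ((contDiff_ramp κ).continuous.comp
          ((contDiff_mollify (φ n) hu.locallyIntegrable).continuous.sub
            continuous_const)).aestronglyMeasurable
      · exact (integrable_indicator_iff hKc.measurableSet).2
          ((hc j).locInt.integrableOn_isCompact hKc).norm
      · refine fun n => Eventually.of_forall fun x => ?_
        by_cases hx : x ∈ K
        · rw [indicator_of_mem hx, norm_mul, Real.norm_eq_abs (ramp _ _),
            abs_of_nonneg (ramp_nonneg hκ _)]
          exact mul_le_of_le_one_right (norm_nonneg _) (ramp_le_one hκ _)
        · rw [indicator_of_notMem hx, hsupp n x hx, ramp_of_nonpos hκ (by simp)]; simp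
      · filter_upwards [hlim] with x hx
        exact ((((contDiff_ramp κ).continuous.tendsto _).comp (hx.sub_const _))).const_mul _
    exact le_of_tendsto ((ENNReal.continuous_ofReal.tendsto _).comp ht)
      (Eventually.of_forall fun n => ofReal_sum_mollify_le hκ (φ n) hu hus J hc)
  have hr : Tendsto (fun n : ℕ => ramp (1 / ((n : ℝ) + 1)) 1) atTop (nhds 1) := by
    have h1 : Tendsto (fun n : ℕ => 1 - 2 * (1 / ((n : ℝ) + 1))) atTop (nhds 1) := by
      simpa using (tendsto_one_div_add_atTop_nhds_zero_nat (𝕜 := ℝ)).const_mul 2 |>.const_sub 1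
    refine tendsto_of_tendsto_of_tendsto_of_le_of_le' h1 tendsto_const_nhds ?_
      (Eventually.of_forall fun n => ramp_one_le _)
    filter_upwards [eventually_ge_atTop 2] with n hn
    refine le_ramp_one (by positivity) ?_
    have : (2 : ℝ) ≤ n := by exact_mod_cast hn
    apply one_div_lt_one_div_of_lt <;> linarith
  have ht : Tendsto (fun n : ℕ => ENNReal.ofReal (ramp (1 / ((n : ℝ) + 1)) 1 * S)) atTop
      (nhds (ENNReal.ofReal S)) := by
    have := (ENNReal.continuous_ofReal.tendsto _).comp (hr.mul_const S)
    simpa [Function.comp_def] using this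
  exact le_of_tendsto ht (Eventually.of_forall fun n => main _ (by positivity))

/-- `F` is an indefinite integral of the locally integrable function `k`. -/
structure IsPrim (F k : ℝ → ℝ) : Prop where
  locInt : LocallyIntegrable k
  eq : ∀ t, F t = F 0 + ∫ s in (0 : ℝ)..t, k s

lemma IsPrim.intervalIntegrable {F k : ℝ → ℝ} (h : IsPrim F k) (a b : ℝ) :
    IntervalIntegrable k volume a b :=
  (h.locInt.integrableOn_isCompact isCompact_uIcc).intervalIntegrable

lemma IsPrim.continuous {F k : ℝ → ℝ} (h : IsPrim F k) : Continuous F := by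
  have : F = fun t => F 0 + ∫ s in (0 : ℝ)..t, k s := funext h.eq
  rw [this]
  exact continuous_const.add (intervalIntegral.continuous_primitive
    (fun a b => h.intervalIntegrable a b) 0)

lemma IsPrim.const_mul {F k : ℝ → ℝ} (h : IsPrim F k) (c : ℝ) :
    IsPrim (fun t => c * F t) fun t => c * k t :=
  ⟨h.locInt.smul c, fun t => by
    rw [intervalIntegral.integral_const_mul, h.eq t]; ring⟩

lemma IsPrim.add {F k G l : ℝ → ℝ} (h : IsPrim F k) (h' : IsPrim G l) :
    IsPrim (fun t => F t + G t) fun t => k t + l t :=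
  ⟨h.locInt.add h'.locInt, fun t => by
    rw [intervalIntegral.integral_add (h.intervalIntegrable _ _) (h'.intervalIntegrable _ _),
      h.eq t, h'.eq t]; ring⟩

lemma isPrim_const (c : ℝ) : IsPrim (fun _ => c) fun _ => 0 :=
  ⟨continuous_const.locallyIntegrable, fun t => by simp⟩

/-- Integration by parts against a compactly supported test function. -/
lemma IsPrim.integral_mul_deriv {F k : ℝ → ℝ} (h : IsPrim F k) {ψ : ℝ → ℝ} (hψ : ContDiff ℝ 1 ψ)
    (hs : HasCompactSupport ψ) : ∫ t, F t * deriv ψ t = - ∫ t, k t * ψ t := by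
  obtain ⟨R, hR0, hR⟩ : ∃ R : ℝ, 0 < R ∧ tsupport ψ ⊆ Ioo (-R) R := by
    obtain ⟨R, hR⟩ := hs.isCompact.isBounded.subset_ball 0
    refine ⟨max R 1, by positivity, fun x hx => ?_⟩
    have := hR hx
    rw [Real.ball_eq_Ioo] at this
    exact ⟨by linarith [this.1, le_max_left R 1], by linarith [this.2, le_max_left R 1]⟩
  have hsub : Ioo (-R) R ⊆ Ioc (-R) R := Ioo_subset_Ioc_self
  have hle : -R ≤ R := by linarith
  have hz : ∀ t, t ∉ Ioc (-R) R → ψ t = 0 := fun t ht =>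
    image_eq_zero_of_notMem_tsupport fun h' => ht (hsub (hR h'))
  have hz' : ∀ t, t ∉ Ioc (-R) R → deriv ψ t = 0 := fun t ht =>
    image_eq_zero_of_notMem_tsupport (f := deriv ψ) fun h' =>
      ht (hsub (hR (closure_minimal (support_deriv_subset) (isClosed_tsupport _) h')))
  have e1 : ∫ t, F t * deriv ψ t = ∫ t in (-R)..R, F t * deriv ψ t := by
    rw [intervalIntegral.integral_of_le hle, setIntegral_eq_integral_of_forall_compl_eq_zero]
    intro t ht; rw [hz' t ht, mul_zero]
  have e2 : ∫ t, k t * ψ t = ∫ t in (-R)..R, k t * ψ t := by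
    rw [intervalIntegral.integral_of_le hle, setIntegral_eq_integral_of_forall_compl_eq_zero]
    intro t ht; rw [hz t ht, mul_zero]
  have hF : F = fun t => F 0 + ∫ s in (0 : ℝ)..t, k s := funext h.eq
  have hk : IntervalIntegrable k volume (-R) R := h.intervalIntegrable _ _
  have h0 : (0 : ℝ) ∈ uIcc (-R) R := by rw [uIcc_of_le hle]; constructor <;> linarith
  have hac1 : AbsolutelyContinuousOnInterval F (-R) R := by
    rw [hF]
    exact (ContDiffOn.absolutelyContinuousOnInterval
      (contDiff_const (c := F 0) (n := 1)).contDiffOn).add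
      (hk.absolutelyContinuousOnInterval_intervalIntegral h0)
  have hac2 : AbsolutelyContinuousOnInterval ψ (-R) R :=
    ContDiffOn.absolutelyContinuousOnInterval hψ.contDiffOn
  have h1 := hac1.integral_mul_deriv_eq_deriv_mul hac2
  rw [hz (-R) (by simp), image_eq_zero_of_notMem_tsupport (f := ψ) (x := R)
    (fun h' => by simpa using hR h'), mul_zero, mul_zero, sub_zero, zero_sub] at h1
  rw [e1, e2, h1]
  congr 1
  refine intervalIntegral.integral_congr_ae ?_
  filter_upwards [LocallyIntegrable.ae_hasDerivAt_integral h.locInt] with t ht _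
  have : HasDerivAt F (k t) t := by
    rw [hF]; exact (ht 0).const_add _
  rw [this.deriv]

/-- Fubini along the `i`-th coordinate of the plane. -/
lemma integral_insertNth (i : Fin 2) {f : (Fin 2 → ℝ) → ℝ} (hf : Integrable f) :
    ∫ x, f x = ∫ z : Fin 1 → ℝ, ∫ t, f (i.insertNth t z) := by
  have hmp := (volume_preserving_piFinSuccAbove (fun _ : Fin 2 => ℝ) i).symm
  rw [← hmp.integral_comp' f]
  change ∫ p, f ((MeasurableEquiv.piFinSuccAbove (fun _ => ℝ) i).symm p)
    ∂((volume : Measure ℝ).prod volume) = _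
  rw [integral_prod_symm]
  · rfl
  · exact (hmp.integrable_comp_emb (MeasurableEquiv.measurableEmbedding _)).2 hf

lemma update_insertNth' (i : Fin 2) (s t : ℝ) (z : Fin 1 → ℝ) :
    Function.update (i.insertNth s z : Fin 2 → ℝ) i t = i.insertNth t z :=
  Fin.update_insertNth (α := fun _ : Fin 2 => ℝ) i s t z

lemma contDiff_insertNth (i : Fin 2) (z : Fin 1 → ℝ) :
    ContDiff ℝ 1 fun t : ℝ => (i.insertNth t z : Fin 2 → ℝ) := by
  refine contDiff_pi.2 fun j => ?_
  rcases Fin.eq_self_or_eq_succAbove i j with rfl | ⟨k, rfl⟩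
  · simpa using (contDiff_fun_id : ContDiff ℝ 1 fun x : ℝ => x)
  · simpa using contDiff_const

/-- A bounded measurable function which is a primitive of `g` on every line in direction `i`
has weak partial derivative `g`. -/
lemma integral_mul_partial (i : Fin 2) {η g : (Fin 2 → ℝ) → ℝ} (hη : Measurable η)
    (hb : ∀ x, ‖η x‖ ≤ 1) (hg : LocallyIntegrable g)
    (hp : ∀ x, IsPrim (fun t => η (Function.update x i t)) fun t => g (Function.update x i t))
    {ψ : (Fin 2 → ℝ) → ℝ} (hψ : ContDiff ℝ 1 ψ) (hs : HasCompactSupport ψ) :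
    ∫ x, η x * fderiv ℝ ψ x (Pi.single i 1) = - ∫ x, g x * ψ x := by
  have hi1 : Integrable fun x => η x * fderiv ℝ ψ x (Pi.single i 1) := by
    refine Integrable.bdd_mul (c := 1) ?_ hη.aestronglyMeasurable (Eventually.of_forall hb)
    exact ((hψ.continuous_fderiv one_ne_zero).clm_apply
      continuous_const).integrable_of_hasCompactSupport (hs.fderiv_apply (𝕜 := ℝ) _)
  have hi2 : Integrable fun x => g x * ψ x := by
    have := hg.integrable_smul_right_of_hasCompactSupport hψ.continuous hs
    simpa [mul_comm] using this
  rw [integral_insertNth i hi1, integral_insertNth i hi2, ← integral_neg]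
  congr 1; funext z
  have hp' := hp (i.insertNth 0 z)
  simp only [update_insertNth'] at hp'
  have hψz : ContDiff ℝ 1 fun t : ℝ => ψ (i.insertNth t z) := hψ.comp (contDiff_insertNth i z)
  have hder : ∀ t, fderiv ℝ ψ (i.insertNth t z) (Pi.single i 1) =
      deriv (fun t : ℝ => ψ (i.insertNth t z)) t := by
    intro t
    have h1 := hasDerivAt_update (i.insertNth 0 z : Fin 2 → ℝ) i t
    have h1' : HasDerivAt (fun s : ℝ => (i.insertNth s z : Fin 2 → ℝ)) (Pi.single i (1 : ℝ)) t := by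
      refine h1.congr_of_eventuallyEq (Eventually.of_forall fun s => ?_)
      exact (update_insertNth' i 0 s z).symm
    exact ((hψ.differentiable one_ne_zero _).hasFDerivAt.comp_hasDerivAt t h1').deriv.symm
  simp_rw [hder]
  refine hp'.integral_mul_deriv hψz ?_
  have hcont : Continuous fun x : Fin 2 → ℝ => x i := continuous_apply i
  refine HasCompactSupport.intro (hs.isCompact.image hcont) fun t ht => ?_
  refine image_eq_zero_of_notMem_tsupport fun h' => ht ⟨_, h', by simp⟩

/-- A bounded field whose components have weak partial derivatives is a calibration. -/
lemma isCalib_of_isPrim {ξ k : Fin 2 → (Fin 2 → ℝ) → ℝ} (hm : ∀ i, Measurable (ξ i))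
    (hb : ∀ x, ξ 0 x ^ 2 + ξ 1 x ^ 2 ≤ 1) (hk : ∀ i, LocallyIntegrable (k i))
    (hp : ∀ i x, IsPrim (fun t => ξ i (Function.update x i t))
      fun t => k i (Function.update x i t)) :
    IsCalib ξ fun x => k 0 x + k 1 x := by
  have hb' : ∀ i x, ‖ξ i x‖ ≤ 1 := fun i x => by
    have := hb x
    rw [Real.norm_eq_abs, abs_le_one_iff_mul_self_le_one]
    fin_cases i <;> simp only [Fin.zero_eta, Fin.mk_one] <;>
      nlinarith [sq_nonneg (ξ 0 x), sq_nonneg (ξ 1 x)]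
  refine ⟨hm, hb, (hk 0).add (hk 1), fun ψ hψ hs => ?_⟩
  have hi : ∀ i, Integrable fun x => k i x * ψ x := fun i => by
    have := (hk i).integrable_smul_right_of_hasCompactSupport hψ.continuous hs
    simpa [mul_comm] using this
  have hi1 : ∀ i, Integrable fun x => ξ i x * fderiv ℝ ψ x (Pi.single i 1) := fun i => by
    refine Integrable.bdd_mul (c := 1) ?_ (hm i).aestronglyMeasurable (Eventually.of_forall (hb' i))
    exact ((hψ.continuous_fderiv one_ne_zero).clm_apply
      continuous_const).integrable_of_hasCompactSupport (hs.fderiv_apply (𝕜 := ℝ) _)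
  simp_rw [gradPair, add_mul]
  rw [integral_finsetSum _ fun i _ => hi1 i, integral_add (hi 0) (hi 1), Fin.sum_univ_two,
    integral_mul_partial 0 (hm 0) (hb' 0) (hk 0) (hp 0) hψ hs,
    integral_mul_partial 1 (hm 1) (hb' 1) (hk 1) (hp 1) hψ hs]
  ring

/-- The length of the part of `S` to the left of `t`. -/
def lengthBelow (S : Set ℝ) (t : ℝ) : ℝ := volume.real (S ∩ Iic t)

section
variable {S : Set ℝ}

lemma volume_ne_top_of_subset_Ioo (hS : S ⊆ Ioo 0 1) : volume S ≠ ⊤ :=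
  measure_ne_top_of_subset hS (by simp)

lemma isPrim_lengthBelow (hm : MeasurableSet S) (hS : S ⊆ Ioo 0 1) :
    IsPrim (lengthBelow S) (S.indicator 1) := by
  refine ⟨((integrable_indicator_iff hm).2
    (integrableOn_const (volume_ne_top_of_subset_Ioo hS))).locallyIntegrable, fun t => ?_⟩
  have h0 : lengthBelow S 0 = 0 := by
    have : S ∩ Iic 0 = ∅ := by
      ext x; simp only [mem_inter_iff, mem_Iic, mem_empty_iff_false, iff_false, not_and, not_le]
      exact fun hx => (hS hx).1
    simp [lengthBelow, this]
  rw [h0, zero_add]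
  rcases le_total 0 t with ht | ht
  · rw [intervalIntegral.integral_of_le ht, integral_indicator_one hm]
    have : S ∩ Ioc 0 t = S ∩ Iic t := by
      ext x; simp only [mem_inter_iff, mem_Iic, mem_Ioc]
      exact ⟨fun h => ⟨h.1, h.2.2⟩, fun h => ⟨h.1, (hS h.1).1, h.2⟩⟩
    rw [Measure.real, Measure.restrict_apply hm, this]; rfl
  · rw [intervalIntegral.integral_of_ge ht, integral_indicator_one hm]
    have h1 : S ∩ Ioc t 0 = ∅ := by
      ext x; simp only [mem_inter_iff, mem_Ioc, mem_empty_iff_false, iff_false, not_and, not_le]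
      exact fun hx _ => (hS hx).1
    have h2 : S ∩ Iic t = ∅ := by
      ext x; simp only [mem_inter_iff, mem_Iic, mem_empty_iff_false, iff_false, not_and, not_le]
      exact fun hx => ht.trans_lt (hS hx).1
    rw [Measure.real, Measure.restrict_apply hm, h1, lengthBelow, h2]; simp

lemma lengthBelow_nonneg (S : Set ℝ) (t : ℝ) : 0 ≤ lengthBelow S t := measureReal_nonneg

lemma lengthBelow_le (hS : S ⊆ Ioo 0 1) (t : ℝ) : lengthBelow S t ≤ volume.real S :=
  measureReal_mono inter_subset_left (volume_ne_top_of_subset_Ioo hS)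

lemma monotone_lengthBelow (hS : S ⊆ Ioo 0 1) : Monotone (lengthBelow S) := fun _ _ h =>
  measureReal_mono (inter_subset_inter_right _ (Iic_subset_Iic.2 h))
    (volume_ne_top_of_subset_Ioo (inter_subset_left.trans hS))

lemma lengthBelow_zero (hS : S ⊆ Ioo 0 1) : lengthBelow S 0 = 0 := by
  have : S ∩ Iic 0 = ∅ := by
    ext x; simp only [mem_inter_iff, mem_Iic, mem_empty_iff_false, iff_false, not_and, not_le]
    exact fun hx => (hS hx).1
  simp [lengthBelow, this]

lemma lengthBelow_one (hS : S ⊆ Ioo 0 1) : lengthBelow S 1 = volume.real S := by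
  rw [lengthBelow, inter_eq_left.2 (show S ⊆ Iic 1 from fun x hx => (hS hx).2.le)]

lemma exists_lengthBelow_eq (hm : MeasurableSet S) (hS : S ⊆ Ioo 0 1) {c : ℝ} (h0 : 0 ≤ c)
    (h1 : c ≤ volume.real S) : ∃ t ∈ Icc (0 : ℝ) 1, lengthBelow S t = c := by
  have := intermediate_value_Icc zero_le_one (isPrim_lengthBelow hm hS).continuous.continuousOn
  rw [lengthBelow_zero hS, lengthBelow_one hS] at this
  exact this ⟨h0, h1⟩

/-- The distribution of `lengthBelow S` on `S` is uniform. -/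
lemma map_lengthBelow (hm : MeasurableSet S) (hS : S ⊆ Ioo 0 1) :
    (volume.restrict S).map (lengthBelow S) = volume.restrict (Ioc 0 (volume.real S)) := by
  have hfin := volume_ne_top_of_subset_Ioo hS
  have hc := (isPrim_lengthBelow hm hS).continuous
  have : IsFiniteMeasure (volume.restrict S) := ⟨by simpa using hfin.lt_top⟩
  refine Measure.ext_of_Iic _ _ fun c => ?_
  rw [Measure.map_apply hc.measurable measurableSet_Iic,
    Measure.restrict_apply (hc.measurable measurableSet_Iic),
    Measure.restrict_apply measurableSet_Iic]
  rcases lt_or_ge c 0 with h | h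
  · have e1 : lengthBelow S ⁻¹' Iic c ∩ S = ∅ := by
      ext x; simp only [mem_inter_iff, mem_preimage, mem_Iic, mem_empty_iff_false, iff_false]
      exact fun hx => by linarith [lengthBelow_nonneg S x, hx.1]
    have e2 : Iic c ∩ Ioc 0 (volume.real S) = ∅ := by
      ext x; simp only [mem_inter_iff, mem_Ioc, mem_Iic, mem_empty_iff_false, iff_false]
      exact fun hx => by linarith [hx.1, hx.2.1]
    rw [e1, e2]
  rcases le_or_gt (volume.real S) c with h' | h'
  · have e1 : lengthBelow S ⁻¹' Iic c ∩ S = S :=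
      inter_eq_right.2 fun x _ => (lengthBelow_le hS x).trans h'
    have e2 : Iic c ∩ Ioc 0 (volume.real S) = Ioc 0 (volume.real S) :=
      inter_eq_right.2 fun x hx => hx.2.trans h'
    rw [e1, e2, Real.volume_Ioc, sub_zero, ofReal_measureReal hfin]
  · obtain ⟨t₁, h1, h2⟩ : ∃ t₁, lengthBelow S ⁻¹' Iic c = Iic t₁ ∧ lengthBelow S t₁ = c := by
      have hbdd : BddAbove (lengthBelow S ⁻¹' Iic c) := ⟨1, fun x hx => by
        by_contra hx1
        have := monotone_lengthBelow hS (not_le.1 hx1).le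
        rw [lengthBelow_one hS] at this
        have : lengthBelow S x ≤ c := hx
        linarith⟩
      have hne : (lengthBelow S ⁻¹' Iic c).Nonempty := ⟨0, by
        change lengthBelow S 0 ≤ c; rwa [lengthBelow_zero hS]⟩
      have hcl : IsClosed (lengthBelow S ⁻¹' Iic c) := isClosed_Iic.preimage hc
      have hmem := hcl.csSup_mem hne hbdd
      refine ⟨sSup (lengthBelow S ⁻¹' Iic c), ?_, ?_⟩
      · ext x
        exact ⟨fun hx => le_csSup hbdd hx, fun hx => (monotone_lengthBelow hS hx).trans hmem⟩
      · refine le_antisymm hmem ?_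
        obtain ⟨t, -, ht⟩ := exists_lengthBelow_eq hm hS h h'.le
        exact ht.symm.le.trans (monotone_lengthBelow hS (le_csSup hbdd ht.le))
    have e2 : Iic c ∩ Ioc 0 (volume.real S) = Ioc 0 c := by
      ext x; simp only [mem_inter_iff, mem_Ioc, mem_Iic]
      exact ⟨fun hx => ⟨hx.2.1, hx.1⟩, fun hx => ⟨hx.2, hx.1, hx.2.trans h'.le⟩⟩
    rw [h1, e2, Real.volume_Ioc, sub_zero, ← h2, inter_comm, lengthBelow, ofReal_measureReal]

lemma setIntegral_comp_lengthBelow (hm : MeasurableSet S) (hS : S ⊆ Ioo 0 1) {f : ℝ → ℝ}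
    (hf : Continuous f) :
    ∫ y in S, f (lengthBelow S y) = ∫ s in (0 : ℝ)..volume.real S, f s := by
  rw [intervalIntegral.integral_of_le measureReal_nonneg, ← map_lengthBelow hm hS,
    integral_map (isPrim_lengthBelow hm hS).continuous.aemeasurable hf.aestronglyMeasurable]

end

lemma integral_sqrt_one_sub_sq_half : ∫ x in (0 : ℝ)..1, √(1 - x ^ 2) = Real.pi / 4 := by
  have h := integral_sqrt_one_sub_sq
  have hi : ∀ a b : ℝ, IntervalIntegrable (fun x : ℝ => √(1 - x ^ 2)) volume a b := fun a b =>
    (by fun_prop : Continuous fun x : ℝ => √(1 - x ^ 2)).intervalIntegrable a b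
  rw [← intervalIntegral.integral_add_adjacent_intervals (hi (-1) 0) (hi 0 1)] at h
  have h2 : ∫ x in (-1 : ℝ)..0, √(1 - x ^ 2) = ∫ x in (0 : ℝ)..1, √(1 - x ^ 2) := by
    have := intervalIntegral.integral_comp_neg (a := -1) (b := 0) fun x : ℝ => √(1 - x ^ 2)
    simpa using this
  linarith

lemma integral_sqrt_one_sub_div_sq {r : ℝ} (hr : 0 < r) :
    ∫ x in (0 : ℝ)..r, √(1 - (x / r) ^ 2) = r * Real.pi / 4 := by
  rw [intervalIntegral.integral_comp_div (fun x : ℝ => √(1 - x ^ 2)) hr.ne', zero_div,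
    div_self hr.ne', integral_sqrt_one_sub_sq_half, smul_eq_mul]
  ring

lemma integral_sqrt_one_sub_sub_div_sq {r : ℝ} (hr : 0 < r) :
    ∫ x in (0 : ℝ)..r, √(1 - (x / r - 1) ^ 2) = r * Real.pi / 4 := by
  rw [← integral_sqrt_one_sub_div_sq hr]
  have := intervalIntegral.integral_comp_sub_left (a := 0) (b := r)
    (fun x : ℝ => √(1 - (x / r) ^ 2)) r
  rw [sub_self, sub_zero] at this
  rw [← this]
  congr 1; funext x; congr 2
  rw [sub_div, div_self hr.ne']; ring

/-- The horizontal slice of a planar set at height `y`. -/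
def rowSlice (E : Set (Fin 2 → ℝ)) (y : ℝ) : Set ℝ := {s | ![s, y] ∈ E}

/-- The length of a horizontal slice. -/
def rowLength (E : Set (Fin 2 → ℝ)) (y : ℝ) : ℝ := volume.real (rowSlice E y)

/-- The heights of the nontrivial horizontal slices. -/
def rowSupport (E : Set (Fin 2 → ℝ)) : Set ℝ := {y | 0 < rowLength E y}

section
variable {E : Set (Fin 2 → ℝ)}

lemma measurable_vec : Measurable fun p : ℝ × ℝ => (![p.1, p.2] : Fin 2 → ℝ) := by
  refine measurable_pi_iff.2 fun i => ?_
  fin_cases i <;> simp <;> fun_prop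

lemma measurableSet_rowSlice (hE : MeasurableSet E) (y : ℝ) : MeasurableSet (rowSlice E y) :=
  (measurable_vec.comp (measurable_id.prodMk measurable_const)) hE

lemma rowSlice_subset (hEQ : E ⊆ unitSquare) (y : ℝ) : rowSlice E y ⊆ Ioo 0 1 := fun s hs => by
  simpa using (hEQ hs) 0 (mem_univ _)

lemma measurable_rowVolume (hE : MeasurableSet E) : Measurable fun y => volume (rowSlice E y) :=
  measurable_measure_prodMk_right (μ := (volume : Measure ℝ)) (measurable_vec hE)

lemma measurable_rowLength (hE : MeasurableSet E) : Measurable (rowLength E) :=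
  (measurable_rowVolume hE).ennreal_toReal

lemma measurableSet_rowSupport (hE : MeasurableSet E) : MeasurableSet (rowSupport E) :=
  measurableSet_lt measurable_const (measurable_rowLength hE)

lemma rowSupport_subset (hEQ : E ⊆ unitSquare) : rowSupport E ⊆ Ioo 0 1 := by
  intro y hy
  by_contra hne
  have : rowSlice E y = ∅ := by
    ext s
    simp only [mem_empty_iff_false, iff_false]
    exact fun hs => hne (by simpa using (hEQ hs) 1 (mem_univ _))
  simp [rowSupport, rowLength, this] at hy

lemma rowLength_nonneg (E : Set (Fin 2 → ℝ)) (y : ℝ) : 0 ≤ rowLength E y := measureReal_nonneg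

lemma rowLength_le_one (hEQ : E ⊆ unitSquare) (y : ℝ) : rowLength E y ≤ 1 := by
  have := measureReal_mono (μ := volume) (rowSlice_subset hEQ y) (by simp)
  simpa [rowLength] using this

lemma rowLength_eq_zero {y : ℝ} (hy : y ∉ rowSupport E) : rowLength E y = 0 :=
  le_antisymm (not_lt.1 hy) (rowLength_nonneg E y)

/-- The distribution of the height on a planar set. -/
lemma map_height (hE : MeasurableSet E) :
    (volume.restrict E).map (fun x : Fin 2 → ℝ => x 1) =
      volume.withDensity fun y => volume (rowSlice E y) := by
  have hmp := (volume_preserving_finTwoArrow ℝ).symm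
  have hx1 : Measurable fun x : Fin 2 → ℝ => x 1 := measurable_pi_apply 1
  refine Measure.ext fun S hS => ?_
  rw [Measure.map_apply hx1 hS, Measure.restrict_apply (hx1 hS), withDensity_apply _ hS,
    ← hmp.measure_preimage ((hx1 hS).inter hE).nullMeasurableSet, Measure.volume_eq_prod,
    Measure.prod_apply_symm (hmp.measurable ((hx1 hS).inter hE)), ← lintegral_indicator hS]
  congr 1; funext y
  by_cases hy : y ∈ S
  · rw [indicator_of_mem hy]
    congr 1; ext s
    simp [hy, rowSlice, MeasurableEquiv.finTwoArrow]
  · rw [indicator_of_notMem hy]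
    convert measure_empty (μ := (volume : Measure ℝ))
    ext s
    simp [hy, MeasurableEquiv.finTwoArrow]

lemma volume_rowSlice_lt_top (hEQ : E ⊆ unitSquare) (y : ℝ) : volume (rowSlice E y) < ⊤ :=
  (volume_ne_top_of_subset_Ioo (rowSlice_subset hEQ y)).lt_top

lemma setIntegral_height (hE : MeasurableSet E) (hEQ : E ⊆ unitSquare) {f : ℝ → ℝ}
    (hf : Measurable f) : ∫ x in E, f (x 1) = ∫ y, rowLength E y * f y := by
  have hx1 : Measurable fun x : Fin 2 → ℝ => x 1 := measurable_pi_apply 1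
  rw [← integral_map (μ := volume.restrict E) (f := f) hx1.aemeasurable hf.aestronglyMeasurable,
    map_height hE, integral_withDensity_eq_integral_toReal_smul (measurable_rowVolume hE)
      (Eventually.of_forall (volume_rowSlice_lt_top hEQ))]
  rfl

lemma integrableOn_height (hE : MeasurableSet E) (hEQ : E ⊆ unitSquare) {f : ℝ → ℝ}
    (hf : Measurable f) (hi : Integrable fun y => rowLength E y * f y) :
    IntegrableOn (fun x : Fin 2 → ℝ => f (x 1)) E := by
  have hx1 : Measurable fun x : Fin 2 → ℝ => x 1 := measurable_pi_apply 1
  have h := (integrable_map_measure (μ := volume.restrict E) (g := f) hf.aestronglyMeasurable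
    hx1.aemeasurable).1
  refine h ?_
  rw [map_height hE, integrable_withDensity_iff_integrable_smul' (measurable_rowVolume hE)
      (Eventually.of_forall (volume_rowSlice_lt_top hEQ))]
  exact hi

lemma integral_rowLength (hE : MeasurableSet E) (hEQ : E ⊆ unitSquare) :
    ∫ y, rowLength E y = volume.real E := by
  have := setIntegral_height hE hEQ (f := fun _ => 1) measurable_const
  simpa using this.symm

end

lemma update_zero_apply_one (x : Fin 2 → ℝ) (t : ℝ) : Function.update x 0 t 1 = x 1 := by simp

lemma mem_iff_mem_rowSlice {E : Set (Fin 2 → ℝ)} {x : Fin 2 → ℝ} :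
    x ∈ E ↔ x 0 ∈ rowSlice E (x 1) := by
  have : x = ![x 0, x 1] := by ext i; fin_cases i <;> rfl
  rw [rowSlice, mem_ofPred_eq, ← this]

lemma measurable_lengthBelow_rowSlice {E : Set (Fin 2 → ℝ)} (hE : MeasurableSet E) :
    Measurable fun x : Fin 2 → ℝ => lengthBelow (rowSlice E (x 1)) (x 0) := by
  have hv : Measurable fun p : (Fin 2 → ℝ) × ℝ => (![p.2, p.1 1] : Fin 2 → ℝ) :=
    measurable_vec.comp (measurable_snd.prodMk ((measurable_pi_apply 1).comp measurable_fst))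
  have hs : MeasurableSet {p : (Fin 2 → ℝ) × ℝ | ![p.2, p.1 1] ∈ E ∧ p.2 ≤ p.1 0} :=
    (hv hE).inter (measurableSet_le measurable_snd ((measurable_pi_apply 0).comp measurable_fst))
  exact (measurable_measure_prodMk_left (ν := (volume : Measure ℝ)) hs).ennreal_toReal

/-- A calibration adapted to the horizontal slices of `E`. -/
lemma exists_rowCalib {E : Set (Fin 2 → ℝ)} (hE : MeasurableSet E) (hEQ : E ⊆ unitSquare)
    {r : ℝ} (hr : 0 < r) (hrh : 2 * r ≤ volume.real (rowSupport E)) :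
    ∃ y₁ y₂ ξ g, lengthBelow (rowSupport E) y₁ = r ∧
      lengthBelow (rowSupport E) y₂ = volume.real (rowSupport E) - r ∧ y₁ ≤ y₂ ∧
      volume.real (rowSupport E ∩ Ioc y₁ y₂) = volume.real (rowSupport E) - 2 * r ∧ IsCalib ξ g ∧
      ∫ x in E, g x = 2 * (volume.real (rowSupport E) - 2 * r) + Real.pi * r +
        1 / r * (volume.real E - ∫ y in rowSupport E ∩ Ioc y₁ y₂, rowLength E y) := by
  set H := rowSupport E with hH
  set h := volume.real H with hh
  have hHm : MeasurableSet H := measurableSet_rowSupport hE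
  have hHs : H ⊆ Ioo 0 1 := rowSupport_subset hEQ
  have hHfin := volume_ne_top_of_subset_Ioo hHs
  obtain ⟨y₁, y₂, hy₁, hy₂, hy⟩ : ∃ y₁ y₂, lengthBelow H y₁ = r ∧ lengthBelow H y₂ = h - r ∧
      y₁ ≤ y₂ := by
    obtain ⟨y₁, -, h1⟩ := exists_lengthBelow_eq hHm hHs hr.le (by linarith)
    obtain ⟨y₂, -, h2⟩ := exists_lengthBelow_eq hHm hHs (c := h - r) (by linarith) (by linarith)
    rcases le_total y₁ y₂ with h3 | h3
    · exact ⟨y₁, y₂, h1, h2, h3⟩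
    · have := monotone_lengthBelow hHs h3
      exact ⟨y₁, y₁, h1, by linarith, le_rfl⟩
  set H₁ := H ∩ Iic y₁ with hH₁
  set H₂ := H ∩ Ioi y₂ with hH₂
  set M := H ∩ Ioc y₁ y₂ with hM
  have hm₁ : MeasurableSet H₁ := hHm.inter measurableSet_Iic
  have hm₂ : MeasurableSet H₂ := hHm.inter measurableSet_Ioi
  have hmM : MeasurableSet M := hHm.inter measurableSet_Ioc
  have hs₁ : H₁ ⊆ Ioo 0 1 := inter_subset_left.trans hHs
  have hs₂ : H₂ ⊆ Ioo 0 1 := inter_subset_left.trans hHs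
  have hsM : M ⊆ Ioo 0 1 := inter_subset_left.trans hHs
  have hv₁ : volume.real H₁ = r := hy₁
  have hv₂ : volume.real H₂ = r := by
    have h1 := measureReal_inter_add_sdiff (μ := volume) (s := H) (t := Iic y₂)
      measurableSet_Iic hHfin
    have h2 : H \ Iic y₂ = H₂ := by rw [hH₂, ← compl_Iic, sdiff_eq]
    have h3 : volume.real (H ∩ Iic y₂) = h - r := hy₂
    rw [h2, h3] at h1; linarith
  have hU : H = H₁ ∪ (M ∪ H₂) := by
    rw [hH₁, hM, hH₂, ← inter_union_distrib_left, ← inter_union_distrib_left,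
      Ioc_union_Ioi_eq_Ioi hy,
      Iic_union_Ioi, inter_univ]
  have hd₁ : Disjoint H₁ (M ∪ H₂) := by
    rw [Set.disjoint_left]
    rintro x ⟨-, hx⟩ (hx' | hx')
    · exact not_lt.2 hx hx'.2.1
    · exact not_lt.2 (hx.trans hy) hx'.2
  have hd₂ : Disjoint M H₂ := by
    rw [Set.disjoint_left]
    rintro x hx hx'
    exact not_lt.2 hx.2.2 hx'.2
  have hvM : volume.real M = h - 2 * r := by
    have h1 := measureReal_union (μ := volume) hd₁ (hmM.union hm₂)
      (volume_ne_top_of_subset_Ioo hs₁) (volume_ne_top_of_subset_Ioo (union_subset hsM hs₂))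
    have h2 := measureReal_union (μ := volume) hd₂ hm₂
      (volume_ne_top_of_subset_Ioo hsM) (volume_ne_top_of_subset_Ioo hs₂)
    rw [← hU] at h1
    linarith
  set v₁ := lengthBelow H₁ with hv₁'
  set v₂ := lengthBelow H₂ with hv₂'
  have p₁ := isPrim_lengthBelow hm₁ hs₁
  have p₂ := isPrim_lengthBelow hm₂ hs₂
  have hv₁r : ∀ y, y₁ ≤ y → v₁ y = r := fun y hy' => by
    rw [hv₁', lengthBelow, inter_eq_left.2 (inter_subset_right.trans (Iic_subset_Iic.2 hy')), hv₁]
  have hv₂0 : ∀ y, y ≤ y₂ → v₂ y = 0 := fun y hy' => by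
    have : H₂ ∩ Iic y = ∅ := by
      ext x; simp only [mem_inter_iff, mem_Iic, mem_empty_iff_false, iff_false]
      rintro ⟨⟨-, hx⟩, hx'⟩
      exact not_lt.2 (hx'.trans hy') hx
    rw [hv₂', lengthBelow, this, measureReal_empty]
  let B : ℝ → ℝ := fun y => -1 + (1 / r) * (v₁ y + v₂ y)
  let A : ℝ → ℝ := fun y => √(1 - B y ^ 2)
  let β : ℝ → ℝ := fun y => (1 / r) * (H₁.indicator 1 y + H₂.indicator 1 y)
  have hBp : IsPrim B fun y => 0 + β y := (isPrim_const (-1)).add ((p₁.add p₂).const_mul (1 / r))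
  have hBc : Continuous B := hBp.continuous
  have hB1 : ∀ y, B y ^ 2 ≤ 1 := fun y => by
    have h1 := lengthBelow_nonneg H₁ y
    have h2 := lengthBelow_nonneg H₂ y
    have h3 := lengthBelow_le hs₁ y
    have h4 := lengthBelow_le hs₂ y
    rw [hv₁] at h3; rw [hv₂] at h4
    have h5 : 0 ≤ (1 / r) * (v₁ y + v₂ y) := by positivity
    have h6 : (1 / r) * (v₁ y + v₂ y) ≤ 2 := by
      rw [one_div, inv_mul_le_iff₀ hr]; linarith
    rw [sq_le_one_iff_abs_le_one, abs_le]
    constructor <;> simp only [B] <;> linarith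
  have hAc : Continuous A := by fun_prop
  have hA0 : ∀ y, 0 ≤ A y := fun y => Real.sqrt_nonneg _
  have hAsq : ∀ y, A y ^ 2 = 1 - B y ^ 2 := fun y => Real.sq_sqrt (by linarith [hB1 y])
  have hA1 : ∀ y, A y ≤ 1 := fun y => Real.sqrt_le_one.2 (by linarith [sq_nonneg (B y)])
  have hβm : Measurable β := ((measurable_one.indicator hm₁).add
    (measurable_one.indicator hm₂)).const_mul _
  have hℓm := measurable_rowLength hE
  let f : ℝ → ℝ := fun y => A y * (2 / rowLength E y) + β y
  have hfm : Measurable f := (hAc.measurable.mul (measurable_const.div hℓm)).add hβm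
  let ξ : Fin 2 → (Fin 2 → ℝ) → ℝ := ![fun x => A (x 1) * (-1 + 2 / rowLength E (x 1) *
    lengthBelow (rowSlice E (x 1)) (x 0)), fun x => B (x 1)]
  let k : Fin 2 → (Fin 2 → ℝ) → ℝ := ![E.indicator fun x => A (x 1) * (2 / rowLength E (x 1)),
    fun x => β (x 1)]
  have hx1 : Measurable fun x : Fin 2 → ℝ => x 1 := measurable_pi_apply 1
  have hbdd : ∀ {S : Set ℝ} {q : ℝ → ℝ} {C : ℝ}, MeasurableSet S → S ⊆ Ioo 0 1 → Measurable q →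
      (∀ y, |q y| ≤ C) → IntegrableOn q S := fun hSm hS hq hC =>
    Measure.integrableOn_of_bounded (volume_ne_top_of_subset_Ioo hS) hq.aestronglyMeasurable
      (Eventually.of_forall hC)
  have hIA : ∀ {S : Set ℝ}, MeasurableSet S → S ⊆ Ioo 0 1 → IntegrableOn A S := fun hSm hS =>
    hbdd hSm hS hAc.measurable (C := 1) fun y => by rw [abs_of_nonneg (hA0 y)]; exact hA1 y
  have hIℓ : ∀ {S : Set ℝ}, MeasurableSet S → S ⊆ Ioo 0 1 → IntegrableOn (rowLength E) S :=
    fun hSm hS => hbdd hSm hS hℓm (C := 1) fun y => by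
      rw [abs_of_nonneg (rowLength_nonneg E y)]; exact rowLength_le_one hEQ y
  have hℓA : (fun y => rowLength E y * (A y * (2 / rowLength E y))) =
      H.indicator fun y => 2 * A y := by
    funext y
    by_cases hy' : y ∈ H
    · have : rowLength E y ≠ 0 := ne_of_gt hy'
      rw [indicator_of_mem hy']; field_simp
    · rw [indicator_of_notMem hy', rowLength_eq_zero hy', zero_mul]
  have hℓAi : Integrable fun y => rowLength E y * (A y * (2 / rowLength E y)) := by
    rw [hℓA]; exact (integrable_indicator_iff hHm).2 ((hIA hHm hHs).const_mul 2)
  have hℓf : (fun y => rowLength E y * f y) = fun y => (H.indicator fun y => 2 * A y) y +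
      (1 / r) * (H₁.indicator (rowLength E) y + H₂.indicator (rowLength E) y) := by
    funext y
    rw [← hℓA]
    simp only [f, β, mul_add, indicator, Pi.one_apply]
    split_ifs <;> ring
  have hcalib : IsCalib ξ fun x => k 0 x + k 1 x := by
    refine isCalib_of_isPrim ?_ ?_ ?_ ?_
    · intro i
      fin_cases i
      · exact (hAc.measurable.comp hx1).mul (measurable_const.add
          ((measurable_const.div (hℓm.comp hx1)).mul (measurable_lengthBelow_rowSlice hE)))
      · exact hBc.measurable.comp hx1
    · intro x
      change (A (x 1) * (-1 + 2 / rowLength E (x 1) *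
        lengthBelow (rowSlice E (x 1)) (x 0))) ^ 2 + B (x 1) ^ 2 ≤ 1
      have h1 : (-1 + 2 / rowLength E (x 1) * lengthBelow (rowSlice E (x 1)) (x 0)) ^ 2 ≤ 1 := by
        have h2 := lengthBelow_nonneg (rowSlice E (x 1)) (x 0)
        have h3 : lengthBelow (rowSlice E (x 1)) (x 0) ≤ rowLength E (x 1) :=
          lengthBelow_le (rowSlice_subset hEQ _) _
        have h4 := rowLength_nonneg E (x 1)
        have h5 : 0 ≤ 2 / rowLength E (x 1) * lengthBelow (rowSlice E (x 1)) (x 0) := by positivity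
        have h6 : 2 / rowLength E (x 1) * lengthBelow (rowSlice E (x 1)) (x 0) ≤ 2 := by
          rw [div_mul_eq_mul_div]
          exact div_le_of_le_mul₀ h4 zero_le_two (by linarith)
        rw [sq_le_one_iff_abs_le_one, abs_le]
        constructor <;> linarith
      rw [mul_pow, hAsq]
      nlinarith [hB1 (x 1)]
    · intro i
      fin_cases i
      · refine Integrable.locallyIntegrable ?_
        exact (integrable_indicator_iff hE).2 (integrableOn_height hE hEQ
          (hAc.measurable.mul (measurable_const.div hℓm)) hℓAi)
      · refine LocallyIntegrable.mono (continuous_const (y := 2 / r)).locallyIntegrable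
          (hβm.comp hx1).aestronglyMeasurable (Eventually.of_forall fun x => ?_)
        change ‖β (x 1)‖ ≤ ‖2 / r‖
        have h2 : ∀ S : Set ℝ, 0 ≤ S.indicator (1 : ℝ → ℝ) (x 1) ∧
            S.indicator (1 : ℝ → ℝ) (x 1) ≤ 1 :=
          fun S => ⟨indicator_nonneg (fun _ _ => zero_le_one) _,
            indicator_le_self' (fun _ _ => zero_le_one) _⟩
        have h3 := h2 H₁
        have h4 := h2 H₂
        rw [Real.norm_of_nonneg (mul_nonneg (by positivity) (by linarith)),
          Real.norm_of_nonneg (by positivity), one_div, inv_mul_eq_div]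
        exact div_le_div_of_nonneg_right (by linarith) hr.le
    · intro i x
      fin_cases i
      · have h1 := isPrim_lengthBelow (measurableSet_rowSlice hE (x 1)) (rowSlice_subset hEQ (x 1))
        have h2 :=
          ((isPrim_const (-1)).add (h1.const_mul (2 / rowLength E (x 1)))).const_mul (A (x 1))
        convert h2 using 2 with t t
        · simp [ξ]
        · change E.indicator (fun x => A (x 1) * (2 / rowLength E (x 1)))
            (Function.update x 0 t) = _
          by_cases ht : Function.update x 0 t ∈ E
          · have ht' := mem_iff_mem_rowSlice.1 ht
            simp only [update_zero_apply_one, Function.update_self] at ht'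
            rw [indicator_of_mem ht, indicator_of_mem ht']
            simp
          · have ht' := mt mem_iff_mem_rowSlice.2 ht
            simp only [update_zero_apply_one, Function.update_self] at ht'
            rw [indicator_of_notMem ht, indicator_of_notMem ht']
            simp
      · convert hBp using 2 with t t
        · simp [ξ]
        · simp [k]
  refine ⟨y₁, y₂, ξ, _, hy₁, hy₂, hy, hvM, hcalib, ?_⟩
  have e1 : ∫ x in E, (k 0 x + k 1 x) = ∫ x in E, f (x 1) := by
    refine setIntegral_congr_fun hE fun x hx => ?_
    change E.indicator (fun x => A (x 1) * (2 / rowLength E (x 1))) x + β (x 1) = _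
    rw [indicator_of_mem hx]
  have i1 : Integrable (H.indicator fun y => 2 * A y) :=
    (integrable_indicator_iff hHm).2 ((hIA hHm hHs).const_mul 2)
  have i2 : Integrable (H₁.indicator (rowLength E)) :=
    (integrable_indicator_iff hm₁).2 (hIℓ hm₁ hs₁)
  have i3 : Integrable (H₂.indicator (rowLength E)) :=
    (integrable_indicator_iff hm₂).2 (hIℓ hm₂ hs₂)
  have i4 : Integrable fun y => (1 / r) * (H₁.indicator (rowLength E) y +
      H₂.indicator (rowLength E) y) := (i2.add i3).const_mul _
  rw [e1, setIntegral_height hE hEQ hfm, hℓf, integral_add i1 i4,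
    integral_const_mul, integral_add i2 i3, integral_indicator hHm, integral_indicator hm₁,
    integral_indicator hm₂, integral_const_mul]
  have a1 : ∫ y in H₁, A y = r * Real.pi / 4 := by
    rw [← integral_sqrt_one_sub_sub_div_sq hr]
    conv_rhs => rw [← hv₁]
    rw [← setIntegral_comp_lengthBelow hm₁ hs₁ (by fun_prop)]
    refine setIntegral_congr_fun hm₁ fun y hy' => ?_
    change √(1 - (-1 + (1 / r) * (v₁ y + v₂ y)) ^ 2) = _
    rw [hv₂0 y (hy'.2.trans hy)]
    congr 3; rw [hv₁]; ring
  have a2 : ∫ y in H₂, A y = r * Real.pi / 4 := by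
    rw [← integral_sqrt_one_sub_div_sq hr]
    conv_rhs => rw [← hv₂]
    rw [← setIntegral_comp_lengthBelow hm₂ hs₂ (by fun_prop)]
    refine setIntegral_congr_fun hm₂ fun y hy' => ?_
    change √(1 - (-1 + (1 / r) * (v₁ y + v₂ y)) ^ 2) = _
    rw [hv₁r y (hy.trans (le_of_lt hy'.2)), hv₂]
    congr 3; field_simp; ring
  have a3 : ∫ y in M, A y = h - 2 * r := by
    have : ∫ y in M, A y = ∫ y in M, (1 : ℝ) := by
      refine setIntegral_congr_fun hmM fun y hy' => ?_
      change √(1 - (-1 + (1 / r) * (v₁ y + v₂ y)) ^ 2) = _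
      rw [hv₁r y hy'.2.1.le, hv₂0 y hy'.2.2, add_zero, one_div, inv_mul_cancel₀ hr.ne']
      simp
    rw [this]; simpa using hvM
  have a4 : ∫ y in H, A y = r * Real.pi / 4 + ((h - 2 * r) + r * Real.pi / 4) := by
    rw [hU, setIntegral_union hd₁ (hmM.union hm₂) (hIA hm₁ hs₁)
      (hIA (hmM.union hm₂) (union_subset hsM hs₂)),
      setIntegral_union hd₂ hm₂ (hIA hmM hsM) (hIA hm₂ hs₂), a1, a2, a3]
  have a5 : volume.real E = (∫ y in H₁, rowLength E y) + ((∫ y in M, rowLength E y) +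
      ∫ y in H₂, rowLength E y) := by
    rw [← integral_rowLength hE hEQ, ← setIntegral_eq_integral_of_forall_compl_eq_zero (s := H)
      fun y hy' => rowLength_eq_zero hy', hU, setIntegral_union hd₁ (hmM.union hm₂) (hIℓ hm₁ hs₁)
      (hIℓ (hmM.union hm₂) (union_subset hsM hs₂)),
      setIntegral_union hd₂ hm₂ (hIℓ hmM hsM) (hIℓ hm₂ hs₂)]
  rw [a4, a5]; ring

/-- The exchange of the two coordinates of the plane. -/
def coordSwap : (Fin 2 → ℝ) →L[ℝ] (Fin 2 → ℝ) :=
  ContinuousLinearMap.pi fun i => ContinuousLinearMap.proj (Equiv.swap 0 1 i)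

@[simp] lemma coordSwap_apply (x : Fin 2 → ℝ) (i : Fin 2) :
    coordSwap x i = x (Equiv.swap 0 1 i) := rfl

@[simp] lemma coordSwap_coordSwap (x : Fin 2 → ℝ) : coordSwap (coordSwap x) = x := by
  ext i; simp

lemma measurePreserving_coordSwap : MeasurePreserving coordSwap := by
  have h := volume_measurePreserving_piCongrLeft (fun _ : Fin 2 => ℝ) (Equiv.swap 0 1)
  have h' : ⇑coordSwap = MeasurableEquiv.piCongrLeft (fun _ : Fin 2 => ℝ) (Equiv.swap 0 1) := by
    funext x i
    rw [coordSwap_apply, MeasurableEquiv.coe_piCongrLeft]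
    conv_rhs => rw [← Equiv.swap_apply_self 0 1 i]
    exact (Equiv.piCongrLeft_apply_apply (fun _ : Fin 2 => ℝ) (Equiv.swap 0 1) x _).symm
  rw [h']
  exact h

lemma measurableEmbedding_coordSwap : MeasurableEmbedding coordSwap :=
  (MeasurableEquiv.mk (Function.Involutive.toPerm coordSwap coordSwap_coordSwap)
    coordSwap.continuous.measurable coordSwap.continuous.measurable).measurableEmbedding

lemma coordSwap_single (i : Fin 2) :
    coordSwap (Pi.single i (1 : ℝ)) = Pi.single (Equiv.swap 0 1 i) 1 := by
  ext j
  fin_cases i <;> fin_cases j <;> simp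

lemma IsCalib.swap {ξ : Fin 2 → (Fin 2 → ℝ) → ℝ} {g : (Fin 2 → ℝ) → ℝ} (h : IsCalib ξ g) :
    IsCalib (fun i x => ξ (Equiv.swap 0 1 i) (coordSwap x)) fun x => g (coordSwap x) := by
  have hmp := measurePreserving_coordSwap
  refine ⟨fun i => (h.meas _).comp coordSwap.continuous.measurable, fun x => ?_, ?_, ?_⟩
  · have := h.bound (coordSwap x)
    simp only [Equiv.swap_apply_left, Equiv.swap_apply_right]
    linarith
  · refine (locallyIntegrable_iff (μ := volume)).2 fun K hK => ?_
    have h1 := h.locInt.integrableOn_isCompact (hK.image coordSwap.continuous)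
    have h2 := (hmp.integrableOn_comp_preimage measurableEmbedding_coordSwap).2 h1
    exact h2.mono_set (subset_preimage_image _ _)
  · intro ψ hψ hs
    have hψ' : ContDiff ℝ 1 (ψ ∘ coordSwap) := hψ.comp coordSwap.contDiff
    have hs' : HasCompactSupport (ψ ∘ coordSwap) := by
      refine HasCompactSupport.intro (hs.isCompact.image coordSwap.continuous) fun x hx => ?_
      exact image_eq_zero_of_notMem_tsupport (f := ψ) fun h' =>
        hx ⟨coordSwap x, h', coordSwap_coordSwap x⟩
    have hw := h.weak _ hψ' hs'
    rw [← hmp.integral_comp measurableEmbedding_coordSwap, ← hmp.integral_comp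
      measurableEmbedding_coordSwap (fun x => g x * _)] at hw
    simp only [Function.comp_apply, coordSwap_coordSwap] at hw
    rw [← hw]
    congr 1; funext x
    have hf : fderiv ℝ (ψ ∘ coordSwap) (coordSwap x) = (fderiv ℝ ψ x).comp coordSwap := by
      have h1 := (hψ.differentiable one_ne_zero (coordSwap (coordSwap x))).hasFDerivAt.comp
        (coordSwap x) coordSwap.hasFDerivAt
      rw [coordSwap_coordSwap] at h1
      exact h1.fderiv
    simp only [gradPair, hf, Fin.sum_univ_two, ContinuousLinearMap.comp_apply, coordSwap_single,
      Equiv.swap_apply_left, Equiv.swap_apply_right]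
    ring

lemma setIntegral_coordSwap (E : Set (Fin 2 → ℝ)) (g : (Fin 2 → ℝ) → ℝ) :
    ∫ x in coordSwap ⁻¹' E, g x = ∫ x in E, g (coordSwap x) := by
  have := measurePreserving_coordSwap.setIntegral_preimage_emb measurableEmbedding_coordSwap
    (fun x => g (coordSwap x)) E
  simpa using this

lemma preimage_coordSwap_subset {E : Set (Fin 2 → ℝ)} (h : E ⊆ unitSquare) :
    coordSwap ⁻¹' E ⊆ unitSquare := fun x hx i _ => by
  simpa using h hx (Equiv.swap 0 1 i) (mem_univ _)

/-- The least perimeter of a subset of the unit square with area `a`. -/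
def squareProfile (a : ℝ) : ℝ :=
  if a ≤ Real.pi / 4 then 2 * √(Real.pi * a) else 4 - 2 * √((4 - Real.pi) * (1 - a))

/-- The rounding radius associated with the area `a`. -/
def cornerRadius (a : ℝ) : ℝ := √((1 - a) / (4 - Real.pi))

lemma four_sub_pi_pos : 0 < 4 - Real.pi := sub_pos.2 Real.pi_lt_four

lemma cornerRadius_nonneg (a : ℝ) : 0 ≤ cornerRadius a := Real.sqrt_nonneg _

lemma cornerRadius_sq {a : ℝ} (h : a ≤ 1) : (4 - Real.pi) * cornerRadius a ^ 2 = 1 - a := by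
  rw [cornerRadius, Real.sq_sqrt (div_nonneg (by linarith) four_sub_pi_pos.le),
    mul_div_cancel₀ _ four_sub_pi_pos.ne']

lemma cornerRadius_pos {a : ℝ} (h : a < 1) : 0 < cornerRadius a :=
  Real.sqrt_pos.2 (div_pos (by linarith) four_sub_pi_pos)

lemma cornerRadius_lt_half {a : ℝ} (h : Real.pi / 4 < a) : cornerRadius a < 1 / 2 := by
  rw [cornerRadius, Real.sqrt_lt' (by norm_num), div_lt_iff₀ four_sub_pi_pos]
  linarith

lemma sqrt_mul_eq_cornerRadius {a : ℝ} (h : a ≤ 1) :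
    √((4 - Real.pi) * (1 - a)) = (4 - Real.pi) * cornerRadius a := by
  rw [← cornerRadius_sq h, show (4 - Real.pi) * ((4 - Real.pi) * cornerRadius a ^ 2) =
    ((4 - Real.pi) * cornerRadius a) ^ 2 by ring,
    Real.sqrt_sq (mul_nonneg four_sub_pi_pos.le (cornerRadius_nonneg a))]

section
variable {E : Set (Fin 2 → ℝ)}

lemma volume_real_le_rowSupport (hE : MeasurableSet E) (hEQ : E ⊆ unitSquare) :
    volume.real E ≤ volume.real (rowSupport E) := by
  rw [← integral_rowLength hE hEQ, ← integral_indicator_one (measurableSet_rowSupport hE)]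
  have hi : Integrable ((rowSupport E).indicator (1 : ℝ → ℝ)) :=
    (integrable_indicator_iff (measurableSet_rowSupport hE)).2
      (integrableOn_const (volume_ne_top_of_subset_Ioo (rowSupport_subset hEQ)))
  refine integral_mono_of_nonneg (Eventually.of_forall (rowLength_nonneg E)) hi
    (Eventually.of_forall fun y => ?_)
  by_cases hy : y ∈ rowSupport E
  · rw [indicator_of_mem hy]; exact rowLength_le_one hEQ y
  · rw [indicator_of_notMem hy, rowLength_eq_zero hy]

lemma volume_real_rowSupport_le_one (hEQ : E ⊆ unitSquare) : volume.real (rowSupport E) ≤ 1 := by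
  have := measureReal_mono (μ := volume) (rowSupport_subset hEQ) (by simp)
  simpa using this

lemma setIntegral_rowLength_le (hEQ : E ⊆ unitSquare) {S : Set ℝ}
    (hS : S ⊆ Ioo 0 1) : ∫ y in S, rowLength E y ≤ volume.real S := by
  have hi : IntegrableOn (fun _ => (1 : ℝ)) S :=
    integrableOn_const (volume_ne_top_of_subset_Ioo hS)
  have := integral_mono_of_nonneg (Eventually.of_forall (rowLength_nonneg E)) hi
    (Eventually.of_forall (rowLength_le_one hEQ))
  simpa using this

/-- A lower bound by a calibration with small radius. -/
lemma exists_calib_le (hE : MeasurableSet E) (hEQ : E ⊆ unitSquare) {r : ℝ} (hr : 0 < r)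
    (hrh : 2 * r ≤ volume.real (rowSupport E)) :
    ∃ ξ g, IsCalib ξ g ∧ 2 * (volume.real (rowSupport E) - 2 * r) + Real.pi * r +
      1 / r * (volume.real E - (volume.real (rowSupport E) - 2 * r)) ≤ ∫ x in E, g x := by
  obtain ⟨y₁, y₂, ξ, g, -, -, -, hM, hc, hI⟩ := exists_rowCalib hE hEQ hr hrh
  refine ⟨ξ, g, hc, ?_⟩
  have h1 := setIntegral_rowLength_le hEQ (S := rowSupport E ∩ Ioc y₁ y₂)
    (inter_subset_left.trans (rowSupport_subset hEQ))
  rw [hI, ← hM]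
  have : 0 < 1 / r := by positivity
  gcongr

lemma add_div_antitone {a s t : ℝ} (hs : 0 < s) (hst : s ≤ t) (h : Real.pi * t ^ 2 ≤ a) :
    Real.pi * t + a / t ≤ Real.pi * s + a / s := by
  have ht : 0 < t := hs.trans_le hst
  have h1 : Real.pi * s * t ≤ a := by
    have := mul_le_mul_of_nonneg_left hst (mul_nonneg Real.pi_pos.le ht.le)
    nlinarith
  have h2 : Real.pi * s + a / s - (Real.pi * t + a / t) =
      (t - s) * (a - Real.pi * s * t) / (s * t) := by
    field_simp; ring
  have h3 : 0 ≤ (t - s) * (a - Real.pi * s * t) / (s * t) :=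
    div_nonneg (mul_nonneg (by linarith) (by linarith)) (by positivity)
  linarith

/-- If the support of the rows is short, there is a good calibration by a radial profile. -/
lemma exists_calib_of_short (hE : MeasurableSet E) (hEQ : E ⊆ unitSquare)
    (ha : Real.pi / 4 < volume.real E) (ha1 : volume.real E < 1)
    (hh : volume.real (rowSupport E) < 2 * cornerRadius (volume.real E)) :
    ∃ ξ g, IsCalib ξ g ∧ squareProfile (volume.real E) < ∫ x in E, g x := by
  have h0 := volume_real_le_rowSupport hE hEQ
  set a := volume.real E
  set h := volume.real (rowSupport E)
  have hpi := Real.pi_pos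
  have hr := cornerRadius_pos ha1
  have hr2 := cornerRadius_lt_half ha
  have hsq := cornerRadius_sq ha1.le
  have hhp : 0 < h := by linarith
  obtain ⟨ξ, g, hc, hle⟩ := exists_calib_le hE hEQ (r := h / 2) (by linarith) (by
    change 2 * (h / 2) ≤ h; linarith)
  refine ⟨ξ, g, hc, lt_of_lt_of_le ?_ hle⟩
  rw [squareProfile, if_neg (not_le.2 ha), sqrt_mul_eq_cornerRadius ha1.le]
  set r := cornerRadius a
  have h1 := add_div_antitone (a := a) (s := h / 2) (t := r) (by linarith) (by linarith)
    (by nlinarith)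
  have h2 : Real.pi * r + a / r - (4 - 2 * ((4 - Real.pi) * r)) = (2 * r - 1) ^ 2 / r := by
    have : a = 1 - (4 - Real.pi) * r ^ 2 := by linarith
    rw [this]; field_simp; ring
  have h3 : 0 < (2 * r - 1) ^ 2 / r := div_pos (by nlinarith) hr
  change _ < 2 * (h - 2 * (h / 2)) + Real.pi * (h / 2) + 1 / (h / 2) * (a - (h - 2 * (h / 2)))
  have h4 : 2 * (h - 2 * (h / 2)) + Real.pi * (h / 2) + 1 / (h / 2) * (a - (h - 2 * (h / 2))) =
    Real.pi * (h / 2) + a / (h / 2) := by ring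
  linarith

lemma profile_identity {a h r : ℝ} (hr : 0 < r) (hsq : (4 - Real.pi) * r ^ 2 = 1 - a) :
    2 * (h - 2 * r) + Real.pi * r + 1 / r * (a - (h - 2 * r)) =
      4 - 2 * ((4 - Real.pi) * r) + (1 - h) * (1 - 2 * r) / r := by
  have : a = 1 - (4 - Real.pi) * r ^ 2 := by linarith
  rw [this]; field_simp; ring

/-- Every subset of the unit square has calibrations reaching the profile bound. -/
lemma exists_calib_profile (hE : MeasurableSet E) (hEQ : E ⊆ unitSquare)
    (ha : 0 < volume.real E) {ε : ℝ} (hε : 0 < ε) :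
    ∃ ξ g, IsCalib ξ g ∧ squareProfile (volume.real E) - ε ≤ ∫ x in E, g x := by
  have h0 := volume_real_le_rowSupport hE hEQ
  have h1 := volume_real_rowSupport_le_one hEQ
  have hpi := Real.pi_pos
  rcases le_or_gt (volume.real E) (Real.pi / 4) with ha4 | ha4
  · obtain ⟨ξ, g, hc, hle⟩ := exists_calib_le hE hEQ (r := volume.real (rowSupport E) / 2)
      (by linarith) (by linarith)
    refine ⟨ξ, g, hc, ?_⟩
    set a := volume.real E
    set h := volume.real (rowSupport E)
    have hh : 0 < h := by linarith
    have h4 : 2 * (h - 2 * (h / 2)) + Real.pi * (h / 2) + 1 / (h / 2) * (a - (h - 2 * (h / 2))) =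
      Real.pi * (h / 2) + a / (h / 2) := by ring
    rw [h4] at hle
    have h5 : 2 * √(Real.pi * a) ≤ Real.pi * (h / 2) + a / (h / 2) := by
      have h6 := two_mul_le_add_sq √(Real.pi * (h / 2)) √(a / (h / 2))
      rw [Real.sq_sqrt (by positivity), Real.sq_sqrt (by positivity), mul_assoc,
        ← Real.sqrt_mul (by positivity)] at h6
      have h7 : Real.pi * (h / 2) * (a / (h / 2)) = Real.pi * a := by field_simp
      rwa [h7] at h6
    rw [squareProfile, if_pos ha4]; linarith
  · rcases lt_or_ge (volume.real E) 1 with ha1 | ha1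
    · rcases lt_or_ge (volume.real (rowSupport E)) (2 * cornerRadius (volume.real E)) with hh | hh
      · obtain ⟨ξ, g, hc, hle⟩ := exists_calib_of_short hE hEQ ha4 ha1 hh
        exact ⟨ξ, g, hc, by linarith⟩
      · have hr := cornerRadius_pos ha1
        have hr2 := cornerRadius_lt_half ha4
        obtain ⟨ξ, g, hc, hle⟩ := exists_calib_le hE hEQ hr hh
        refine ⟨ξ, g, hc, ?_⟩
        rw [profile_identity hr (cornerRadius_sq ha1.le)] at hle
        rw [squareProfile, if_neg (not_le.2 ha4), sqrt_mul_eq_cornerRadius ha1.le]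
        have : 0 ≤ (1 - volume.real (rowSupport E)) * (1 - 2 * cornerRadius (volume.real E)) /
          cornerRadius (volume.real E) :=
          div_nonneg (mul_nonneg (by linarith) (by linarith)) hr.le
        linarith
    · have ha' : volume.real E = 1 := by linarith
      have hh : volume.real (rowSupport E) = 1 := by linarith
      have hm : 0 < min ε (1 / 2) := lt_min hε (by norm_num)
      have hm1 := min_le_left ε (1 / 2)
      have hm2 := min_le_right ε (1 / 2)
      obtain ⟨ξ, g, hc, hle⟩ := exists_calib_le hE hEQ hm (by linarith)
      refine ⟨ξ, g, hc, ?_⟩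
      rw [squareProfile, if_neg (not_le.2 ha4)]
      rw [ha', hh] at hle
      rw [ha', sub_self, mul_zero, Real.sqrt_zero]
      set r := min ε (1 / 2)
      have h4 : 1 / r * (1 - (1 - 2 * r)) = 2 := by field_simp; ring
      rw [h4] at hle
      nlinarith [Real.pi_gt_three]

/-- Optimality with respect to row calibrations forces full rows in the central strip. -/
lemma volume_strip_sdiff (hE : MeasurableSet E) (hEQ : E ⊆ unitSquare)
    (ha : Real.pi / 4 < volume.real E) (ha1 : volume.real E < 1)
    (hopt : ∀ ξ g, IsCalib ξ g → ∫ x in E, g x ≤ squareProfile (volume.real E)) :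
    volume ((unitSquare ∩ {x | x 1 ∈ Ioc (cornerRadius (volume.real E))
      (1 - cornerRadius (volume.real E))}) \ E) = 0 := by
  have h1 := volume_real_rowSupport_le_one hEQ
  have hHs := rowSupport_subset hEQ
  have hHm := measurableSet_rowSupport hE
  have hr := cornerRadius_pos ha1
  have hr2 := cornerRadius_lt_half ha
  have hsq := cornerRadius_sq ha1.le
  have hge : 2 * cornerRadius (volume.real E) ≤ volume.real (rowSupport E) := by
    by_contra hlt
    obtain ⟨ξ, g, hc, hlt'⟩ := exists_calib_of_short hE hEQ ha ha1 (not_le.1 hlt)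
    exact absurd (hopt ξ g hc) (not_le.2 hlt')
  obtain ⟨y₁, y₂, ξ, g, hy₁, hy₂, hy, hM, hc, hI⟩ := exists_rowCalib hE hEQ hr hge
  have hle := hopt ξ g hc
  set H := rowSupport E
  set r := cornerRadius (volume.real E)
  have hD := setIntegral_rowLength_le hEQ (S := H ∩ Ioc y₁ y₂) (inter_subset_left.trans hHs)
  rw [hI, squareProfile, if_neg (not_le.2 ha), sqrt_mul_eq_cornerRadius ha1.le] at hle
  set D := ∫ y in H ∩ Ioc y₁ y₂, rowLength E y with hDdef
  change _ ≤ 4 - 2 * ((4 - Real.pi) * r) at hle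
  have hid := profile_identity (h := volume.real H) hr hsq
  have e1 : 2 * (volume.real H - 2 * r) + Real.pi * r + 1 / r * (volume.real E - D) =
      4 - 2 * ((4 - Real.pi) * r) + (1 - volume.real H) * (1 - 2 * r) / r +
        1 / r * (volume.real (H ∩ Ioc y₁ y₂) - D) := by
    rw [← hid, hM]; ring
  rw [e1] at hle
  have n1 : 0 ≤ (1 - volume.real H) * (1 - 2 * r) / r :=
    div_nonneg (mul_nonneg (by linarith) (by linarith)) hr.le
  have n2 : 0 ≤ 1 / r * (volume.real (H ∩ Ioc y₁ y₂) - D) :=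
    mul_nonneg (by positivity) (by linarith)
  have hH1 : volume.real H = 1 := by
    have : (1 - volume.real H) * (1 - 2 * r) / r = 0 := by linarith
    rw [_root_.div_eq_zero_iff, _root_.mul_eq_zero] at this
    rcases this with (h | h) | h <;> linarith
  have hDeq : D = 1 - 2 * r := by
    have : 1 / r * (volume.real (H ∩ Ioc y₁ y₂) - D) = 0 := by linarith
    rw [_root_.mul_eq_zero] at this
    rcases this with h | h
    · exact absurd h (by positivity)
    · linarith
  have hlb : ∀ t ∈ Icc (0 : ℝ) 1, lengthBelow H t = t := by
    intro t ht
    have h2 := measureReal_inter_add_sdiff (μ := volume) (s := H) (t := Iic t) measurableSet_Iic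
      (volume_ne_top_of_subset_Ioo hHs)
    have h3 : volume.real (H ∩ Iic t) ≤ t := by
      have := measureReal_mono (μ := volume) (s₁ := H ∩ Iic t) (s₂ := Ioc 0 t)
        (fun x hx => ⟨(hHs hx.1).1, hx.2⟩) (by simp)
      simpa [ht.1] using this
    have h4 : volume.real (H \ Iic t) ≤ 1 - t := by
      have := measureReal_mono (μ := volume) (s₁ := H \ Iic t) (s₂ := Ioo t 1)
        (fun x hx => ⟨not_le.1 hx.2, (hHs hx.1).2⟩) (by simp)
      simpa [ht.2] using this
    change volume.real (H ∩ Iic t) = t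
    linarith
  have hinv : ∀ t, 0 < lengthBelow H t → lengthBelow H t < 1 → lengthBelow H t = t := by
    intro t h2 h3
    refine hlb t ⟨?_, ?_⟩
    · by_contra hlt
      have := monotone_lengthBelow hHs (not_le.1 hlt).le
      rw [lengthBelow_zero hHs] at this; linarith
    · by_contra hlt
      have := monotone_lengthBelow hHs (not_le.1 hlt).le
      rw [lengthBelow_one hHs] at this; linarith
  rw [hH1] at hy₂
  have hy₁' : y₁ = r := by rw [← hinv y₁ (by linarith) (by linarith), hy₁]
  have hy₂' : y₂ = 1 - r := by rw [← hinv y₂ (by linarith) (by linarith), hy₂]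
  set S : Set (Fin 2 → ℝ) := unitSquare ∩ {x | x 1 ∈ Ioc r (1 - r)} with hS
  have hx1 : Measurable fun x : Fin 2 → ℝ => x 1 := measurable_pi_apply 1
  have hSv : volume S = ENNReal.ofReal (1 - 2 * r) := by
    have : S = univ.pi ![Ioo (0 : ℝ) 1, Ioc r (1 - r)] := by
      ext x
      simp only [hS, unitSquare, mem_inter_iff, Set.mem_pi, mem_univ, true_imp_iff,
        Fin.forall_fin_two,
        mem_ofPred_eq, Matrix.cons_val_zero, Matrix.cons_val_one]
      exact ⟨fun h => ⟨h.1.1, h.2⟩,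
        fun h => ⟨⟨h.1, by constructor <;> linarith [h.2.1, h.2.2]⟩, h.2⟩⟩
    rw [this, volume_pi_pi, Fin.prod_univ_two]
    simp only [Matrix.cons_val_zero, Matrix.cons_val_one, Real.volume_Ioo, Real.volume_Ioc]
    rw [sub_zero, ENNReal.ofReal_one, one_mul]; congr 1; ring
  have hEv : volume.real (E ∩ {x | x 1 ∈ H ∩ Ioc y₁ y₂}) = D := by
    have hMm : MeasurableSet (H ∩ Ioc y₁ y₂) := hHm.inter measurableSet_Ioc
    have hMm' : MeasurableSet {x : Fin 2 → ℝ | x 1 ∈ H ∩ Ioc y₁ y₂} := hx1 hMm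
    have h2 := setIntegral_height hE hEQ (f := (H ∩ Ioc y₁ y₂).indicator 1)
      (measurable_one.indicator hMm)
    have h3 : (fun x : Fin 2 → ℝ => (H ∩ Ioc y₁ y₂).indicator (1 : ℝ → ℝ) (x 1)) =
        ({x : Fin 2 → ℝ | x 1 ∈ H ∩ Ioc y₁ y₂}).indicator 1 := by
      funext x; by_cases hx : x 1 ∈ H ∩ Ioc y₁ y₂ <;> simp [indicator, hx]
    rw [h3, integral_indicator_one hMm', Measure.real, Measure.restrict_apply hMm',
      inter_comm] at h2
    rw [Measure.real, h2, hDdef, ← integral_indicator hMm]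
    congr 1; funext y
    by_cases hy' : y ∈ H ∩ Ioc y₁ y₂ <;> simp [indicator, hy']
  have hSm : MeasurableSet S :=
    (MeasurableSet.univ_pi fun _ => measurableSet_Ioo).inter (hx1 measurableSet_Ioc)
  have hsub : E ∩ {x | x 1 ∈ H ∩ Ioc y₁ y₂} ⊆ S ∩ E := fun x hx =>
    ⟨⟨hEQ hx.1, by have := hx.2.2; rwa [hy₁', hy₂'] at this⟩, hx.1⟩
  have hSfin : volume S ≠ ⊤ := by rw [hSv]; exact ENNReal.ofReal_ne_top
  have h5 := measureReal_mono (μ := volume) hsub (measure_ne_top_of_subset inter_subset_left hSfin)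
  have h6 := measureReal_inter_add_sdiff (μ := volume) (s := S) hE hSfin
  have h7 : volume.real S = 1 - 2 * r := by
    rw [Measure.real, hSv, ENNReal.toReal_ofReal (by linarith)]
  have h8 : volume.real (S \ E) = 0 :=
    le_antisymm (by linarith) measureReal_nonneg
  exact (measureReal_eq_zero_iff (measure_ne_top_of_subset sdiff_subset hSfin)).1 h8

end

/-- The distance of a real number to the interval `[r, 1 - r]`. -/
def insetDist (r t : ℝ) : ℝ := max (|t - 1 / 2| - (1 / 2 - r)) 0

/-- The distance of a point to the square `[r, 1 - r]²`. -/
def roundDist (r : ℝ) (x : Fin 2 → ℝ) : ℝ := √(insetDist r (x 0) ^ 2 + insetDist r (x 1) ^ 2)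

lemma insetDist_nonneg (r t : ℝ) : 0 ≤ insetDist r t := le_max_right _ _

@[fun_prop] lemma continuous_insetDist (r : ℝ) : Continuous (insetDist r) := by
  unfold insetDist; fun_prop

@[fun_prop] lemma continuous_roundDist (r : ℝ) : Continuous (roundDist r) := by
  unfold roundDist; fun_prop

lemma roundDist_sq (r : ℝ) (x : Fin 2 → ℝ) :
    roundDist r x ^ 2 = insetDist r (x 0) ^ 2 + insetDist r (x 1) ^ 2 :=
  Real.sq_sqrt (by positivity)

lemma insetDist_le_abs_sub {r c : ℝ} (hc : c ∈ Icc r (1 - r)) (t : ℝ) :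
    insetDist r t ≤ |t - c| := by
  refine max_le ?_ (abs_nonneg _)
  obtain ⟨h1, h2⟩ := hc
  rcases abs_cases (t - 1 / 2) with h | h <;> rcases abs_cases (t - c) with h' | h' <;> linarith

lemma exists_abs_sub_eq_insetDist {r : ℝ} (hr : r ≤ 1 / 2) (t : ℝ) :
    ∃ c ∈ Icc r (1 - r), |t - c| = insetDist r t := by
  rcases le_total t r with h | h
  · refine ⟨r, ⟨le_rfl, by linarith⟩, ?_⟩
    rw [insetDist, abs_of_nonpos (by linarith), abs_of_nonpos (by linarith),
      max_eq_left (by linarith)]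
    ring
  rcases le_total (1 - r) t with h' | h'
  · refine ⟨1 - r, ⟨by linarith, le_rfl⟩, ?_⟩
    rw [insetDist, abs_of_nonneg (by linarith), abs_of_nonneg (by linarith),
      max_eq_left (by linarith)]
    ring
  · refine ⟨t, ⟨h, h'⟩, ?_⟩
    have : |t - 1 / 2| ≤ 1 / 2 - r := abs_le.2 ⟨by linarith, by linarith⟩
    rw [insetDist, sub_self, abs_zero, max_eq_right (by linarith)]

lemma insetDist_le_add {r : ℝ} (hr : r ≤ 1 / 2) (s t : ℝ) :
    insetDist r s ≤ insetDist r t + |s - t| := by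
  obtain ⟨c, hc, h⟩ := exists_abs_sub_eq_insetDist hr t
  have := insetDist_le_abs_sub hc s
  have := abs_sub_le s t c
  linarith

lemma euclNorm_add_le (v w : Fin 2 → ℝ) : euclNorm (v + w) ≤ euclNorm v + euclNorm w := by
  unfold euclNorm
  have h1 := Real.sqrt_nonneg (v 0 ^ 2 + v 1 ^ 2)
  have h2 := Real.sqrt_nonneg (w 0 ^ 2 + w 1 ^ 2)
  have h3 : v 0 * w 0 + v 1 * w 1 ≤ √(v 0 ^ 2 + v 1 ^ 2) * √(w 0 ^ 2 + w 1 ^ 2) := by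
    rw [← Real.sqrt_mul (by positivity)]
    refine Real.le_sqrt_of_sq_le ?_
    nlinarith [sq_nonneg (v 0 * w 1 - v 1 * w 0)]
  refine (Real.sqrt_le_left (by positivity)).2 ?_
  simp only [Pi.add_apply]
  nlinarith [Real.sq_sqrt (show 0 ≤ v 0 ^ 2 + v 1 ^ 2 by positivity),
    Real.sq_sqrt (show 0 ≤ w 0 ^ 2 + w 1 ^ 2 by positivity)]

lemma roundDist_le_add {r : ℝ} (hr : r ≤ 1 / 2) (x y : Fin 2 → ℝ) :
    roundDist r x ≤ roundDist r y + euclNorm (x - y) := by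
  have h := euclNorm_add_le ![insetDist r (y 0), insetDist r (y 1)] ![|x 0 - y 0|, |x 1 - y 1|]
  simp only [euclNorm, Pi.add_apply, Matrix.cons_val_zero, Matrix.cons_val_one, sq_abs] at h
  refine le_trans (Real.sqrt_le_sqrt ?_) h
  have h0 := insetDist_le_add hr (x 0) (y 0)
  have h1 := insetDist_le_add hr (x 1) (y 1)
  have := insetDist_nonneg r (x 0)
  have := insetDist_nonneg r (x 1)
  gcongr

lemma isOpen_roundDist_lt (r s : ℝ) : IsOpen {x | roundDist r x < s} :=
  isOpen_lt (continuous_roundDist r) continuous_const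

lemma roundDist_lt_iff {r s : ℝ} (hs : 0 < s) (x : Fin 2 → ℝ) :
    roundDist r x < s ↔ insetDist r (x 0) ^ 2 + insetDist r (x 1) ^ 2 < s ^ 2 :=
  Real.sqrt_lt' hs

lemma insetDist_lt_iff {r c t : ℝ} (hc : 0 < c) :
    insetDist r t < c ↔ |t - 1 / 2| < 1 / 2 - r + c := by
  rw [insetDist, max_lt_iff, sub_lt_iff_lt_add', and_iff_left hc]

lemma roundDist_lt_subset_unitSquare {r : ℝ} (hr : 0 < r) :
    {x | roundDist r x < r} ⊆ unitSquare := by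
  intro x hx i _
  rw [mem_ofPred_eq, roundDist_lt_iff hr] at hx
  have h : insetDist r (x i) < r := by
    refine lt_of_pow_lt_pow_left₀ 2 hr.le (lt_of_le_of_lt ?_ hx)
    fin_cases i
    · exact le_add_of_nonneg_right (sq_nonneg _)
    · exact le_add_of_nonneg_left (sq_nonneg _)
  rw [insetDist_lt_iff hr, abs_lt] at h
  constructor <;> linarith [h.1, h.2]

lemma integral_sqrt_sq_sub_sq {s : ℝ} (hs : 0 < s) :
    ∫ x in (0 : ℝ)..s, √(s ^ 2 - x ^ 2) = Real.pi / 4 * s ^ 2 := by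
  have h : ∀ x : ℝ, √(s ^ 2 - x ^ 2) = s * √(1 - (x / s) ^ 2) := fun x => by
    rw [show s ^ 2 - x ^ 2 = s ^ 2 * (1 - (x / s) ^ 2) by field_simp, Real.sqrt_mul (sq_nonneg s),
      Real.sqrt_sq hs.le]
  simp_rw [h]
  rw [intervalIntegral.integral_const_mul, integral_sqrt_one_sub_div_sq hs]; ring

/-- Half the length of the sections of a rounded square. -/
def roundWidth (r s t : ℝ) : ℝ := 1 / 2 - r + √(s ^ 2 - insetDist r t ^ 2)

@[fun_prop] lemma continuous_roundWidth (r s : ℝ) : Continuous (roundWidth r s) := by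
  unfold roundWidth; fun_prop

lemma integral_roundWidth {r s : ℝ} (hr : r ≤ 1 / 2) (hs : 0 < s) :
    ∫ t in (r - s)..(1 - r + s), roundWidth r s t =
      ((1 - 2 * r) ^ 2 + 4 * (1 - 2 * r) * s + Real.pi * s ^ 2) / 2 := by
  have hi : ∀ a b, IntervalIntegrable (roundWidth r s) volume a b := fun a b =>
    (continuous_roundWidth r s).intervalIntegrable a b
  have hi' : ∀ a b, IntervalIntegrable (fun x : ℝ => √(s ^ 2 - x ^ 2)) volume a b := fun a b =>
    Continuous.intervalIntegrable (by fun_prop) a b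
  rw [← intervalIntegral.integral_add_adjacent_intervals (hi (r - s) (1 - r)) (hi _ _),
    ← intervalIntegral.integral_add_adjacent_intervals (hi (r - s) r) (hi r (1 - r))]
  have key : ∫ x in (0 : ℝ)..s, (1 / 2 - r + √(s ^ 2 - x ^ 2)) =
      (1 / 2 - r) * s + Real.pi / 4 * s ^ 2 := by
    rw [intervalIntegral.integral_add (by simp) (hi' _ _), integral_sqrt_sq_sub_sq hs]
    simp; ring
  have h1 : ∫ t in (r - s)..r, roundWidth r s t = (1 / 2 - r) * s + Real.pi / 4 * s ^ 2 := by
    have e := intervalIntegral.integral_comp_sub_left (a := r - s) (b := r)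
      (fun x : ℝ => 1 / 2 - r + √(s ^ 2 - x ^ 2)) r
    rw [sub_self, _root_.sub_sub_cancel, key] at e
    rw [← e]
    refine intervalIntegral.integral_congr fun t ht => ?_
    rw [uIcc_of_le (by linarith)] at ht
    simp only [roundWidth, insetDist]
    rw [abs_of_nonpos (by linarith [ht.2]), max_eq_left (by linarith [ht.2])]
    congr 4; ring
  have h2 : ∫ t in r..(1 - r), roundWidth r s t = (1 - 2 * r) * (1 / 2 - r + s) := by
    have : ∫ t in r..(1 - r), roundWidth r s t = ∫ t in r..(1 - r), (1 / 2 - r + s) := by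
      refine intervalIntegral.integral_congr fun t ht => ?_
      rw [uIcc_of_le (by linarith)] at ht
      have : |t - 1 / 2| ≤ 1 / 2 - r := abs_le.2 ⟨by linarith [ht.1], by linarith [ht.2]⟩
      simp only [roundWidth, insetDist]
      rw [max_eq_right (by linarith), zero_pow two_ne_zero, sub_zero, Real.sqrt_sq hs.le]
    rw [this]; simp; ring
  have h3 : ∫ t in (1 - r)..(1 - r + s), roundWidth r s t =
      (1 / 2 - r) * s + Real.pi / 4 * s ^ 2 := by
    have e := intervalIntegral.integral_comp_sub_right (a := 1 - r) (b := 1 - r + s)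
      (fun x : ℝ => 1 / 2 - r + √(s ^ 2 - x ^ 2)) (1 - r)
    rw [sub_self, add_sub_cancel_left, key] at e
    rw [← e]
    refine intervalIntegral.integral_congr fun t ht => ?_
    rw [uIcc_of_le (by linarith)] at ht
    simp only [roundWidth, insetDist]
    rw [abs_of_nonneg (by linarith [ht.1]), max_eq_left (by linarith [ht.1])]
    congr 4; ring
  rw [h1, h2, h3]; ring

lemma volume_roundDist_lt {r s : ℝ} (hr : r ≤ 1 / 2) (hs : 0 < s) :
    volume {x | roundDist r x < s} =
      ENNReal.ofReal ((1 - 2 * r) ^ 2 + 4 * (1 - 2 * r) * s + Real.pi * s ^ 2) := by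
  have hset : {x | roundDist r x < s} = MeasurableEquiv.finTwoArrow ⁻¹'
      (regionBetween (fun t => 1 / 2 - roundWidth r s t) (fun t => 1 / 2 + roundWidth r s t)
        (Ioo (r - s) (1 - r + s))) := by
    ext x
    have e : MeasurableEquiv.finTwoArrow x = (x 0, x 1) := rfl
    rw [mem_preimage, e, regionBetween, mem_ofPred_eq, mem_ofPred_eq, roundDist_lt_iff hs]
    change _ ↔ x 0 ∈ _ ∧ x 1 ∈ Ioo _ _
    have h0 := insetDist_nonneg r (x 0)
    have h1 := insetDist_nonneg r (x 1)
    constructor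
    · intro h
      have hB : insetDist r (x 0) < s := by nlinarith
      have hB1 : insetDist r (x 1) < √(s ^ 2 - insetDist r (x 0) ^ 2) :=
        (Real.lt_sqrt h1).2 (by linarith)
      rw [insetDist_lt_iff hs, abs_lt] at hB
      rw [insetDist_lt_iff (h1.trans_lt hB1), abs_lt] at hB1
      refine ⟨⟨by linarith, by linarith⟩, ?_, ?_⟩ <;> simp only [roundWidth] <;> linarith
    · rintro ⟨⟨ha, hb⟩, hc, hd⟩
      have hB : insetDist r (x 0) < s :=
        (insetDist_lt_iff hs).2 (abs_lt.2 ⟨by linarith, by linarith⟩)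
      have hpos : 0 < √(s ^ 2 - insetDist r (x 0) ^ 2) := Real.sqrt_pos.2 (by nlinarith)
      simp only [roundWidth] at hc hd
      have hB1 : insetDist r (x 1) < √(s ^ 2 - insetDist r (x 0) ^ 2) :=
        (insetDist_lt_iff hpos).2 (abs_lt.2 ⟨by linarith, by linarith⟩)
      linarith [(Real.lt_sqrt h1).1 hB1]
  rw [hset, (volume_preserving_finTwoArrow ℝ).measure_preimage_equiv, Measure.volume_eq_prod,
    volume_regionBetween_eq_integral]
  · rw [← integral_Ioc_eq_integral_Ioo, ← intervalIntegral.integral_of_le (by linarith)]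
    have : ∀ t, ((fun t => 1 / 2 + roundWidth r s t) - fun t => 1 / 2 - roundWidth r s t) t =
      2 * roundWidth r s t := fun t => by simp only [Pi.sub_apply]; ring
    simp_rw [this]
    rw [intervalIntegral.integral_const_mul, integral_roundWidth hr hs]
    congr 1; ring
  · exact (Continuous.integrableOn_Icc (by fun_prop)).mono_set Ioo_subset_Icc_self
  · exact (Continuous.integrableOn_Icc (by fun_prop)).mono_set Ioo_subset_Icc_self
  · exact measurableSet_Ioo
  · intro t _
    have : 0 ≤ roundWidth r s t := add_nonneg (by linarith) (Real.sqrt_nonneg _)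
    linarith

lemma volume_real_roundDist_lt {r s : ℝ} (hr : r ≤ 1 / 2) (hs : 0 < s) :
    volume.real {x | roundDist r x < s} =
      (1 - 2 * r) ^ 2 + 4 * (1 - 2 * r) * s + Real.pi * s ^ 2 := by
  have := Real.pi_pos
  have : 0 ≤ 1 - 2 * r := by linarith
  rw [Measure.real, volume_roundDist_lt hr hs, ENNReal.toReal_ofReal (by positivity)]

lemma volume_real_roundDist_lt_self {r : ℝ} (hr : r ≤ 1 / 2) (hr0 : 0 < r) :
    volume.real {x | roundDist r x < r} = 1 - (4 - Real.pi) * r ^ 2 := by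
  rw [volume_real_roundDist_lt hr hr0]; ring

lemma volume_roundDist_eq {r s : ℝ} (hr : r ≤ 1 / 2) (hs : 0 < s) :
    volume {x | roundDist r x = s} = 0 := by
  have hm : ∀ t, MeasurableSet {x | roundDist r x < t} := fun t =>
    (isOpen_roundDist_lt r t).measurableSet
  have hfin : ∀ t, 0 < t → volume {x | roundDist r x < t} ≠ ⊤ := fun t ht => by
    rw [volume_roundDist_lt hr ht]; exact ENNReal.ofReal_ne_top
  have hle : ∀ t ∈ Ioi s, volume.real {x | roundDist r x = s} ≤
      ((1 - 2 * r) ^ 2 + 4 * (1 - 2 * r) * t + Real.pi * t ^ 2) -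
      ((1 - 2 * r) ^ 2 + 4 * (1 - 2 * r) * s + Real.pi * s ^ 2) := by
    intro t ht
    have ht' : s < t := ht
    rw [← volume_real_roundDist_lt hr hs, ← volume_real_roundDist_lt hr (hs.trans ht'),
      ← measureReal_sdiff (s₁ := {x | roundDist r x < t}) (s₂ := {x | roundDist r x < s})
        (fun x (hx : _ < s) => hx.trans ht') (hm s) (hfin _ (hs.trans ht'))]
    refine measureReal_mono (fun x (hx : _ = s) => ⟨?_, ?_⟩)
      (measure_ne_top_of_subset sdiff_subset (hfin t (hs.trans ht')))
    · exact hx.trans_lt ht'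
    · exact fun h => absurd h (not_lt.2 hx.ge)
  have hlim : Tendsto (fun t => ((1 - 2 * r) ^ 2 + 4 * (1 - 2 * r) * t + Real.pi * t ^ 2) -
      ((1 - 2 * r) ^ 2 + 4 * (1 - 2 * r) * s + Real.pi * s ^ 2)) (nhdsWithin s (Ioi s))
      (nhds 0) := by
    have hc : Continuous fun t => ((1 - 2 * r) ^ 2 + 4 * (1 - 2 * r) * t + Real.pi * t ^ 2) -
      ((1 - 2 * r) ^ 2 + 4 * (1 - 2 * r) * s + Real.pi * s ^ 2) := by fun_prop
    have := (hc.tendsto s).mono_left (nhdsWithin_le_nhds (s := Ioi s))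
    rwa [sub_self] at this
  have h0 := ge_of_tendsto hlim (eventually_nhdsWithin_of_forall hle)
  have hsub : {x | roundDist r x = s} ⊆ {x | roundDist r x < s + 1} := fun x (hx : _ = s) => by
    change roundDist r x < s + 1; linarith
  exact (measureReal_eq_zero_iff (measure_ne_top_of_subset hsub (hfin _ (by linarith)))).1
    (le_antisymm h0 measureReal_nonneg)

lemma abs_apply_le_euclNorm (v : Fin 2 → ℝ) (i : Fin 2) : |v i| ≤ euclNorm v := by
  refine Real.abs_le_sqrt ?_
  fin_cases i
  · exact le_add_of_nonneg_right (sq_nonneg _)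
  · exact le_add_of_nonneg_left (sq_nonneg _)

lemma euclNorm_single (i : Fin 2) (t : ℝ) : euclNorm (Pi.single i t) = |t| := by
  fin_cases i <;> simp [euclNorm, Real.sqrt_sq_eq_abs]

/-- The plaquette of the unit square is a rounded square. -/
lemma plaquette_unitSquare {r : ℝ} (hr : 0 < r) (hr2 : r ≤ 1 / 2) :
    plaquette euclNorm unitSquare r = {x | roundDist r x < r} := by
  rw [plaquette, if_neg hr.ne']
  ext y
  simp only [mem_iUnion, exists_prop, mem_ofPred_eq]
  constructor
  · rintro ⟨c, hc, hy⟩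
    have hmem : ∀ (i : Fin 2) (t : ℝ), |t| < r → c i + t ∈ Ioo (0 : ℝ) 1 := fun i t ht => by
      have : c + Pi.single i t ∈ unitSquare := hc (by
        change euclNorm _ < r
        rwa [add_sub_cancel_left, euclNorm_single])
      simpa using this i (mem_univ i)
    have hcI : ∀ i, c i ∈ Icc r (1 - r) := by
      intro i
      have hlim : ∀ t, 0 < t → t < r → t ≤ c i ∧ c i ≤ 1 - t := fun t ht0 ht => by
        have h1 := hmem i (-t) (by rwa [abs_neg, abs_of_pos ht0])
        have h2 := hmem i t (by rwa [abs_of_pos ht0])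
        constructor <;> linarith [h1.1, h2.2]
      constructor
      · refine le_of_forall_lt fun t ht => ?_
        have h1 := (hlim (max ((t + r) / 2) (r / 2)) (lt_max_of_lt_right (by linarith))
          (max_lt (by linarith) (by linarith))).1
        linarith [le_max_left ((t + r) / 2) (r / 2)]
      · suffices r ≤ 1 - c i by linarith
        refine le_of_forall_lt fun t ht => ?_
        have h1 := (hlim (max ((t + r) / 2) (r / 2)) (lt_max_of_lt_right (by linarith))
          (max_lt (by linarith) (by linarith))).2
        linarith [le_max_left ((t + r) / 2) (r / 2)]
    refine lt_of_le_of_lt (Real.sqrt_le_sqrt ?_) (hy : euclNorm (y - c) < r)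
    rw [← sq_abs ((y - c) 0), ← sq_abs ((y - c) 1)]
    have h0 := insetDist_le_abs_sub (hcI 0) (y 0)
    have h1 := insetDist_le_abs_sub (hcI 1) (y 1)
    have := insetDist_nonneg r (y 0)
    have := insetDist_nonneg r (y 1)
    simp only [Pi.sub_apply]
    gcongr
  · intro hy
    choose c hc hce using fun i => exists_abs_sub_eq_insetDist hr2 (y i)
    refine ⟨c, fun z hz i _ => ?_, ?_⟩
    · have h1 := (abs_apply_le_euclNorm (z - c) i).trans_lt hz
      rw [Pi.sub_apply, abs_lt] at h1
      constructor <;> linarith [(hc i).1, (hc i).2]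
    · change euclNorm _ < r
      rw [roundDist, ← hce 0, ← hce 1, sq_abs, sq_abs] at hy
      exact hy

/-- The closure of the density points of a set which agrees a.e. with an open set. -/
lemma closure_densityPoints {E R : Set (Fin 2 → ℝ)} (hR : IsOpen R) (hER : E =ᵐ[volume] R) :
    closure (densityPoints E) = closure R := by
  have hcongr : ∀ x r, volume (E ∩ Metric.ball x r) = volume (R ∩ Metric.ball x r) := fun x r =>
    measure_congr (hER.inter (ae_eq_refl _))
  have hb : ∀ (x : Fin 2 → ℝ) (r : ℝ), 0 < r → volume (Metric.ball x r) ≠ 0 := fun x r hr =>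
    (Metric.measure_ball_pos _ _ hr).ne'
  have hnh : ∀ ε : ℝ, 0 < ε → ∀ᶠ r in nhdsWithin (0 : ℝ) (Ioi 0), r ∈ Ioo 0 ε := fun ε hε =>
    Ioo_mem_nhdsGT hε
  refine le_antisymm (closure_minimal (fun x hx => ?_) isClosed_closure)
    (closure_mono fun x hx => ?_)
  · by_contra hxR
    obtain ⟨ε, hε, hball⟩ := Metric.isOpen_iff.1 isClosed_closure.isOpen_compl x hxR
    have h0 : Tendsto (fun r : ℝ => volume (E ∩ Metric.ball x r) / volume (Metric.ball x r))
        (nhdsWithin 0 (Ioi 0)) (nhds 0) := by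
      refine tendsto_const_nhds.congr' ((hnh ε hε).mono fun r hr => ?_)
      have : R ∩ Metric.ball x r = ∅ := by
        refine eq_empty_of_forall_notMem fun z hz => ?_
        exact hball (Metric.ball_subset_ball hr.2.le hz.2) (subset_closure hz.1)
      beta_reduce
      rw [hcongr, this, measure_empty, ENNReal.zero_div]
    exact zero_ne_one (tendsto_nhds_unique h0 hx)
  · obtain ⟨ε, hε, hball⟩ := Metric.isOpen_iff.1 hR x hx
    refine tendsto_const_nhds.congr' ((hnh ε hε).mono fun r hr => ?_)
    beta_reduce
    rw [hcongr, inter_eq_self_of_subset_right ((Metric.ball_subset_ball hr.2.le).trans hball),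
      ENNReal.div_self (hb x r hr.1) Metric.isBounded_ball.measure_lt_top.ne]

lemma euclNorm_le_two_mul_norm (v : Fin 2 → ℝ) : euclNorm v ≤ 2 * ‖v‖ := by
  have h0 := norm_le_pi_norm v 0
  have h1 := norm_le_pi_norm v 1
  rw [Real.norm_eq_abs] at h0 h1
  refine (Real.sqrt_le_left (by positivity)).2 ?_
  rw [← sq_abs (v 0), ← sq_abs (v 1)]
  nlinarith [abs_nonneg (v 0), abs_nonneg (v 1), norm_nonneg v]

lemma euclNorm_smul (t : ℝ) (v : Fin 2 → ℝ) : euclNorm (t • v) = |t| * euclNorm v := by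
  simp only [euclNorm, Pi.smul_apply, smul_eq_mul, mul_pow]
  rw [← mul_add, Real.sqrt_mul (sq_nonneg t), Real.sqrt_sq_eq_abs]

lemma euclNorm_nonneg (v : Fin 2 → ℝ) : 0 ≤ euclNorm v := Real.sqrt_nonneg _

/-- The total variation of a Lipschitz function which has a local extremum at every point
outside a set of finite measure. -/
lemma integral_mul_diverg_le {ψ : (Fin 2 → ℝ) → ℝ} {L : ℝ} (hL : 0 ≤ L)
    (hψ : ∀ x y, |ψ x - ψ y| ≤ L * euclNorm (x - y)) {S : Set (Fin 2 → ℝ)}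
    (hSm : MeasurableSet S) (hS : volume S ≠ ⊤) (hext : ∀ x ∉ S, IsLocalExtr ψ x)
    {η : (Fin 2 → ℝ) → (Fin 2 → ℝ)} (hη : ContDiff ℝ 1 η) (hηs : HasCompactSupport η)
    (hη1 : ∀ x, euclNorm (η x) ≤ 1) : ∫ x, ψ x * diverg η x ≤ L * volume.real S := by
  have hlip : LipschitzWith (2 * L).toNNReal ψ := LipschitzWith.of_dist_le_mul fun x y => by
    rw [Real.dist_eq, dist_eq_norm, Real.coe_toNNReal _ (by positivity)]
    refine (hψ x y).trans ?_
    nlinarith [euclNorm_le_two_mul_norm (x - y)]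
  have hηi : ∀ i, ContDiff ℝ 1 fun x => η x i := fun i => contDiff_pi.1 hη i
  have hηis : ∀ i, HasCompactSupport fun x => η x i := fun i =>
    hηs.comp_left (g := fun v : Fin 2 → ℝ => v i) rfl
  have hη' : ∀ i x, HasFDerivAt (fun x => η x i)
      ((ContinuousLinearMap.proj i : (Fin 2 → ℝ) →L[ℝ] ℝ).comp (fderiv ℝ η x)) x := fun i x =>
    (ContinuousLinearMap.proj i : (Fin 2 → ℝ) →L[ℝ] ℝ).hasFDerivAt.comp x
      (hη.differentiable one_ne_zero x).hasFDerivAt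
  have hld : ∀ i x, lineDeriv ℝ (fun x => η x i) x (Pi.single i 1) =
      fderiv ℝ η x (Pi.single i 1) i := fun i x =>
    ((hη' i x).hasLineDerivAt _).lineDeriv
  have hparts : ∀ i, ∫ x, ψ x * fderiv ℝ η x (Pi.single i 1) i =
      ∫ x, lineDeriv ℝ ψ x (-Pi.single i 1) * η x i := fun i => by
    obtain ⟨D, hD⟩ := (hηi i).lipschitzWith_of_hasCompactSupport (hηis i) one_ne_zero
    rw [hlip.integral_lineDeriv_mul_eq hD (hηis i), neg_neg]
    simp_rw [hld, mul_comm]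
  have hi1 : ∀ i, Integrable fun x => ψ x * fderiv ℝ η x (Pi.single i 1) i := fun i => by
    refine Continuous.integrable_of_hasCompactSupport ?_ ?_
    · exact hlip.continuous.mul ((continuous_apply i).comp
        ((hη.continuous_fderiv one_ne_zero).clm_apply continuous_const))
    · refine HasCompactSupport.mul_left ?_
      refine (hηs.fderiv (𝕜 := ℝ)).comp_left
        (g := fun A : (Fin 2 → ℝ) →L[ℝ] (Fin 2 → ℝ) => A (Pi.single i 1) i) rfl
  have hi2 : ∀ i, Integrable fun x => lineDeriv ℝ ψ x (-Pi.single i 1) * η x i := fun i => by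
    refine Integrable.bdd_mul ((hηi i).continuous.integrable_of_hasCompactSupport (hηis i))
      (aestronglyMeasurable_lineDeriv hlip.continuous volume)
      (Eventually.of_forall fun x => norm_lineDeriv_le_of_lipschitz ℝ hlip)
  have hsum : ∫ x, ψ x * diverg η x =
      ∫ x, ∑ i, lineDeriv ℝ ψ x (-Pi.single i 1) * η x i := by
    rw [integral_finsetSum _ fun i _ => hi2 i]
    simp_rw [← hparts]
    rw [← integral_finsetSum _ fun i _ => hi1 i]
    simp_rw [diverg, Finset.mul_sum]
  rw [hsum]
  have hSi : Integrable (S.indicator fun _ => L) :=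
    (integrable_indicator_iff hSm).2 (integrableOn_const hS)
  have hle : ∫ x, ∑ i, lineDeriv ℝ ψ x (-Pi.single i 1) * η x i ≤
      ∫ x, S.indicator (fun _ => L) x := by
    refine integral_mono_ae (integrable_finsetSum _ fun i _ => hi2 i) hSi ?_
    filter_upwards [hlip.ae_differentiableAt] with x hx
    have h1 : ∀ i, lineDeriv ℝ ψ x (-Pi.single i 1) = fderiv ℝ ψ x (-Pi.single i 1) := fun i =>
      (hx.hasFDerivAt.hasLineDerivAt _).lineDeriv
    have h2 : ∑ i, lineDeriv ℝ ψ x (-Pi.single i 1) * η x i = - fderiv ℝ ψ x (η x) := by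
      have h3 : η x = η x 0 • Pi.single 0 (1 : ℝ) + η x 1 • Pi.single 1 (1 : ℝ) := by
        ext i; fin_cases i <;> simp
      rw [Fin.sum_univ_two, h1, h1, map_neg, map_neg]
      conv_rhs => rw [h3, map_add, map_smul, map_smul]
      simp only [smul_eq_mul]
      ring
    rw [h2]
    by_cases hxS : x ∈ S
    · rw [indicator_of_mem hxS]
      set v := η x
      have h4 : HasDerivAt (fun t : ℝ => ψ (x + t • v)) (fderiv ℝ ψ x v) 0 :=
        hx.hasFDerivAt.hasLineDerivAt v
      have h5 : LipschitzWith L.toNNReal fun t : ℝ => ψ (x + t • v) :=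
        LipschitzWith.of_dist_le_mul fun s t => by
          rw [Real.dist_eq, Real.dist_eq, Real.coe_toNNReal _ hL]
          refine (hψ _ _).trans ?_
          rw [add_sub_add_left_eq_sub, ← sub_smul, euclNorm_smul]
          exact mul_le_mul_of_nonneg_left
            (mul_le_of_le_one_right (abs_nonneg _) (hη1 x)) hL
      have h6 := norm_deriv_le_of_lipschitz h5 (x₀ := 0)
      rw [h4.deriv, Real.coe_toNNReal _ hL, Real.norm_eq_abs] at h6
      linarith [neg_abs_le (fderiv ℝ ψ x v)]
    · rw [indicator_of_notMem hxS, (hext x hxS).fderiv_eq_zero]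
      simp
  refine hle.trans_eq ?_
  rw [integral_indicator hSm, setIntegral_const, smul_eq_mul, mul_comm]

/-- A Lipschitz cutoff function of a rounded square. -/
def roundCutoff (r δ : ℝ) (x : Fin 2 → ℝ) : ℝ := max 0 (min 1 ((r - roundDist r x) / δ))

lemma roundCutoff_nonneg (r δ : ℝ) (x : Fin 2 → ℝ) : 0 ≤ roundCutoff r δ x := le_max_left _ _

lemma roundCutoff_le_one (r δ : ℝ) (x : Fin 2 → ℝ) : roundCutoff r δ x ≤ 1 :=
  max_le zero_le_one (min_le_left _ _)

lemma roundCutoff_eq_one {r δ : ℝ} (hδ : 0 < δ) {x : Fin 2 → ℝ} (h : roundDist r x ≤ r - δ) :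
    roundCutoff r δ x = 1 := by
  rw [roundCutoff, min_eq_left, max_eq_right zero_le_one]
  rw [le_div_iff₀ hδ]; linarith

lemma roundCutoff_eq_zero {r δ : ℝ} (hδ : 0 < δ) {x : Fin 2 → ℝ} (h : r ≤ roundDist r x) :
    roundCutoff r δ x = 0 :=
  max_eq_left (min_le_of_right_le (div_nonpos_of_nonpos_of_nonneg (by linarith) hδ.le))

lemma abs_roundCutoff_sub_le {r δ : ℝ} (hr : r ≤ 1 / 2) (hδ : 0 < δ) (x y : Fin 2 → ℝ) :
    |roundCutoff r δ x - roundCutoff r δ y| ≤ 1 / δ * euclNorm (x - y) := by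
  have h1 := abs_max_sub_max_le_max 0 (min 1 ((r - roundDist r x) / δ)) 0
    (min 1 ((r - roundDist r y) / δ))
  have h2 := abs_min_sub_min_le_max 1 ((r - roundDist r x) / δ) 1 ((r - roundDist r y) / δ)
  have hnn : 0 ≤ 1 / δ * euclNorm (x - y) := mul_nonneg (by positivity) (euclNorm_nonneg _)
  rw [sub_self, abs_zero] at h1 h2
  refine h1.trans (max_le hnn (h2.trans (max_le hnn ?_)))
  have h3 : (r - roundDist r x) / δ - (r - roundDist r y) / δ =
    1 / δ * (roundDist r y - roundDist r x) := by ring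
  rw [h3, abs_mul, abs_of_pos (by positivity : 0 < 1 / δ)]
  refine mul_le_mul_of_nonneg_left (abs_le.2 ⟨?_, ?_⟩) (by positivity)
  · linarith [roundDist_le_add hr x y]
  · have h4 : euclNorm (y - x) = euclNorm (x - y) := by
      rw [← neg_sub, ← neg_one_smul ℝ, euclNorm_smul, abs_neg, abs_one, one_mul]
    linarith [roundDist_le_add hr y x]

lemma continuous_roundCutoff (r δ : ℝ) : Continuous (roundCutoff r δ) := by
  unfold roundCutoff; fun_prop

lemma continuous_diverg {η : (Fin 2 → ℝ) → (Fin 2 → ℝ)} (hη : ContDiff ℝ 1 η) :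
    Continuous (diverg η) :=
  continuous_finsetSum _ fun i _ => (continuous_apply i).comp
    ((hη.continuous_fderiv one_ne_zero).clm_apply continuous_const)

lemma hasCompactSupport_diverg {η : (Fin 2 → ℝ) → (Fin 2 → ℝ)} (hηs : HasCompactSupport η) :
    HasCompactSupport (diverg η) :=
  (hηs.fderiv (𝕜 := ℝ)).comp_left
    (g := fun A : (Fin 2 → ℝ) →L[ℝ] (Fin 2 → ℝ) => ∑ i, A (Pi.single i 1) i) (by simp)

lemma integral_roundDist_lt_diverg_le {r : ℝ} (hr0 : 0 < r) (hr : r ≤ 1 / 2)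
    {η : (Fin 2 → ℝ) → (Fin 2 → ℝ)} (hη : ContDiff ℝ 1 η) (hηs : HasCompactSupport η)
    (hη1 : ∀ x, euclNorm (η x) ≤ 1) :
    ∫ x in {x | roundDist r x < r}, diverg η x ≤ 4 - 2 * (4 - Real.pi) * r := by
  have hδ : ∀ n : ℕ, 0 < r / (n + 2) ∧ r / (n + 2) < r := fun n => by
    have : (0 : ℝ) ≤ n := n.cast_nonneg
    exact ⟨by positivity, div_lt_self hr0 (by linarith)⟩
  have hle : ∀ n : ℕ, ∫ x, roundCutoff r (r / (n + 2)) x * diverg η x ≤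
      4 - 2 * (4 - Real.pi) * r := by
    intro n
    obtain ⟨h0, h1⟩ := hδ n
    set δ := r / ((n : ℝ) + 2)
    have hm : ∀ t, MeasurableSet {x | roundDist r x < t} := fun t =>
      (isOpen_roundDist_lt r t).measurableSet
    have hfin : volume {x | roundDist r x < r} ≠ ⊤ := by
      rw [volume_roundDist_lt hr hr0]; exact ENNReal.ofReal_ne_top
    have := integral_mul_diverg_le (L := 1 / δ) (by positivity) (abs_roundCutoff_sub_le hr h0)
      (S := {x | roundDist r x < r} \ {x | roundDist r x < r - δ}) ((hm _).diff (hm _))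
      (measure_ne_top_of_subset sdiff_subset hfin) (fun x hx => ?_) hη hηs hη1
    · refine this.trans ?_
      rw [measureReal_sdiff (s₁ := {x | roundDist r x < r}) (s₂ := {x | roundDist r x < r - δ})
        (fun x (hx : roundDist r x < r - δ) => hx.trans (by linarith)) (hm _) hfin,
        volume_real_roundDist_lt hr hr0, volume_real_roundDist_lt hr (by linarith)]
      have : 1 / δ * ((1 - 2 * r) ^ 2 + 4 * (1 - 2 * r) * r + Real.pi * r ^ 2 -
          ((1 - 2 * r) ^ 2 + 4 * (1 - 2 * r) * (r - δ) + Real.pi * (r - δ) ^ 2)) =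
          4 * (1 - 2 * r) + 2 * Real.pi * r - Real.pi * δ := by
        field_simp; ring
      rw [this]
      nlinarith [Real.pi_pos]
    · by_cases h : roundDist r x < r
      · refine Or.inr (Eventually.of_forall fun y => ?_)
        have h' : roundDist r x ≤ r - δ := by
          by_contra h''
          refine hx ⟨h, fun hlt => ?_⟩
          exact h'' (le_of_lt hlt)
        rw [roundCutoff_eq_one h0 h']; exact roundCutoff_le_one _ _ _
      · refine Or.inl (Eventually.of_forall fun y => ?_)
        rw [roundCutoff_eq_zero h0 (not_lt.1 h)]; exact roundCutoff_nonneg _ _ _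
  have hlim : Tendsto (fun n : ℕ => ∫ x, roundCutoff r (r / (n + 2)) x * diverg η x) atTop
      (nhds (∫ x, {x | roundDist r x < r}.indicator (diverg η) x)) := by
    refine tendsto_integral_of_dominated_convergence (fun x => ‖diverg η x‖)
      (fun n => ((continuous_roundCutoff _ _).mul (continuous_diverg hη)).aestronglyMeasurable)
      ((continuous_diverg hη).integrable_of_hasCompactSupport
        (hasCompactSupport_diverg hηs)).norm (fun n => Eventually.of_forall fun x => ?_)
      (Eventually.of_forall fun x => ?_)
    · rw [norm_mul, Real.norm_of_nonneg (roundCutoff_nonneg _ _ _)]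
      exact mul_le_of_le_one_left (norm_nonneg _) (roundCutoff_le_one _ _ _)
    · refine tendsto_const_nhds.congr' ?_
      by_cases hx : roundDist r x < r
      · have ht : Tendsto (fun n : ℕ => r / ((n : ℝ) + 2)) atTop (nhds 0) :=
          tendsto_const_nhds.div_atTop
            (tendsto_natCast_atTop_atTop.atTop_add tendsto_const_nhds)
        filter_upwards [ht.eventually_lt_const (sub_pos.2 hx)] with n hn
        rw [roundCutoff_eq_one (hδ n).1 (by linarith), one_mul, indicator_of_mem (by exact hx)]
      · refine Eventually.of_forall fun n => ?_
        beta_reduce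
        rw [roundCutoff_eq_zero (hδ n).1 (not_lt.1 hx), zero_mul,
          indicator_of_notMem (by exact hx)]
  rw [integral_indicator (isOpen_roundDist_lt r r).measurableSet] at hlim
  exact le_of_tendsto' hlim hle

/-- The total variation of a multiple of a rounded square. -/
lemma anisoTV_roundDist_le {r : ℝ} (hr0 : 0 < r) (hr : r ≤ 1 / 2) {c : ℝ} (hc : 0 ≤ c) :
    anisoTV euclNorm ({x | roundDist r x < r}.indicator fun _ => c) ≤
      ENNReal.ofReal (c * (4 - 2 * (4 - Real.pi) * r)) := by
  refine iSup₂_le fun η hη => ENNReal.ofReal_le_ofReal ?_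
  have h := integral_roundDist_lt_diverg_le hr0 hr hη.1 hη.2.1 hη.2.2
  have e : ∀ x, {x | roundDist r x < r}.indicator (fun _ => c) x * diverg η x =
      {x | roundDist r x < r}.indicator (fun x => c * diverg η x) x := fun x => by
    by_cases hx : x ∈ {x | roundDist r x < r} <;> simp [indicator, hx]
  simp_rw [e]
  rw [integral_indicator (isOpen_roundDist_lt r r).measurableSet, integral_const_mul]
  exact mul_le_mul_of_nonneg_left h hc

lemma isPrim_of_hasDerivAt {F k : ℝ → ℝ} {S : Set ℝ} (hS : S.Countable) (hF : Continuous F)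
    (hd : ∀ t ∉ S, HasDerivAt F (k t) t) (hk : LocallyIntegrable k) : IsPrim F k := by
  refine ⟨hk, fun t => ?_⟩
  rw [MeasureTheory.integral_eq_of_hasDerivAt_off_countable F k hS hF.continuousOn
    (fun x hx => hd x hx.2) ((hk.integrableOn_isCompact isCompact_uIcc).intervalIntegrable)]
  ring

lemma locallyIntegrable_of_bound {α : Type*} [TopologicalSpace α] [MeasurableSpace α]
    {μ : Measure α} [IsLocallyFiniteMeasure μ] {f : α → ℝ} (hf : Measurable f) (C : ℝ)
    (hC : ∀ x, |f x| ≤ C) : LocallyIntegrable f μ :=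
  (memLp_top_of_bound hf.aestronglyMeasurable C (Eventually.of_forall hC)).locallyIntegrable le_top

/-- The piecewise affine function growing from `0` to `1` on `[p, q]`. -/
def affineRamp (p q t : ℝ) : ℝ := max 0 (min 1 ((t - p) / (q - p)))

/-- The derivative of `affineRamp p q`. -/
def affineRampDeriv (p q t : ℝ) : ℝ := (Ioo p q).indicator (fun _ => 1 / (q - p)) t

@[fun_prop] lemma continuous_affineRamp (p q : ℝ) : Continuous (affineRamp p q) := by
  unfold affineRamp; fun_prop

@[fun_prop] lemma measurable_affineRampDeriv (p q : ℝ) : Measurable (affineRampDeriv p q) :=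
  measurable_const.indicator measurableSet_Ioo

lemma affineRamp_nonneg (p q t : ℝ) : 0 ≤ affineRamp p q t := le_max_left _ _

lemma affineRamp_le_one (p q t : ℝ) : affineRamp p q t ≤ 1 := max_le zero_le_one (min_le_left _ _)

lemma affineRamp_of_le {p q t : ℝ} (h : p < q) (ht : t ≤ p) : affineRamp p q t = 0 :=
  max_eq_left (min_le_of_right_le (div_nonpos_of_nonpos_of_nonneg (by linarith) (by linarith)))

lemma affineRamp_of_ge {p q t : ℝ} (h : p < q) (ht : q ≤ t) : affineRamp p q t = 1 := by
  rw [affineRamp, min_eq_left, max_eq_right zero_le_one]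
  rw [le_div_iff₀ (by linarith)]; linarith

lemma affineRamp_of_mem {p q t : ℝ} (h : p < q) (ht : t ∈ Icc p q) :
    affineRamp p q t = (t - p) / (q - p) := by
  rw [affineRamp, min_eq_right, max_eq_right]
  · exact div_nonneg (by linarith [ht.1]) (by linarith)
  · rw [div_le_one (by linarith)]; linarith [ht.2]

lemma affineRampDeriv_nonneg {p q : ℝ} (h : p < q) (t : ℝ) : 0 ≤ affineRampDeriv p q t :=
  indicator_nonneg (fun _ _ => (one_div_pos.2 (sub_pos.2 h)).le) t

lemma affineRampDeriv_le {p q : ℝ} (h : p < q) (t : ℝ) : affineRampDeriv p q t ≤ 1 / (q - p) :=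
  indicator_le_self' (fun _ _ => (one_div_pos.2 (sub_pos.2 h)).le) t

lemma hasDerivAt_affineRamp {p q t : ℝ} (h : p < q) (hp : t ≠ p) (hq : t ≠ q) :
    HasDerivAt (affineRamp p q) (affineRampDeriv p q t) t := by
  rcases lt_or_gt_of_ne hp with h1 | h1
  · rw [affineRampDeriv, indicator_of_notMem fun h' => absurd h'.1 (not_lt.2 h1.le)]
    refine (hasDerivAt_const t (0 : ℝ)).congr_of_eventuallyEq ?_
    filter_upwards [Iio_mem_nhds h1] with s hs
    exact affineRamp_of_le h (le_of_lt hs)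
  rcases lt_or_gt_of_ne hq with h2 | h2
  · rw [affineRampDeriv, indicator_of_mem (show t ∈ Ioo p q from ⟨h1, h2⟩)]
    refine (((hasDerivAt_id t).sub_const p).div_const (q - p)).congr_of_eventuallyEq ?_
    filter_upwards [Ioo_mem_nhds h1 h2] with s hs
    exact affineRamp_of_mem h (Ioo_subset_Icc_self hs)
  · rw [affineRampDeriv, indicator_of_notMem fun h' => absurd h'.2 (not_lt.2 h2.le)]
    refine (hasDerivAt_const t (1 : ℝ)).congr_of_eventuallyEq ?_
    filter_upwards [Ioi_mem_nhds h2] with s hs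
    exact affineRamp_of_ge h (le_of_lt hs)

lemma hasDerivAt_max_zero_sq (w : ℝ) : HasDerivAt (fun w : ℝ => max w 0 ^ 2) (2 * max w 0) w := by
  rcases lt_trichotomy w 0 with h | rfl | h
  · rw [max_eq_right h.le, mul_zero]
    refine (hasDerivAt_const w (0 : ℝ)).congr_of_eventuallyEq ?_
    filter_upwards [Iio_mem_nhds h] with s hs
    rw [max_eq_right (le_of_lt hs), zero_pow two_ne_zero]
  · rw [hasDerivAt_iff_tendsto_slope_zero, max_self, mul_zero]
    have hc : Tendsto (fun t : ℝ => max t 0) (nhdsWithin 0 {0}ᶜ) (nhds 0) := by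
      have : Continuous fun t : ℝ => max t 0 := by fun_prop
      have := (this.tendsto 0).mono_left (nhdsWithin_le_nhds (s := {0}ᶜ))
      rwa [max_self] at this
    refine hc.congr' (eventually_nhdsWithin_of_forall fun t ht => ?_)
    beta_reduce
    rw [zero_add, zero_pow two_ne_zero, sub_zero, smul_eq_mul]
    rcases le_total t 0 with h | h
    · rw [max_eq_right h]; ring
    · rw [max_eq_left h, sq, inv_mul_cancel_left₀ ht]
  · rw [max_eq_left h.le]
    have := (hasDerivAt_pow 2 w).congr_of_eventuallyEq (f₁ := fun w : ℝ => max w 0 ^ 2) (by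
      filter_upwards [Ioi_mem_nhds h] with s hs
      rw [max_eq_left (le_of_lt hs)])
    simpa using this

/-- The piecewise affine odd profile which vanishes on `[r, 1 - r]`. -/
def edge (r t : ℝ) : ℝ := affineRamp 0 r t + affineRamp (1 - r) 1 t - 1

def edgeDeriv (r t : ℝ) : ℝ := affineRampDeriv 0 r t + affineRampDeriv (1 - r) 1 t

/-- The piecewise affine odd profile which grows from `-1` to `1` on `[r, 1 - r]`. -/
def core (r t : ℝ) : ℝ := 2 * affineRamp r (1 - r) t - 1

def coreDeriv (r t : ℝ) : ℝ := 2 * affineRampDeriv r (1 - r) t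

/-- The circular profile attached to `edge`. -/
def arc (r t : ℝ) : ℝ := √(1 - edge r t ^ 2)

@[fun_prop] lemma continuous_edge (r : ℝ) : Continuous (edge r) := by unfold edge; fun_prop
@[fun_prop] lemma continuous_core (r : ℝ) : Continuous (core r) := by unfold core; fun_prop
@[fun_prop] lemma continuous_arc (r : ℝ) : Continuous (arc r) := by unfold arc; fun_prop
@[fun_prop] lemma measurable_edgeDeriv (r : ℝ) : Measurable (edgeDeriv r) := by
  unfold edgeDeriv; fun_prop
@[fun_prop] lemma measurable_coreDeriv (r : ℝ) : Measurable (coreDeriv r) := by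
  unfold coreDeriv; fun_prop

lemma abs_edge_le (r t : ℝ) : |edge r t| ≤ 1 := by
  have h1 := affineRamp_nonneg 0 r t
  have h2 := affineRamp_nonneg (1 - r) 1 t
  have h3 := affineRamp_le_one 0 r t
  have h4 := affineRamp_le_one (1 - r) 1 t
  exact abs_le.2 ⟨by unfold edge; linarith, by unfold edge; linarith⟩

lemma abs_core_le (r t : ℝ) : |core r t| ≤ 1 := by
  have h1 := affineRamp_nonneg r (1 - r) t
  have h3 := affineRamp_le_one r (1 - r) t
  exact abs_le.2 ⟨by unfold core; linarith, by unfold core; linarith⟩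

lemma edge_sq_le (r t : ℝ) : edge r t ^ 2 ≤ 1 := (sq_le_one_iff_abs_le_one _).2 (abs_edge_le r t)

lemma arc_nonneg (r t : ℝ) : 0 ≤ arc r t := Real.sqrt_nonneg _

lemma arc_sq (r t : ℝ) : arc r t ^ 2 = 1 - edge r t ^ 2 :=
  Real.sq_sqrt (by linarith [edge_sq_le r t])

lemma arc_le_one (r t : ℝ) : arc r t ≤ 1 := by
  have := arc_sq r t
  nlinarith [arc_nonneg r t, sq_nonneg (edge r t)]

lemma hasDerivAt_edge {r t : ℝ} (hr : 0 < r) (ht : t ∉ ({0, r, 1 - r, 1} : Set ℝ)) :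
    HasDerivAt (edge r) (edgeDeriv r t) t := by
  simp only [mem_insert_iff, mem_singleton_iff, not_or] at ht
  obtain ⟨h1, h2, h3, h4⟩ := ht
  exact ((hasDerivAt_affineRamp hr h1 h2).add
    (hasDerivAt_affineRamp (by linarith) h3 h4)).sub_const 1

lemma hasDerivAt_core {r t : ℝ} (hr2 : r < 1 / 2) (ht : t ∉ ({0, r, 1 - r, 1} : Set ℝ)) :
    HasDerivAt (core r) (coreDeriv r t) t := by
  simp only [mem_insert_iff, mem_singleton_iff, not_or] at ht
  obtain ⟨-, h2, h3, -⟩ := ht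
  exact ((hasDerivAt_affineRamp (by linarith) h2 h3).const_mul 2).sub_const 1

lemma edge_of_le {r t : ℝ} (hr : 0 < r) (hr2 : r < 1 / 2) (h0 : 0 ≤ t) (h1 : t ≤ r) :
    edge r t = t / r - 1 := by
  rw [edge, affineRamp_of_mem hr ⟨h0, h1⟩, affineRamp_of_le (by linarith) (by linarith)]
  simp

lemma edge_of_mem {r t : ℝ} (hr : 0 < r) (ht : t ∈ Icc r (1 - r)) : edge r t = 0 := by
  rw [edge, affineRamp_of_ge hr ht.1, affineRamp_of_le (by linarith) ht.2]
  simp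

lemma edge_of_ge {r t : ℝ} (hr : 0 < r) (hr2 : r < 1 / 2) (h0 : 1 - r ≤ t) (h1 : t ≤ 1) :
    edge r t = 1 - (1 - t) / r := by
  rw [edge, affineRamp_of_mem (by linarith) ⟨h0, h1⟩, affineRamp_of_ge hr (by linarith),
    _root_.sub_sub_cancel]
  field_simp; ring

lemma insetDist_eq_edge {r t : ℝ} (hr : 0 < r) (hr2 : r < 1 / 2) (ht : t ∈ Icc (0 : ℝ) 1) :
    insetDist r t = r * |edge r t| := by
  rcases le_total t r with h | h
  · have hn : t / r - 1 ≤ 0 := by rw [sub_nonpos, div_le_one hr]; exact h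
    rw [edge_of_le hr hr2 ht.1 h, abs_of_nonpos hn, insetDist, abs_of_nonpos (by linarith),
      max_eq_left (by linarith)]
    field_simp; ring
  rcases le_total t (1 - r) with h' | h'
  · rw [edge_of_mem hr ⟨h, h'⟩, abs_zero, mul_zero, insetDist, max_eq_right]
    rw [sub_nonpos, abs_le]; constructor <;> linarith
  · have hn : 0 ≤ 1 - (1 - t) / r := by rw [sub_nonneg, div_le_one hr]; linarith
    rw [edge_of_ge hr hr2 h' ht.2, abs_of_nonneg hn, insetDist, abs_of_nonneg (by linarith),
      max_eq_left (by linarith)]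
    field_simp; ring

lemma roundWidth_eq_arc {r t : ℝ} (hr : 0 < r) (hr2 : r < 1 / 2) (ht : t ∈ Icc (0 : ℝ) 1) :
    roundWidth r r t = 1 / 2 - r + r * arc r t := by
  rw [roundWidth, insetDist_eq_edge hr hr2 ht, mul_pow, sq_abs, arc,
    show r ^ 2 - r ^ 2 * edge r t ^ 2 = r ^ 2 * (1 - edge r t ^ 2) by ring,
    Real.sqrt_mul (sq_nonneg r), Real.sqrt_sq hr.le]

lemma integral_arc {r : ℝ} (hr : 0 < r) (hr2 : r < 1 / 2) :
    ∫ t in (0 : ℝ)..1, arc r t = 1 - 2 * r + Real.pi * r / 2 := by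
  have h := integral_roundWidth hr2.le hr
  rw [sub_self, sub_add_cancel, intervalIntegral.integral_congr
    (g := fun t => 1 / 2 - r + r * arc r t) fun t ht => roundWidth_eq_arc hr hr2
      (by rwa [uIcc_of_le zero_le_one] at ht),
    intervalIntegral.integral_add (by simp)
      (Continuous.intervalIntegrable (by fun_prop) _ _),
    intervalIntegral.integral_const_mul] at h
  simp only [intervalIntegral.integral_const, sub_zero, one_smul] at h
  have : r * ∫ t in (0 : ℝ)..1, arc r t = r * (1 - 2 * r + Real.pi * r / 2) := by linarith
  exact mul_left_cancel₀ hr.ne' this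

lemma edgeDeriv_nonneg {r : ℝ} (hr : 0 < r) (t : ℝ) : 0 ≤ edgeDeriv r t :=
  add_nonneg (affineRampDeriv_nonneg hr t) (affineRampDeriv_nonneg (by linarith) t)

lemma edgeDeriv_le {r : ℝ} (hr : 0 < r) (t : ℝ) : edgeDeriv r t ≤ 2 / r := by
  have h1 := affineRampDeriv_le hr t
  have h2 := affineRampDeriv_le (show 1 - r < 1 by linarith) t
  rw [sub_zero] at h1
  rw [_root_.sub_sub_cancel] at h2
  rw [edgeDeriv, show 2 / r = 1 / r + 1 / r by ring]
  exact add_le_add h1 h2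

lemma coreDeriv_nonneg {r : ℝ} (hr2 : r < 1 / 2) (t : ℝ) : 0 ≤ coreDeriv r t :=
  mul_nonneg zero_le_two (affineRampDeriv_nonneg (by linarith) t)

lemma coreDeriv_le {r : ℝ} (hr2 : r < 1 / 2) (t : ℝ) : coreDeriv r t ≤ 2 / (1 - r - r) := by
  rw [coreDeriv, show 2 / (1 - r - r) = 2 * (1 / (1 - r - r)) by ring]
  exact mul_le_mul_of_nonneg_left (affineRampDeriv_le (by linarith) t) zero_le_two

lemma edgeDeriv_of_notMem {r t : ℝ} (hr2 : r < 1 / 2) (ht : t ∈ Ioo (0 : ℝ) 1)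
    (h : t ∉ Icc r (1 - r)) : edgeDeriv r t = 1 / r := by
  rw [edgeDeriv, affineRampDeriv, affineRampDeriv]
  rcases lt_or_ge t r with h1 | h1
  · rw [indicator_of_mem (show t ∈ Ioo 0 r from ⟨ht.1, h1⟩),
      indicator_of_notMem fun h' => absurd h'.1 (not_lt.2 (by linarith))]
    simp
  · have h2 : 1 - r < t := not_le.1 fun h2 => h ⟨h1, h2⟩
    rw [indicator_of_mem (show t ∈ Ioo (1 - r) 1 from ⟨h2, ht.2⟩),
      indicator_of_notMem fun h' => absurd h'.2 (not_lt.2 h1)]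
    simp

lemma edgeDeriv_of_mem {r t : ℝ} (h : t ∈ Icc r (1 - r)) : edgeDeriv r t = 0 := by
  rw [edgeDeriv, affineRampDeriv, affineRampDeriv,
    indicator_of_notMem fun h' => absurd h'.2 (not_lt.2 h.1),
    indicator_of_notMem fun h' => absurd h'.1 (not_lt.2 h.2), add_zero]

lemma sq_add_sq_le_one_of_arc {b c X Y σ τ t : ℝ} (hX : 0 ≤ X) (hY : 0 ≤ Y)
    (hbX : X ^ 2 = 1 - b ^ 2) (hcY : Y ^ 2 = 1 - c ^ 2) (hσ : |σ| ≤ 1) (hτ : |τ| ≤ 1)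
    (ht : t = max (b ^ 2 + c ^ 2 - 1) 0) :
    (1 / 2 * (Y * σ + b) + 1 / 16 * (b * t ^ 2)) ^ 2 + (1 / 2 * (c + X * τ)) ^ 2 ≤ 1 := by
  have hb : b ^ 2 ≤ 1 := by nlinarith
  have hc : c ^ 2 ≤ 1 := by nlinarith
  have hb1 : |b| ≤ 1 := (sq_le_one_iff_abs_le_one _).1 hb
  have hY1 : Y ≤ 1 := by nlinarith
  have ht0 : 0 ≤ t := ht ▸ le_max_right _ _
  have ht1 : t ≤ 1 := ht ▸ max_le (by linarith) zero_le_one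
  set S := Y * |b| + X * |c| with hS
  have hSq : S ^ 2 + (X * Y - |b| * |c|) ^ 2 = 1 := by
    have e1 := sq_abs b
    have e2 := sq_abs c
    calc S ^ 2 + (X * Y - |b| * |c|) ^ 2 = (X ^ 2 + |b| ^ 2) * (Y ^ 2 + |c| ^ 2) := by
          rw [hS]; ring
      _ = 1 := by rw [e1, e2, hbX, hcY]; ring
  have htS : t ^ 2 ≤ (X * Y - |b| * |c|) ^ 2 := by
    rcases le_total (b ^ 2 + c ^ 2 - 1) 0 with h | h
    · rw [ht, max_eq_right h]; simpa using sq_nonneg (X * Y - |b| * |c|)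
    · rw [max_eq_left h] at ht
      have h1 : (X * Y + t) ^ 2 ≤ (|b| * |c|) ^ 2 := by
        rw [mul_pow |b|, sq_abs, sq_abs, show b ^ 2 = Y ^ 2 + t by rw [ht, hcY]; ring,
          show c ^ 2 = X ^ 2 + t by rw [ht, hbX]; ring]
        nlinarith [mul_nonneg ht0 (sq_nonneg (X - Y))]
      have h2 := abs_le_of_sq_le_sq' h1 (by positivity)
      nlinarith [h2.2]
  have hS1 : S ≤ 1 := by nlinarith [sq_nonneg (X * Y - |b| * |c|)]
  have hS2 : t ^ 2 ≤ 2 * (1 - S) := by nlinarith [sq_nonneg (1 - S)]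
  have hσ2 : σ ^ 2 ≤ 1 := (sq_le_one_iff_abs_le_one _).2 hσ
  have hτ2 : τ ^ 2 ≤ 1 := (sq_le_one_iff_abs_le_one _).2 hτ
  have h1 : σ * b ≤ |b| := (le_abs_self _).trans (by
    rw [abs_mul]; nlinarith [abs_nonneg b])
  have h2 : τ * c ≤ |c| := (le_abs_self _).trans (by
    rw [abs_mul]; nlinarith [abs_nonneg c])
  have hN : (1 / 2 * (Y * σ + b)) ^ 2 + (1 / 2 * (c + X * τ)) ^ 2 ≤ (1 + S) / 2 := by
    have h3 := mul_le_mul_of_nonneg_left h1 hY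
    have h4 := mul_le_mul_of_nonneg_left h2 hX
    have h5 := mul_le_mul_of_nonneg_left hσ2 (sq_nonneg Y)
    have h6 := mul_le_mul_of_nonneg_left hτ2 (sq_nonneg X)
    nlinarith
  have hv : |1 / 2 * (Y * σ + b) * b| ≤ 1 := by
    have : |1 / 2 * (Y * σ + b)| ≤ 1 := by
      rw [abs_mul, abs_of_nonneg (by norm_num : (0 : ℝ) ≤ 1 / 2)]
      have := abs_add_le (Y * σ) b
      have h7 : |Y * σ| ≤ 1 := by
        rw [abs_mul, abs_of_nonneg hY]; nlinarith [abs_nonneg σ]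
      linarith
    rw [abs_mul]; exact mul_le_one₀ this (abs_nonneg b) hb1
  have h8 : 1 / 2 * (Y * σ + b) * b * t ^ 2 ≤ t ^ 2 :=
    (mul_le_mul_of_nonneg_right (le_of_abs_le hv) (sq_nonneg t)).trans_eq (one_mul _)
  have h9 : (b * t ^ 2) ^ 2 ≤ t ^ 2 := by
    have : t ^ 2 ≤ 1 := by nlinarith
    calc (b * t ^ 2) ^ 2 = b ^ 2 * t ^ 2 * t ^ 2 := by ring
      _ ≤ 1 * 1 * t ^ 2 := by gcongr
      _ = t ^ 2 := by ring
  have e : (1 / 2 * (Y * σ + b) + 1 / 16 * (b * t ^ 2)) ^ 2 = (1 / 2 * (Y * σ + b)) ^ 2 +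
    1 / 8 * (1 / 2 * (Y * σ + b) * b * t ^ 2) + 1 / 256 * (b * t ^ 2) ^ 2 := by ring
  rw [e]
  generalize 1 / 2 * (Y * σ + b) * b * t ^ 2 = z at h8 ⊢
  linarith [sq_nonneg t]

/-- How far a point reaches into the corner regions beyond the rounded square. -/
def cornerExcess (r : ℝ) (x : Fin 2 → ℝ) : ℝ := max (edge r (x 0) ^ 2 + edge r (x 1) ^ 2 - 1) 0

/-- The divergence of the perturbation concentrated in the corner regions. -/
def cornerDiv (r : ℝ) (x : Fin 2 → ℝ) : ℝ :=
  edgeDeriv r (x 0) * (cornerExcess r x ^ 2 + 4 * edge r (x 0) ^ 2 * cornerExcess r x)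

/-- The divergence of the field which calibrates the rounded square along vertical strips. -/
def stripDiv (r : ℝ) (x : Fin 2 → ℝ) : ℝ := arc r (x 1) * coreDeriv r (x 0) + edgeDeriv r (x 1)

@[fun_prop] lemma continuous_cornerExcess (r : ℝ) : Continuous (cornerExcess r) := by
  unfold cornerExcess; fun_prop

@[fun_prop] lemma measurable_cornerDiv (r : ℝ) : Measurable (cornerDiv r) := by
  unfold cornerDiv; fun_prop

@[fun_prop] lemma measurable_stripDiv (r : ℝ) : Measurable (stripDiv r) := by
  unfold stripDiv; fun_prop

lemma cornerExcess_nonneg (r : ℝ) (x : Fin 2 → ℝ) : 0 ≤ cornerExcess r x := le_max_right _ _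

lemma cornerExcess_le_one (r : ℝ) (x : Fin 2 → ℝ) : cornerExcess r x ≤ 1 :=
  max_le (by linarith [edge_sq_le r (x 0), edge_sq_le r (x 1)]) zero_le_one

lemma cornerDiv_nonneg {r : ℝ} (hr : 0 < r) (x : Fin 2 → ℝ) : 0 ≤ cornerDiv r x := by
  have := cornerExcess_nonneg r x
  exact mul_nonneg (edgeDeriv_nonneg hr _) (by positivity)

lemma cornerDiv_le {r : ℝ} (hr : 0 < r) (x : Fin 2 → ℝ) : cornerDiv r x ≤ 2 / r * 5 := by
  have h0 := cornerExcess_nonneg r x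
  have h1 := cornerExcess_le_one r x
  have h2 := edge_sq_le r (x 0)
  refine mul_le_mul (edgeDeriv_le hr _) ?_ (by positivity) (by positivity)
  nlinarith [sq_nonneg (edge r (x 0))]

lemma stripDiv_nonneg {r : ℝ} (hr : 0 < r) (hr2 : r < 1 / 2) (x : Fin 2 → ℝ) :
    0 ≤ stripDiv r x :=
  add_nonneg (mul_nonneg (arc_nonneg _ _) (coreDeriv_nonneg hr2 _)) (edgeDeriv_nonneg hr _)

lemma arc_mul_coreDeriv_le {r : ℝ} (hr2 : r < 1 / 2) (s t : ℝ) :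
    arc r s * coreDeriv r t ≤ 2 / (1 - r - r) := by
  have := mul_le_mul (arc_le_one r s) (coreDeriv_le hr2 t) (coreDeriv_nonneg hr2 t) zero_le_one
  rwa [one_mul] at this

lemma stripDiv_le {r : ℝ} (hr : 0 < r) (hr2 : r < 1 / 2) (x : Fin 2 → ℝ) :
    stripDiv r x ≤ 2 / (1 - r - r) + 2 / r :=
  add_le_add (arc_mul_coreDeriv_le hr2 _ _) (edgeDeriv_le hr _)

lemma isPrim_edge {r : ℝ} (hr : 0 < r) : IsPrim (edge r) (edgeDeriv r) :=
  isPrim_of_hasDerivAt (Set.toFinite {0, r, 1 - r, 1}).countable (continuous_edge r)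
    (fun _ ht => hasDerivAt_edge hr ht)
    (locallyIntegrable_of_bound (measurable_edgeDeriv r) (2 / r) fun t => by
      rw [abs_of_nonneg (edgeDeriv_nonneg hr t)]; exact edgeDeriv_le hr t)

lemma isPrim_core {r : ℝ} (hr2 : r < 1 / 2) : IsPrim (core r) (coreDeriv r) :=
  isPrim_of_hasDerivAt (Set.toFinite {0, r, 1 - r, 1}).countable (continuous_core r)
    (fun _ ht => hasDerivAt_core hr2 ht)
    (locallyIntegrable_of_bound (measurable_coreDeriv r) (2 / (1 - r - r)) fun t => by
      rw [abs_of_nonneg (coreDeriv_nonneg hr2 t)]; exact coreDeriv_le hr2 t)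

lemma isPrim_edge_mul_excess {r : ℝ} (hr : 0 < r) (x : Fin 2 → ℝ) :
    IsPrim (fun t => edge r t * cornerExcess r (Function.update x 0 t) ^ 2)
      fun t => cornerDiv r (Function.update x 0 t) := by
  refine isPrim_of_hasDerivAt (Set.toFinite {0, r, 1 - r, 1}).countable ?_ (fun t ht => ?_) ?_
  · unfold cornerExcess; simp only [Function.update_self, update_zero_apply_one]; fun_prop
  · have h := hasDerivAt_edge hr ht
    simp only [cornerExcess, cornerDiv, Function.update_self, update_zero_apply_one]
    have h2 := ((h.pow 2).add_const (edge r (x 1) ^ 2)).sub_const 1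
    have h3 := (hasDerivAt_max_zero_sq (edge r t ^ 2 + edge r (x 1) ^ 2 - 1)).comp t h2
    refine (h.mul h3).congr_deriv ?_
    simp only [Function.comp_apply, Pi.pow_apply]
    push_cast
    ring
  · refine locallyIntegrable_of_bound (by fun_prop) (2 / r * 5) fun t => ?_
    rw [abs_of_nonneg (cornerDiv_nonneg hr _)]
    exact cornerDiv_le hr _

/-- A calibration of the rounded square whose divergence is strictly larger near the corners of
the unit square. -/
lemma isCalib_roundSquare {r : ℝ} (hr : 0 < r) (hr2 : r < 1 / 2) :
    ∃ ξ, IsCalib ξ fun x => 1 / 2 * (stripDiv r x + stripDiv r (coordSwap x)) +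
      1 / 16 * cornerDiv r x := by
  let ξ : Fin 2 → (Fin 2 → ℝ) → ℝ := ![
    fun x => 1 / 2 * (arc r (x 1) * core r (x 0) + edge r (x 0)) +
      1 / 16 * (edge r (x 0) * cornerExcess r x ^ 2),
    fun x => 1 / 2 * (edge r (x 1) + arc r (x 0) * core r (x 1))]
  let k : Fin 2 → (Fin 2 → ℝ) → ℝ := ![
    fun x => 1 / 2 * (arc r (x 1) * coreDeriv r (x 0) + edgeDeriv r (x 0)) +
      1 / 16 * cornerDiv r x,
    fun x => 1 / 2 * (edgeDeriv r (x 1) + arc r (x 0) * coreDeriv r (x 1))]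
  have hc : IsCalib ξ fun x => k 0 x + k 1 x := by
    refine isCalib_of_isPrim (fun i => ?_) (fun x => ?_) (fun i => ?_) (fun i x => ?_)
    · fin_cases i <;> simp only [ξ, Fin.zero_eta, Fin.mk_one, Matrix.cons_val_zero,
        Matrix.cons_val_one] <;> fun_prop
    · exact sq_add_sq_le_one_of_arc (arc_nonneg r (x 0)) (arc_nonneg r (x 1)) (arc_sq r (x 0))
        (arc_sq r (x 1)) (abs_core_le r (x 0)) (abs_core_le r (x 1)) rfl
    · refine locallyIntegrable_of_bound (C := 1 / 2 * (2 / (1 - r - r) + 2 / r) +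
        1 / 16 * (2 / r * 5)) ?_ fun x => ?_
      · fin_cases i <;> simp only [k, Fin.zero_eta, Fin.mk_one, Matrix.cons_val_zero,
          Matrix.cons_val_one] <;> fun_prop
      · have e0 := edgeDeriv_nonneg hr (x 0)
        have e1 := edgeDeriv_nonneg hr (x 1)
        have e2 := edgeDeriv_le hr (x 0)
        have e3 := edgeDeriv_le hr (x 1)
        have c0 := cornerDiv_nonneg hr x
        have c1 := cornerDiv_le hr x
        have a0 := mul_nonneg (arc_nonneg r (x 1)) (coreDeriv_nonneg hr2 (x 0))
        have a1 := mul_nonneg (arc_nonneg r (x 0)) (coreDeriv_nonneg hr2 (x 1))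
        have a2 := arc_mul_coreDeriv_le hr2 (x 1) (x 0)
        have a3 := arc_mul_coreDeriv_le hr2 (x 0) (x 1)
        fin_cases i <;> simp only [k, Fin.zero_eta, Fin.mk_one, Matrix.cons_val_zero,
          Matrix.cons_val_one] <;> rw [abs_of_nonneg (by linarith)] <;> linarith
    · fin_cases i
      · simp only [ξ, k, Fin.zero_eta, Matrix.cons_val_zero, Function.update_self,
          update_zero_apply_one]
        exact ((((isPrim_core hr2).const_mul (arc r (x 1))).add (isPrim_edge hr)).const_mul
          (1 / 2)).add ((isPrim_edge_mul_excess hr x).const_mul (1 / 16))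
      · simp only [ξ, k, Fin.mk_one, Matrix.cons_val_one, Function.update_self, ne_eq, zero_ne_one,
          not_false_eq_true, Function.update_of_ne, Matrix.cons_val_fin_one]
        exact ((isPrim_edge hr).add ((isPrim_core hr2).const_mul (arc r (x 0)))).const_mul (1 / 2)
  refine ⟨ξ, ?_⟩
  convert hc using 2 with x
  simp only [k, stripDiv, Matrix.cons_val_zero, Matrix.cons_val_one, coordSwap_apply,
    Equiv.swap_apply_left, Equiv.swap_apply_right, Matrix.cons_val_fin_one]
  ring

lemma integrableOn_of_bound {E : Set (Fin 2 → ℝ)} (hEQ : E ⊆ unitSquare)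
    {f : (Fin 2 → ℝ) → ℝ} (hf : Measurable f) (C : ℝ) (h0 : ∀ x, 0 ≤ f x) (hC : ∀ x, f x ≤ C) :
    IntegrableOn f E := by
  have hfin : volume E ≠ ⊤ := measure_ne_top_of_subset hEQ (by
    rw [unitSquare, volume_pi_pi]; simp)
  exact Measure.integrableOn_of_bounded hfin hf.aestronglyMeasurable (M := C)
    (Eventually.of_forall fun x => by rw [Real.norm_of_nonneg (h0 x)]; exact hC x)

lemma rowLength_column {r : ℝ} (hr : 0 < r) (hr2 : r < 1 / 2) (y : ℝ) :
    rowLength (unitSquare ∩ {x | x 0 ∈ Ioo r (1 - r)}) y =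
      (Ioo (0 : ℝ) 1).indicator (fun _ => 1 - 2 * r) y := by
  by_cases hy : y ∈ Ioo (0 : ℝ) 1
  · have : rowSlice (unitSquare ∩ {x | x 0 ∈ Ioo r (1 - r)}) y = Ioo r (1 - r) := by
      ext s
      have : s ∈ rowSlice (unitSquare ∩ {x | x 0 ∈ Ioo r (1 - r)}) y ↔
        (s ∈ Ioo (0 : ℝ) 1 ∧ y ∈ Ioo (0 : ℝ) 1) ∧ s ∈ Ioo r (1 - r) := by
        simp [rowSlice, unitSquare, Set.mem_pi, Fin.forall_fin_two]
      rw [this]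
      exact ⟨fun h => h.2, fun h => ⟨⟨⟨hr.trans h.1, by linarith [h.2]⟩, hy⟩, h⟩⟩
    rw [rowLength, this, indicator_of_mem hy, Real.volume_real_Ioo_of_le (by linarith)]
    ring
  · have : rowSlice (unitSquare ∩ {x | x 0 ∈ Ioo r (1 - r)}) y = ∅ := by
      ext s
      simp only [mem_empty_iff_false, iff_false]
      intro h
      exact hy (by simpa using h.1 1 (mem_univ _))
    rw [rowLength, this, indicator_of_notMem hy, measureReal_empty]

lemma measurableSet_unitSquare : MeasurableSet unitSquare :=
  MeasurableSet.univ_pi fun _ => measurableSet_Ioo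

lemma le_setIntegral_stripDiv {E : Set (Fin 2 → ℝ)} (hE : MeasurableSet E) (hEQ : E ⊆ unitSquare)
    {r : ℝ} (hr : 0 < r) (hr2 : r < 1 / 2)
    (hsq : (4 - Real.pi) * r ^ 2 = 1 - volume.real E)
    (hs : volume ((unitSquare ∩ {x | x 0 ∈ Ioo r (1 - r)}) \ E) = 0) :
    4 - 2 * ((4 - Real.pi) * r) ≤ ∫ x in E, stripDiv r x := by
  have hT : MeasurableSet {x : Fin 2 → ℝ | x 0 ∈ Ioo r (1 - r)} :=
    measurableSet_Ioo.preimage (measurable_pi_apply 0)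
  have hi1 : IntegrableOn (fun x : Fin 2 → ℝ => arc r (x 1) * coreDeriv r (x 0)) E :=
    integrableOn_of_bound hEQ (by fun_prop) (2 / (1 - r - r))
      (fun x => mul_nonneg (arc_nonneg _ _) (coreDeriv_nonneg hr2 _))
      fun x => arc_mul_coreDeriv_le hr2 _ _
  have hi2 : IntegrableOn (fun x : Fin 2 → ℝ => edgeDeriv r (x 1)) E :=
    integrableOn_of_bound hEQ (by fun_prop) (2 / r) (fun x => edgeDeriv_nonneg hr _)
      fun x => edgeDeriv_le hr _
  have h1 : ∫ x in E, arc r (x 1) * coreDeriv r (x 0) = 2 * (1 - 2 * r) + Real.pi * r := by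
    have e : (fun x : Fin 2 → ℝ => arc r (x 1) * coreDeriv r (x 0)) =
        {x : Fin 2 → ℝ | x 0 ∈ Ioo r (1 - r)}.indicator
          fun x => arc r (x 1) * (2 * (1 / (1 - r - r))) := by
      funext x
      by_cases hx : x 0 ∈ Ioo r (1 - r)
      · rw [indicator_of_mem (show x ∈ {x : Fin 2 → ℝ | x 0 ∈ Ioo r (1 - r)} from hx), coreDeriv,
          affineRampDeriv, indicator_of_mem hx]
      · rw [indicator_of_notMem (show x ∉ {x : Fin 2 → ℝ | x 0 ∈ Ioo r (1 - r)} from hx),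
          coreDeriv, affineRampDeriv, indicator_of_notMem hx]
        ring
    have hae : (E ∩ {x : Fin 2 → ℝ | x 0 ∈ Ioo r (1 - r)} : Set _) =ᵐ[volume]
        (unitSquare ∩ {x : Fin 2 → ℝ | x 0 ∈ Ioo r (1 - r)} : Set _) := by
      refine (LE.le.eventuallyLE (inter_subset_inter_left _ hEQ)).antisymm ?_
      refine ae_le_set.2 (measure_mono_null ?_ hs)
      intro x hx
      exact ⟨hx.1, fun h => hx.2 ⟨h, hx.1.2⟩⟩
    rw [e, setIntegral_indicator hT, setIntegral_congr_set hae,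
      setIntegral_height (f := fun y => arc r y * (2 * (1 / (1 - r - r))))
        (measurableSet_unitSquare.inter hT) inter_subset_left (by fun_prop)]
    have e2 : (fun y => rowLength (unitSquare ∩ {x | x 0 ∈ Ioo r (1 - r)}) y *
        (arc r y * (2 * (1 / (1 - r - r))))) =
        (Ioo (0 : ℝ) 1).indicator fun y => 2 * arc r y := by
      funext y
      rw [rowLength_column hr hr2]
      by_cases hy : y ∈ Ioo (0 : ℝ) 1
      · rw [indicator_of_mem hy, indicator_of_mem hy]
        have : 1 - r - r ≠ 0 := by linarith
        field_simp; ring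
      · rw [indicator_of_notMem hy, indicator_of_notMem hy, zero_mul]
    rw [e2, integral_indicator measurableSet_Ioo, ← integral_Ioc_eq_integral_Ioo,
      ← intervalIntegral.integral_of_le zero_le_one, intervalIntegral.integral_const_mul,
      integral_arc hr hr2]
    ring
  have h2 : 1 / r * (volume.real E - (1 - 2 * r)) ≤ ∫ x in E, edgeDeriv r (x 1) := by
    have e : ∫ x in E, edgeDeriv r (x 1) =
        ∫ x in E, (1 / r - 1 / r * (Icc r (1 - r)).indicator (fun _ => (1 : ℝ)) (x 1)) := by
      refine setIntegral_congr_fun hE fun x hx => ?_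
      by_cases h : x 1 ∈ Icc r (1 - r)
      · simp only [edgeDeriv_of_mem h, indicator_of_mem h]; ring
      · simp only [edgeDeriv_of_notMem hr2 (by simpa using hEQ hx 1 (mem_univ _)) h,
          indicator_of_notMem h]; ring
    have hind : Measurable ((Icc r (1 - r)).indicator fun _ : ℝ => (1 : ℝ)) :=
      measurable_const.indicator measurableSet_Icc
    have hi : IntegrableOn (fun x : Fin 2 → ℝ => (Icc r (1 - r)).indicator (fun _ => (1 : ℝ)) (x 1))
        E := integrableOn_of_bound hEQ (hind.comp (measurable_pi_apply 1)) 1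
      (fun x => indicator_nonneg (fun _ _ => zero_le_one) _)
      fun x => indicator_le_self' (fun _ _ => zero_le_one) _
    have hfin : volume E ≠ ⊤ := measure_ne_top_of_subset hEQ (by
      rw [unitSquare, volume_pi_pi]; simp)
    have h3 : ∫ x in E, (Icc r (1 - r)).indicator (fun _ => (1 : ℝ)) (x 1) ≤ 1 - 2 * r := by
      rw [setIntegral_height hE hEQ hind]
      have e3 : (fun y => rowLength E y * (Icc r (1 - r)).indicator (fun _ => (1 : ℝ)) y) =
          (Icc r (1 - r)).indicator (rowLength E) := by
        funext y
        by_cases h : y ∈ Icc r (1 - r)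
        · rw [indicator_of_mem h, indicator_of_mem h, mul_one]
        · rw [indicator_of_notMem h, indicator_of_notMem h, mul_zero]
      rw [e3, integral_indicator measurableSet_Icc]
      refine (setIntegral_rowLength_le hEQ fun y hy => ⟨hr.trans_le hy.1, by linarith [hy.2]⟩).trans
        (le_of_eq ?_)
      rw [Real.volume_real_Icc_of_le (by linarith)]
      ring
    have hconst : IntegrableOn (fun _ : Fin 2 → ℝ => 1 / r) E := integrableOn_const hfin
    rw [e, integral_sub hconst (hi.const_mul _), integral_const_mul,
      setIntegral_const, smul_eq_mul]
    have := mul_le_mul_of_nonneg_left h3 (one_div_nonneg.2 hr.le)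
    linarith
  have h3 : ∫ x in E, stripDiv r x = (∫ x in E, arc r (x 1) * coreDeriv r (x 0)) +
    ∫ x in E, edgeDeriv r (x 1) := integral_add hi1 hi2
  have h4 := profile_identity (h := 1) hr hsq
  rw [sub_self, zero_mul, zero_div, add_zero] at h4
  linarith

lemma cornerDiv_pos {r : ℝ} (hr : 0 < r) (hr2 : r < 1 / 2) {x : Fin 2 → ℝ} (hx : x ∈ unitSquare)
    (h : r < roundDist r x) : 0 < cornerDiv r x := by
  have hx' : ∀ i, x i ∈ Ioo (0 : ℝ) 1 := fun i => hx i (mem_univ _)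
  have hs : 1 < edge r (x 0) ^ 2 + edge r (x 1) ^ 2 := by
    have h1 : r ^ 2 < roundDist r x ^ 2 := pow_lt_pow_left₀ h hr.le two_ne_zero
    rw [roundDist_sq, insetDist_eq_edge hr hr2 (Ioo_subset_Icc_self (hx' 0)),
      insetDist_eq_edge hr hr2 (Ioo_subset_Icc_self (hx' 1)), mul_pow, mul_pow, sq_abs, sq_abs,
      ← mul_add] at h1
    have : 0 < r ^ 2 := by positivity
    exact (lt_mul_iff_one_lt_right this).1 h1
  have hc : 0 < cornerExcess r x := lt_max_of_lt_left (by linarith)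
  have hne : x 0 ∉ Icc r (1 - r) := fun h' => by
    rw [edge_of_mem hr h'] at hs
    linarith [edge_sq_le r (x 1)]
  rw [cornerDiv, edgeDeriv_of_notMem hr2 (hx' 0) hne]
  positivity

lemma ae_eq_roundDist_of_optimal {E : Set (Fin 2 → ℝ)} (hE : MeasurableSet E)
    (hEQ : E ⊆ unitSquare) (ha : Real.pi / 4 < volume.real E) (ha1 : volume.real E < 1)
    (hopt : ∀ ξ g, IsCalib ξ g → ∫ x in E, g x ≤ squareProfile (volume.real E)) :
    E =ᵐ[volume] ({x | roundDist (cornerRadius (volume.real E)) x <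
      cornerRadius (volume.real E)} : Set (Fin 2 → ℝ)) := by
  have hmp := measurePreserving_coordSwap
  have hE' : MeasurableSet (coordSwap ⁻¹' E) := hmp.measurable hE
  have hEQ' := preimage_coordSwap_subset hEQ
  have hvol : volume.real (coordSwap ⁻¹' E) = volume.real E := by
    rw [Measure.real, hmp.measure_preimage hE.nullMeasurableSet, Measure.real]
  have hs1 := volume_strip_sdiff hE hEQ ha ha1 hopt
  have hs2 := volume_strip_sdiff hE' hEQ' (by rwa [hvol]) (by rwa [hvol]) fun ξ g h => by
    rw [hvol, setIntegral_coordSwap]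
    exact hopt _ _ h.swap
  rw [hvol] at hs2
  set r := cornerRadius (volume.real E) with hrdef
  have hr : 0 < r := cornerRadius_pos ha1
  have hr2 : r < 1 / 2 := cornerRadius_lt_half ha
  have hsq : (4 - Real.pi) * r ^ 2 = 1 - volume.real E := cornerRadius_sq ha1.le
  have hT : MeasurableSet {x : Fin 2 → ℝ | x 0 ∈ Ioo r (1 - r)} :=
    measurableSet_Ioo.preimage (measurable_pi_apply 0)
  have hA : 4 - 2 * ((4 - Real.pi) * r) ≤ ∫ x in E, stripDiv r x := by
    refine le_setIntegral_stripDiv hE hEQ hr hr2 hsq ?_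
    rw [← hmp.measure_preimage ((measurableSet_unitSquare.inter hT).diff hE).nullMeasurableSet]
    refine measure_mono_null ?_ hs2
    intro x hx
    exact ⟨⟨preimage_coordSwap_subset subset_rfl hx.1.1, Ioo_subset_Ioc_self hx.1.2⟩, hx.2⟩
  have hB : 4 - 2 * ((4 - Real.pi) * r) ≤ ∫ x in E, stripDiv r (coordSwap x) := by
    rw [← setIntegral_coordSwap]
    refine le_setIntegral_stripDiv hE' hEQ' hr hr2 (by rw [hvol, hsq]) ?_
    rw [← hmp.measure_preimage ((measurableSet_unitSquare.inter hT).diff hE').nullMeasurableSet]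
    refine measure_mono_null ?_ hs1
    intro x hx
    refine ⟨⟨preimage_coordSwap_subset subset_rfl hx.1.1, Ioo_subset_Ioc_self hx.1.2⟩,
      fun h => hx.2 ?_⟩
    change coordSwap (coordSwap x) ∈ E
    rwa [coordSwap_coordSwap]
  have hi1 : IntegrableOn (stripDiv r) E := integrableOn_of_bound hEQ (by fun_prop) _
    (stripDiv_nonneg hr hr2) (stripDiv_le hr hr2)
  have hi2 : IntegrableOn (fun x => stripDiv r (coordSwap x)) E :=
    integrableOn_of_bound hEQ (by fun_prop) _ (fun x => stripDiv_nonneg hr hr2 _)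
      fun x => stripDiv_le hr hr2 _
  have hi3 : IntegrableOn (cornerDiv r) E := integrableOn_of_bound hEQ (by fun_prop) _
    (cornerDiv_nonneg hr) (cornerDiv_le hr)
  have hzero : ∫ x in E, cornerDiv r x = 0 := by
    obtain ⟨ξ, hξ⟩ := isCalib_roundSquare hr hr2
    have h1 := hopt ξ _ hξ
    have h2 : ∫ x in E, (1 / 2 * (stripDiv r x + stripDiv r (coordSwap x)) +
        1 / 16 * cornerDiv r x) = 1 / 2 * ((∫ x in E, stripDiv r x) +
        ∫ x in E, stripDiv r (coordSwap x)) + 1 / 16 * ∫ x in E, cornerDiv r x := by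
      have hi12 : IntegrableOn (fun x => stripDiv r x + stripDiv r (coordSwap x)) E :=
        hi1.add hi2
      rw [integral_add (hi12.const_mul _) (hi3.const_mul _), integral_const_mul,
        integral_const_mul]
      congr 2
      exact integral_add hi1 hi2
    rw [h2, squareProfile, if_neg (not_le.2 ha), sqrt_mul_eq_cornerRadius ha1.le, ← hrdef] at h1
    have h3 : 0 ≤ ∫ x in E, cornerDiv r x := integral_nonneg fun x => cornerDiv_nonneg hr x
    linarith
  have hae := (setIntegral_eq_zero_iff_of_nonneg_ae
    (Eventually.of_forall fun x => cornerDiv_nonneg hr x) hi3).1 hzero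
  have hne : ∀ᵐ x : Fin 2 → ℝ, roundDist r x ≠ r := by
    have := volume_roundDist_eq hr2.le hr
    exact measure_eq_zero_iff_ae_notMem.1 this
  have hsub : E ≤ᵐ[volume] ({x | roundDist r x < r} : Set (Fin 2 → ℝ)) := by
    filter_upwards [(ae_restrict_iff' hE).1 hae, hne] with x h1 h2 hx
    refine lt_of_le_of_ne (not_lt.1 fun h => ?_) h2
    exact (cornerDiv_pos hr hr2 (hEQ hx) h).ne' (h1 hx)
  have hQ : volume unitSquare ≠ ⊤ := by rw [unitSquare, volume_pi_pi]; simp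
  have hfinR : volume {x | roundDist r x < r} ≠ ⊤ :=
    measure_ne_top_of_subset (roundDist_lt_subset_unitSquare hr) hQ
  refine ae_eq_of_ae_subset_of_measure_ge hsub ?_ hE.nullMeasurableSet hfinR
  rw [← ENNReal.toReal_le_toReal hfinR (measure_ne_top_of_subset hEQ hQ)]
  have := volume_real_roundDist_lt_self hr2.le hr
  rw [hsq] at this
  change volume.real _ ≤ volume.real _
  linarith

/-- The total variation of the stack of `K` equal rounded squares of total mass `m`. -/
def stackEnergy (m K : ℝ) : ℝ := 4 * K - 2 * √(4 - Real.pi) * √(K * (K - m))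

lemma exists_merge {ι : Type*} (s : Finset ι) (τ : ι → ℝ) (h : ∀ i ∈ s, 0 ≤ τ i ∧ τ i ≤ 1) :
    ∃ (q : ℕ) (t : ℝ), 0 ≤ t ∧ t < 1 ∧ ∑ i ∈ s, τ i ^ 2 = q + t ^ 2 ∧ q + t ≤ ∑ i ∈ s, τ i := by
  classical
  induction s using Finset.induction_on with
  | empty => exact ⟨0, 0, le_rfl, one_pos, by simp, by simp⟩
  | insert i s hi ih =>
    obtain ⟨q, t, h0, h1, h2, h3⟩ := ih fun j hj => h j (Finset.mem_insert_of_mem hj)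
    obtain ⟨hτ0, hτ1⟩ := h i (Finset.mem_insert_self i s)
    rw [Finset.sum_insert hi, Finset.sum_insert hi, h2]
    rcases lt_or_ge (t ^ 2 + τ i ^ 2) 1 with hlt | hge
    · refine ⟨q, √(t ^ 2 + τ i ^ 2), Real.sqrt_nonneg _, ?_, ?_, ?_⟩
      · rw [Real.sqrt_lt' one_pos, one_pow]; exact hlt
      · rw [Real.sq_sqrt (by positivity)]; ring
      · have : √(t ^ 2 + τ i ^ 2) ≤ t + τ i := Real.sqrt_le_iff.2
          ⟨by positivity, by nlinarith [mul_nonneg h0 hτ0]⟩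
        linarith
    · have hge' : 0 ≤ t ^ 2 + τ i ^ 2 - 1 := by linarith
      refine ⟨q + 1, √(t ^ 2 + τ i ^ 2 - 1), Real.sqrt_nonneg _, ?_, ?_, ?_⟩
      · rw [Real.sqrt_lt' one_pos]; nlinarith
      · rw [Real.sq_sqrt hge']; push_cast; ring
      · have : √(t ^ 2 + τ i ^ 2 - 1) ≤ t + τ i - 1 := Real.sqrt_le_iff.2
          ⟨by nlinarith, by nlinarith [mul_nonneg (sub_nonneg.2 h1.le) (sub_nonneg.2 hτ1)]⟩
        push_cast
        linarith

lemma sqrt_add_mul_sq_le {d c t : ℝ} (hd : 0 ≤ d) (hc : 0 ≤ c) (h0 : 0 ≤ t) (h1 : t ≤ 1) :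
    √(d + c * t ^ 2) ≤ (1 - t) * √d + t * √(d + c) := by
  have h2 : √d ≤ √(d + c) := Real.sqrt_le_sqrt (by linarith)
  have e1 := Real.sq_sqrt hd
  have e2 := Real.sq_sqrt (add_nonneg hd hc)
  refine Real.sqrt_le_iff.2 ⟨add_nonneg (mul_nonneg (sub_nonneg.2 h1) (Real.sqrt_nonneg d))
    (mul_nonneg h0 (Real.sqrt_nonneg _)), ?_⟩
  have h3 : d ≤ √d * √(d + c) := by nlinarith [Real.sqrt_nonneg d]
  have h4 := mul_le_mul_of_nonneg_left h3 (mul_nonneg h0 (sub_nonneg.2 h1))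
  have e3 : ((1 - t) * √d + t * √(d + c)) ^ 2 =
      (1 - t) ^ 2 * √d ^ 2 + 2 * (t * (1 - t) * (√d * √(d + c))) + t ^ 2 * √(d + c) ^ 2 := by ring
  rw [e3, e1, e2]
  linarith

lemma sqrt_add_mul_sq_lt {d c t : ℝ} (hd : 0 < d) (hc : 0 < c) (h0 : 0 < t) (h1 : t < 1) :
    √(d + c * t ^ 2) < (1 - t) * √d + t * √(d + c) := by
  have hd' := Real.sqrt_pos.2 hd
  have h2 : √d < √(d + c) := Real.sqrt_lt_sqrt hd.le (by linarith)
  have e1 := Real.sq_sqrt hd.le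
  have e2 := Real.sq_sqrt (add_nonneg hd.le hc.le)
  have h3 : d < √d * √(d + c) := by nlinarith
  have h4 := mul_lt_mul_of_pos_left h3 (mul_pos h0 (sub_pos.2 h1))
  refine (Real.sqrt_lt' (add_pos (mul_pos (sub_pos.2 h1) hd') (mul_pos h0 (hd'.trans h2)))).2 ?_
  have e3 : ((1 - t) * √d + t * √(d + c)) ^ 2 =
      (1 - t) ^ 2 * √d ^ 2 + 2 * (t * (1 - t) * (√d * √(d + c))) + t ^ 2 * √(d + c) ^ 2 := by ring
  rw [e3, e1, e2]
  linarith

lemma sqrt_four_sub_pi_mul : 2 * √(4 - Real.pi) * √(1 - Real.pi / 4) = 4 - Real.pi := by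
  have h : 1 - Real.pi / 4 = (4 - Real.pi) / 2 ^ 2 := by ring
  rw [h, Real.sqrt_div four_sub_pi_pos.le, Real.sqrt_sq zero_le_two]
  have := Real.mul_self_sqrt four_sub_pi_pos.le
  linarith

lemma stackEnergy_succ_le {m n : ℝ} (hn : 0 ≤ n) (hd : 0 ≤ n - m + Real.pi / 4) :
    stackEnergy m (n + 1) ≤
      4 * n - 2 * √(4 - Real.pi) * √(n * (n - m + Real.pi / 4)) + Real.pi := by
  have hα : 0 ≤ 1 - Real.pi / 4 := by linarith [four_sub_pi_pos]
  have h : √(n * (n - m + Real.pi / 4)) + √(1 - Real.pi / 4) ≤ √((n + 1) * (n + 1 - m)) := by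
    refine Real.le_sqrt_of_sq_le ?_
    have e1 := Real.sq_sqrt (mul_nonneg hn hd)
    have e2 := Real.sq_sqrt hα
    have e3 : √(n * (n - m + Real.pi / 4)) * √(1 - Real.pi / 4) =
        √(n * (1 - Real.pi / 4)) * √(n - m + Real.pi / 4) := by
      rw [Real.sqrt_mul hn, Real.sqrt_mul hn]; ring
    have e4 := Real.sq_sqrt (mul_nonneg hn hα)
    have e5 := Real.sq_sqrt hd
    nlinarith [sq_nonneg (√(n * (1 - Real.pi / 4)) - √(n - m + Real.pi / 4))]
  have h' := mul_le_mul_of_nonneg_left h (mul_nonneg zero_le_two (Real.sqrt_nonneg (4 - Real.pi)))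
  rw [mul_add, sqrt_four_sub_pi_mul] at h'
  rw [stackEnergy]
  linarith

lemma stackEnergy_lt {m K : ℝ} (h : m < K) (hK : Real.pi * K < 4 * m) :
    stackEnergy m K < 4 * m := by
  have hd : 0 < K - m := sub_pos.2 h
  have h1 : 2 * (K - m) < √(4 - Real.pi) * √(K * (K - m)) := by
    rw [← Real.sqrt_mul four_sub_pi_pos.le]
    refine Real.lt_sqrt_of_sq_lt ?_
    nlinarith
  rw [stackEnergy]; linarith

lemma le_stackEnergy {m K : ℝ} (h : m ≤ K) (hK : 4 * m ≤ Real.pi * K) :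
    4 * m ≤ stackEnergy m K := by
  have hd : 0 ≤ K - m := sub_nonneg.2 h
  have h1 : √(4 - Real.pi) * √(K * (K - m)) ≤ 2 * (K - m) := by
    rw [← Real.sqrt_mul four_sub_pi_pos.le]
    refine Real.sqrt_le_iff.2 ⟨by linarith, ?_⟩
    nlinarith
  rw [stackEnergy]; linarith

lemma sq_four_mul_sqrt {m K : ℝ} (hm : 0 ≤ m) (h : m ≤ K) :
    (4 * √(K * (K - m))) ^ 2 = 4 * ((2 * K - m) ^ 2 - m ^ 2) := by
  rw [mul_pow, Real.sq_sqrt (mul_nonneg (hm.trans h) (sub_nonneg.2 h))]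
  ring

lemma sq_sqrt_mul_sub (m K : ℝ) :
    (√(4 - Real.pi) * (2 * K - m)) ^ 2 = (4 - Real.pi) * (2 * K - m) ^ 2 := by
  rw [mul_pow, Real.sq_sqrt four_sub_pi_pos.le]

lemma sqrt_sub_mul_add (m K₁ K₂ : ℝ) (hm : 0 ≤ m) (h1 : m ≤ K₁) (h2 : m ≤ K₂) :
    (√(K₂ * (K₂ - m)) - √(K₁ * (K₁ - m))) * (√(K₂ * (K₂ - m)) + √(K₁ * (K₁ - m))) =
      (K₂ - K₁) * (K₁ + K₂ - m) := by
  have e1 := Real.sq_sqrt (mul_nonneg (hm.trans h1) (sub_nonneg.2 h1))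
  have e2 := Real.sq_sqrt (mul_nonneg (hm.trans h2) (sub_nonneg.2 h2))
  linear_combination e2 - e1

lemma stackEnergy_lt_of_le {m K₁ K₂ : ℝ} (hm : 0 < m) (h1 : m ≤ K₁) (h : K₁ < K₂)
    (h2 : Real.pi * (2 * K₂ - m) ^ 2 ≤ 4 * m ^ 2) : stackEnergy m K₂ < stackEnergy m K₁ := by
  have hw : (2 * K₁ - m) ^ 2 < (2 * K₂ - m) ^ 2 := by nlinarith
  have hsα := Real.sqrt_pos.2 four_sub_pi_pos
  have k1 : 4 * √(K₁ * (K₁ - m)) < √(4 - Real.pi) * (2 * K₁ - m) := by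
    rw [← sq_lt_sq₀ (by positivity) (mul_nonneg hsα.le (by linarith)), sq_four_mul_sqrt hm.le h1,
      sq_sqrt_mul_sub]
    nlinarith [Real.pi_pos]
  have k2 : 4 * √(K₂ * (K₂ - m)) ≤ √(4 - Real.pi) * (2 * K₂ - m) := by
    rw [← sq_le_sq₀ (by positivity) (mul_nonneg hsα.le (by linarith)),
      sq_four_mul_sqrt hm.le (h1.trans h.le), sq_sqrt_mul_sub]
    linarith
  have hQ := sqrt_sub_mul_add m K₁ K₂ hm.le h1 (h1.trans h.le)
  have hpos : 0 < √(K₂ * (K₂ - m)) :=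
    Real.sqrt_pos.2 (mul_pos (by linarith) (by linarith))
  have hnn := Real.sqrt_nonneg (K₁ * (K₁ - m))
  rw [stackEnergy, stackEnergy]
  generalize √(K₂ * (K₂ - m)) = Q₂ at *
  generalize √(K₁ * (K₁ - m)) = Q₁ at *
  have h3 : (K₂ - K₁) * (2 * (Q₂ + Q₁)) < √(4 - Real.pi) * (Q₂ - Q₁) * (Q₂ + Q₁) := by
    have : 2 * (Q₂ + Q₁) < √(4 - Real.pi) * (K₁ + K₂ - m) := by linarith
    rw [mul_assoc, hQ]
    linarith [mul_lt_mul_of_pos_left this (sub_pos.2 h)]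
  have h4 : 2 * (K₂ - K₁) < √(4 - Real.pi) * (Q₂ - Q₁) :=
    lt_of_mul_lt_mul_right (a := Q₂ + Q₁) (by linarith) (add_nonneg hpos.le hnn)
  linarith

lemma stackEnergy_lt_of_ge {m K₁ K₂ : ℝ} (hm : 0 < m) (h1 : m < K₁) (h : K₁ < K₂)
    (h2 : 4 * m ^ 2 ≤ Real.pi * (2 * K₁ - m) ^ 2) : stackEnergy m K₁ < stackEnergy m K₂ := by
  have hw : (2 * K₁ - m) ^ 2 < (2 * K₂ - m) ^ 2 := by nlinarith
  have hsα := Real.sqrt_pos.2 four_sub_pi_pos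
  have k1 : √(4 - Real.pi) * (2 * K₁ - m) ≤ 4 * √(K₁ * (K₁ - m)) := by
    rw [← sq_le_sq₀ (mul_nonneg hsα.le (by linarith)) (by positivity), sq_four_mul_sqrt hm.le h1.le,
      sq_sqrt_mul_sub]
    linarith
  have k2 : √(4 - Real.pi) * (2 * K₂ - m) < 4 * √(K₂ * (K₂ - m)) := by
    rw [← sq_lt_sq₀ (mul_nonneg hsα.le (by linarith)) (by positivity),
      sq_four_mul_sqrt hm.le (h1.trans h).le, sq_sqrt_mul_sub]
    nlinarith [Real.pi_pos]
  have hQ := sqrt_sub_mul_add m K₁ K₂ hm.le h1.le (h1.trans h).le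
  have hpos : 0 < √(K₂ * (K₂ - m)) :=
    Real.sqrt_pos.2 (mul_pos (by linarith) (by linarith))
  have hnn := Real.sqrt_nonneg (K₁ * (K₁ - m))
  rw [stackEnergy, stackEnergy]
  generalize √(K₂ * (K₂ - m)) = Q₂ at *
  generalize √(K₁ * (K₁ - m)) = Q₁ at *
  have h3 : √(4 - Real.pi) * (Q₂ - Q₁) * (Q₂ + Q₁) < (K₂ - K₁) * (2 * (Q₂ + Q₁)) := by
    rw [mul_assoc, hQ, mul_left_comm]
    exact mul_lt_mul_of_pos_left (by linarith) (sub_pos.2 h)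
  have h4 : √(4 - Real.pi) * (Q₂ - Q₁) < 2 * (K₂ - K₁) :=
    lt_of_mul_lt_mul_right (a := Q₂ + Q₁) (by linarith) (add_nonneg hpos.le hnn)
  linarith

/-- An integer with no better neighbour is one of the two integers around the real minimizer of
`stackEnergy`. -/
lemma eq_floor_of_optimal {m : ℝ} (hm : 4 < m) {J : ℕ} (hJ : m < J) (hJ' : Real.pi * J < 4 * m)
    (H : ∀ K : ℕ, m < K → Real.pi * K ≤ 4 * m → stackEnergy m J ≤ stackEnergy m K) :
    (J : ℤ) = ⌊(2 + √Real.pi) / (2 * √Real.pi) * m⌋ ∨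
      (J : ℤ) = ⌊(2 + √Real.pi) / (2 * √Real.pi) * m⌋ + 1 := by
  have hm0 : 0 < m := by linarith
  have hp : 0 < √Real.pi := Real.sqrt_pos.2 Real.pi_pos
  have hp2 : √Real.pi < 2 := by
    rw [Real.sqrt_lt' two_pos]; linarith [Real.pi_lt_four]
  have hsq := Real.sq_sqrt Real.pi_pos.le
  set x := (2 + √Real.pi) / (2 * √Real.pi) * m with hx
  have hx1 : √Real.pi * (2 * x - m) = 2 * m := by
    rw [hx]; field_simp; ring
  have hx2 : Real.pi * (2 * x - m) ^ 2 = 4 * m ^ 2 := by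
    rw [← hsq, ← mul_pow, hx1]; ring
  have hmx : m < x := by nlinarith
  have hle : ∀ K : ℝ, m ≤ K → K ≤ x → Real.pi * (2 * K - m) ^ 2 ≤ 4 * m ^ 2 := fun K h1 h2 => by
    rw [← hx2]
    exact mul_le_mul_of_nonneg_left (pow_le_pow_left₀ (by linarith) (by linarith) 2) Real.pi_pos.le
  have hge : ∀ K : ℝ, x ≤ K → 4 * m ^ 2 ≤ Real.pi * (2 * K - m) ^ 2 := fun K h2 => by
    rw [← hx2]
    exact mul_le_mul_of_nonneg_left (pow_le_pow_left₀ (by linarith) (by linarith) 2) Real.pi_pos.le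
  have hxm : Real.pi * x ≤ 4 * m := by
    have : Real.pi * x = √Real.pi * m + Real.pi / 2 * m := by
      rw [show Real.pi * x = (√Real.pi * (√Real.pi * (2 * x - m)) + Real.pi * m) / 2 by
        linear_combination (x - m / 2) * (-hsq), hx1]
      ring
    rw [this]
    nlinarith [Real.pi_lt_four]
  have hJ1 : (⌊x⌋ : ℤ) ≤ J := by
    by_contra! hlt
    have h1 : ((J + 1 : ℕ) : ℤ) ≤ ⌊x⌋ := by push_cast; exact hlt
    have h2 : ((J + 1 : ℕ) : ℝ) ≤ x := by
      have := Int.le_floor.1 h1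
      exact_mod_cast this
    have h3 : (J : ℝ) < (J + 1 : ℕ) := by push_cast; linarith
    have h4 := H (J + 1) (hJ.trans h3)
      ((mul_le_mul_of_nonneg_left h2 Real.pi_pos.le).trans hxm)
    exact absurd (stackEnergy_lt_of_le hm0 hJ.le h3 (hle _ (hJ.trans h3).le h2)) (not_lt.2 h4)
  have hJ2 : (J : ℤ) ≤ ⌊x⌋ + 1 := by
    by_contra! hlt
    have hpos : 1 ≤ J := by
      have : (0 : ℝ) < J := hm0.trans hJ
      exact_mod_cast this
    have h1 : ⌊x⌋ < ((J - 1 : ℕ) : ℤ) := by push_cast [Nat.cast_sub hpos]; linarith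
    have h2 : x < ((J - 1 : ℕ) : ℝ) := by
      have := Int.floor_lt.1 h1
      exact_mod_cast this
    have h3 : ((J - 1 : ℕ) : ℝ) < J := by rw [Nat.cast_sub hpos]; simp
    have h4 := H (J - 1) (hmx.trans h2)
      ((mul_le_mul_of_nonneg_left h3.le Real.pi_pos.le).trans hJ'.le)
    exact absurd (stackEnergy_lt_of_ge hm0 (hmx.trans h2) h3 (hge _ h2.le)) (not_lt.2 h4)
  omega

lemma exists_stackEnergy_lt {m : ℝ} (hm : 4 < m) :
    ∃ K : ℕ, m < K ∧ Real.pi * K ≤ 4 * m ∧ stackEnergy m K < 4 * m := by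
  have h1 : m < (⌊m⌋₊ + 1 : ℕ) := by exact_mod_cast Nat.lt_floor_add_one m
  have h2 : ((⌊m⌋₊ + 1 : ℕ) : ℝ) ≤ m + 1 := by
    push_cast
    linarith [Nat.floor_le (show 0 ≤ m by linarith)]
  have h3 : Real.pi * (⌊m⌋₊ + 1 : ℕ) < 4 * m := by
    nlinarith [Real.pi_lt_d2, Real.pi_pos]
  exact ⟨_, h1, h3.le, stackEnergy_lt h1 h3⟩

lemma squareProfile_eq_of_le {a : ℝ} (h : a ≤ Real.pi / 4) :
    squareProfile a = Real.pi * (2 * √(a / Real.pi)) := by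
  have : Real.pi * a = Real.pi ^ 2 * (a / Real.pi) := by
    field_simp
  rw [squareProfile, if_pos h, this, Real.sqrt_mul (sq_nonneg _), Real.sqrt_sq Real.pi_pos.le]
  ring

lemma squareProfile_eq_of_lt {a : ℝ} (h : Real.pi / 4 < a) :
    squareProfile a = 4 - 2 * √(4 - Real.pi) * √(1 - a) := by
  rw [squareProfile, if_neg (not_le.2 h), Real.sqrt_mul four_sub_pi_pos.le, mul_assoc]

lemma pi_lt_four_sub_pi_mul {n : ℝ} (hn : 4 ≤ n) : Real.pi < (4 - Real.pi) * n := by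
  nlinarith [Real.pi_lt_d2]

lemma pi_div_four_mul_sq_lt {t : ℝ} (h0 : 0 ≤ t) (h1 : t < 1) :
    Real.pi / 4 * t ^ 2 < Real.pi / 4 := by
  have h := pow_lt_one₀ h0 h1 two_ne_zero
  linarith [mul_lt_mul_of_pos_left h (by positivity : 0 < Real.pi / 4)]

lemma sqrt_gap {n d t : ℝ} (hn : 4 ≤ n) (hd : d < 0) (h0 : 0 ≤ t) (h1 : t < 1)
    (hY : 0 ≤ d + Real.pi / 4 * t ^ 2) :
    2 * √(4 - Real.pi) * √(n * (d + Real.pi / 4 * t ^ 2)) + Real.pi * (1 - t) <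
      2 * √(4 - Real.pi) * √(n * (d + Real.pi / 4)) := by
  have hp := Real.sq_sqrt Real.pi_pos.le
  have hp0 := Real.sqrt_pos.2 Real.pi_pos
  have ht2 := pi_div_four_mul_sq_lt h0 h1
  have hZ : 0 < d + Real.pi / 4 := by linarith
  have hX1 : √(d + Real.pi / 4 * t ^ 2) ≤ √Real.pi / 2 * t :=
    Real.sqrt_le_iff.2 ⟨by positivity, by rw [mul_pow, div_pow, hp]; linarith⟩
  have hZ1 : √(d + Real.pi / 4) ≤ √Real.pi / 2 :=
    Real.sqrt_le_iff.2 ⟨by positivity, by rw [div_pow, hp]; linarith⟩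
  have eX := Real.sq_sqrt hY
  have eZ := Real.sq_sqrt hZ.le
  have hXZ : √(d + Real.pi / 4 * t ^ 2) ≤ √(d + Real.pi / 4) :=
    Real.sqrt_le_sqrt (by linarith)
  have hk : √Real.pi < √(4 - Real.pi) * √n := by
    rw [← Real.sqrt_mul four_sub_pi_pos.le]
    exact Real.sqrt_lt_sqrt Real.pi_pos.le (pi_lt_four_sub_pi_mul hn)
  have hn0 : 0 ≤ n := by linarith
  rw [Real.sqrt_mul hn0, Real.sqrt_mul hn0]
  generalize √(d + Real.pi / 4 * t ^ 2) = X at *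
  generalize √(d + Real.pi / 4) = Z at *
  have hgap : √Real.pi / 2 * (1 - t) ≤ Z - X := by
    have h2 : (√Real.pi / 2 * (1 - t)) * (√Real.pi / 2 * (1 + t)) ≤
        (Z - X) * (√Real.pi / 2 * (1 + t)) :=
      calc (√Real.pi / 2 * (1 - t)) * (√Real.pi / 2 * (1 + t)) = (Z - X) * (Z + X) := by
            linear_combination (1 - t ^ 2) / 4 * hp - eZ + eX
        _ ≤ _ := mul_le_mul_of_nonneg_left (by linarith) (sub_nonneg.2 hXZ)
    exact le_of_mul_le_mul_right h2 (by positivity)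
  have h3 : √Real.pi * (√Real.pi / 2 * (1 - t)) < √(4 - Real.pi) * √n * (Z - X) :=
    mul_lt_mul hk hgap (by have : 0 < 1 - t := by linarith
                           positivity) (by positivity)
  have h4 : √Real.pi * (√Real.pi / 2 * (1 - t)) = Real.pi * (1 - t) / 2 := by
    linear_combination (1 - t) / 2 * hp
  linarith

/-- The combined energy bound after the small levels have been merged. -/
lemma merged_energy_cases {m t F : ℝ} {n : ℕ} (hm : 4 < m) (h0 : 0 ≤ t) (h1 : t < 1)
    (hY : 0 ≤ (n : ℝ) - m + Real.pi / 4 * t ^ 2)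
    (hF : 4 * n - 2 * √(4 - Real.pi) * √(n * (n - m + Real.pi / 4 * t ^ 2)) + Real.pi * t ≤ F)
    (H : ∀ K : ℕ, m < K → Real.pi * K ≤ 4 * m → F ≤ stackEnergy m K)
    (hn : Real.pi * n ≤ 4 * m) : m < n ∧ t = 0 := by
  obtain ⟨K, hK1, hK2, hK3⟩ := exists_stackEnergy_lt hm
  have hF4 : F < 4 * m := (H K hK1 hK2).trans_lt hK3
  have hpi4 : Real.pi / 4 < 1 := by linarith [Real.pi_lt_four]
  have ht2 := pi_div_four_mul_sq_lt h0 h1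
  have hmn : m < (n + 1 : ℕ) := by push_cast; linarith
  have hn4 : (4 : ℝ) ≤ n := by
    have : (4 : ℝ) < (n + 1 : ℕ) := hm.trans hmn
    have : 4 < n + 1 := by exact_mod_cast this
    have : 4 ≤ n := by omega
    exact_mod_cast this
  have hT : F ≤ stackEnergy m (n + 1) := by
    rcases le_total (Real.pi * (n + 1 : ℕ)) (4 * m) with h | h
    · simpa using H (n + 1) hmn h
    · have := le_stackEnergy hmn.le h
      push_cast at this
      linarith
  have hc : 0 ≤ (n : ℝ) - m + Real.pi / 4 := by linarith
  have hsucc := stackEnergy_succ_le (m := m) (by linarith : (0 : ℝ) ≤ n) hc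
  have hn0 : (0 : ℝ) ≤ n := by linarith
  have hα := Real.sqrt_pos.2 four_sub_pi_pos
  rcases lt_or_ge (n : ℝ) m with hlt | hge
  · have := sqrt_gap hn4 (sub_neg.2 hlt) h0 h1 hY
    linarith
  have hd : 0 ≤ (n : ℝ) - m := sub_nonneg.2 hge
  have hpi : 0 ≤ Real.pi / 4 := by positivity
  have hTn : stackEnergy m n = 4 * n - 2 * √(4 - Real.pi) * (√n * √(n - m)) := by
    rw [stackEnergy, Real.sqrt_mul hn0]
  rw [Real.sqrt_mul hn0] at hF hsucc
  have hcomb : ∀ X, X ≤ (1 - t) * √(n - m) + t * √(n - m + Real.pi / 4) →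
      (1 - t) * stackEnergy m n + t * F ≤
        4 * n - 2 * √(4 - Real.pi) * (√n * X) + Real.pi * t := fun X hX => by
    have e1 := mul_le_mul_of_nonneg_left hX
      (mul_nonneg (mul_nonneg zero_le_two hα.le) (Real.sqrt_nonneg n))
    have e2 := mul_le_mul_of_nonneg_left (hT.trans hsucc) h0
    rw [hTn]
    linarith
  have hlt : m < n := by
    refine lt_of_le_of_ne hge fun h => ?_
    have e := (hcomb _ (sqrt_add_mul_sq_le hd hpi h0 h1.le)).trans hF
    have : stackEnergy m n = 4 * m := by rw [hTn, ← h, sub_self]; simp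
    rw [this] at e
    nlinarith
  refine ⟨hlt, ?_⟩
  by_contra hne
  have ht : 0 < t := lt_of_le_of_ne h0 (Ne.symm hne)
  have hX := sqrt_add_mul_sq_lt (sub_pos.2 hlt) (by positivity : 0 < Real.pi / 4) ht h1
  have e := hcomb _ le_rfl
  have e1 := mul_lt_mul_of_pos_left hX
    (mul_pos (mul_pos zero_lt_two hα) (Real.sqrt_pos.2 (by linarith : (0 : ℝ) < n)))
  have e2 := mul_le_mul_of_nonneg_left (H n hlt hn) (sub_nonneg.2 h1.le)
  linarith

/-- If a family of areas beats every stack of equal rounded squares, it is such a stack. -/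
lemma eq_div_card_of_optimal {ι : Type*} (s : Finset ι) (a : ι → ℝ) {m : ℝ} (hm : 4 < m)
    (ha : ∀ i ∈ s, 0 < a i ∧ a i ≤ 1) (hsum : ∑ i ∈ s, a i = m)
    (H : ∀ K : ℕ, m < K → Real.pi * K ≤ 4 * m →
      ∑ i ∈ s, squareProfile (a i) ≤ stackEnergy m K) :
    m < s.card ∧ Real.pi * s.card < 4 * m ∧ ∀ i ∈ s, a i = m / s.card := by
  classical
  set small := s.filter fun i => a i ≤ Real.pi / 4 with hsmall
  set big := s.filter fun i => ¬ a i ≤ Real.pi / 4 with hbig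
  have hsa : ∀ i ∈ small, 0 < a i ∧ a i ≤ Real.pi / 4 := fun i hi => by
    rw [hsmall, Finset.mem_filter] at hi; exact ⟨(ha i hi.1).1, hi.2⟩
  have hba : ∀ i ∈ big, Real.pi / 4 < a i ∧ a i ≤ 1 := fun i hi => by
    rw [hbig, Finset.mem_filter] at hi; exact ⟨not_le.1 hi.2, (ha i hi.1).2⟩
  have hτsq : ∀ i ∈ small, (2 * √(a i / Real.pi)) ^ 2 = 4 / Real.pi * a i := fun i hi => by
    rw [mul_pow, Real.sq_sqrt (div_nonneg (hsa i hi).1.le Real.pi_pos.le)]; ring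
  obtain ⟨q, t, h0, h1, hq1, hq2⟩ := exists_merge small (fun i => 2 * √(a i / Real.pi))
    fun i hi => ⟨by positivity, by
      rw [← sq_le_one_iff₀ (by positivity), hτsq i hi, div_mul_eq_mul_div, div_le_one Real.pi_pos]
      linarith [(hsa i hi).2]⟩
  rw [Finset.sum_congr rfl hτsq, ← Finset.mul_sum] at hq1
  have hsum_small : ∑ i ∈ small, a i = Real.pi / 4 * (q + t ^ 2) := by
    rw [← hq1]; field_simp
  have hsplit : ∀ f : ι → ℝ, ∑ i ∈ small, f i + ∑ i ∈ big, f i = ∑ i ∈ s, f i := fun f =>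
    Finset.sum_filter_add_sum_filter_not s _ f
  have hsum_big : ∑ i ∈ big, a i = m - Real.pi / 4 * (q + t ^ 2) := by
    rw [← hsum, ← hsplit, hsum_small]; ring
  set n : ℕ := big.card + q with hn
  have hnR : (n : ℝ) = big.card + q := by rw [hn]; push_cast; rfl
  set Y : ℝ := n - m + Real.pi / 4 * t ^ 2 with hYdef
  set S : ℝ := ∑ i ∈ big, √(1 - a i) + q * √(1 - Real.pi / 4) with hS
  have hz0 : √(1 - Real.pi / 4) ^ 2 = 1 - Real.pi / 4 :=
    Real.sq_sqrt (by linarith [Real.pi_lt_four])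
  have hvar : ∀ σ : ℝ, ∑ i ∈ big, (√(1 - a i) - σ) ^ 2 + q * (√(1 - Real.pi / 4) - σ) ^ 2 =
      Y - 2 * σ * S + n * σ ^ 2 := fun σ => by
    have e : ∑ i ∈ big, (√(1 - a i) - σ) ^ 2 =
        ∑ i ∈ big, (1 - a i - 2 * σ * √(1 - a i) + σ ^ 2) :=
      Finset.sum_congr rfl fun i hi => by
        have := Real.sq_sqrt (sub_nonneg.2 (hba i hi).2)
        linear_combination this
    rw [e, Finset.sum_add_distrib, Finset.sum_sub_distrib, Finset.sum_sub_distrib, hsum_big,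
      ← Finset.mul_sum, Finset.sum_const, Finset.sum_const, nsmul_eq_mul, nsmul_eq_mul, hS,
      hYdef, hnR]
    linear_combination (q : ℝ) * hz0
  have hvar0 : ∀ σ : ℝ, 0 ≤ Y - 2 * σ * S + n * σ ^ 2 := fun σ => by
    rw [← hvar]
    exact add_nonneg (Finset.sum_nonneg fun i _ => sq_nonneg _)
      (mul_nonneg (Nat.cast_nonneg _) (sq_nonneg _))
  have hY : 0 ≤ Y := by simpa using hvar0 0
  have hpi4 : Real.pi / 4 < 1 := by linarith [Real.pi_lt_four]
  have hn0 : (0 : ℝ) < n := by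
    linarith [pi_div_four_mul_sq_lt h0 h1]
  have hC : S ≤ √(n * Y) := by
    refine Real.le_sqrt_of_sq_le ?_
    have := mul_nonneg hn0.le (hvar0 (S / n))
    have e : n * (Y - 2 * (S / n) * S + n * (S / n) ^ 2) = n * Y - S ^ 2 := by
      field_simp; ring
    linarith
  have hFlow : 4 * n - 2 * √(4 - Real.pi) * S + Real.pi * t ≤ ∑ i ∈ s, squareProfile (a i) := by
    have h_small : ∑ i ∈ small, squareProfile (a i) =
        Real.pi * ∑ i ∈ small, 2 * √(a i / Real.pi) := by
      rw [Finset.mul_sum]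
      exact Finset.sum_congr rfl fun i hi => squareProfile_eq_of_le (hsa i hi).2
    have h_big : ∑ i ∈ big, squareProfile (a i) =
        big.card * 4 - 2 * √(4 - Real.pi) * ∑ i ∈ big, √(1 - a i) := by
      rw [Finset.mul_sum, ← nsmul_eq_mul, ← Finset.sum_const, ← Finset.sum_sub_distrib]
      exact Finset.sum_congr rfl fun i hi => squareProfile_eq_of_lt (hba i hi).1
    rw [← hsplit, h_small, h_big, hS, hnR]
    have e1 := mul_le_mul_of_nonneg_left hq2 Real.pi_pos.le
    have e2 := sqrt_four_sub_pi_mul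
    have e3 : 2 * √(4 - Real.pi) * (q * √(1 - Real.pi / 4)) = q * (4 - Real.pi) := by
      linear_combination (q : ℝ) * e2
    linarith
  have hα := Real.sqrt_pos.2 four_sub_pi_pos
  have hCα := mul_le_mul_of_nonneg_left hC (mul_nonneg zero_le_two hα.le)
  have hnpi : Real.pi * n ≤ 4 * m := by
    have e := Finset.card_nsmul_le_sum big a (Real.pi / 4) fun i hi => (hba i hi).1.le
    rw [nsmul_eq_mul, hsum_big] at e
    have := mul_nonneg Real.pi_pos.le (sq_nonneg t)
    rw [hnR]
    linarith
  obtain ⟨hmn, ht⟩ := merged_energy_cases hm h0 h1 hY (by linarith) H hnpi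
  have hYd : Y = n - m := by rw [hYdef, ht]; ring
  have hTn : stackEnergy m n = 4 * n - 2 * √(4 - Real.pi) * √(n * Y) := by
    rw [stackEnergy, hYd]
  have hnpi' : Real.pi * n < 4 * m := by
    obtain ⟨K, hK1, hK2, hK3⟩ := exists_stackEnergy_lt hm
    refine lt_of_le_of_ne hnpi fun h => ?_
    have h5 := le_stackEnergy hmn.le h.ge
    have h6 := H K hK1 hK2
    rw [ht] at hFlow
    linarith
  have hS' : √(n * Y) ≤ S := by
    have h6 := H n hmn hnpi
    rw [ht] at hFlow
    have : 2 * √(4 - Real.pi) * √(n * Y) ≤ 2 * √(4 - Real.pi) * S := by linarith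
    exact le_of_mul_le_mul_left this (by positivity)
  have hσ2 : √(Y / n) ^ 2 = Y / n := Real.sq_sqrt (div_nonneg hY hn0.le)
  have hzero : ∑ i ∈ big, (√(1 - a i) - √(Y / n)) ^ 2 +
      q * (√(1 - Real.pi / 4) - √(Y / n)) ^ 2 ≤ 0 := by
    rw [hvar, hσ2]
    have e1 : √(Y / n) * √(n * Y) = Y := by
      rw [← Real.sqrt_mul (div_nonneg hY hn0.le), show Y / n * (n * Y) = Y ^ 2 by field_simp,
        Real.sqrt_sq hY]
    have e2 := mul_le_mul_of_nonneg_left hS' (Real.sqrt_nonneg (Y / n))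
    have e3 : (n : ℝ) * (Y / n) = Y := by field_simp
    linarith
  have hz1 : 0 ≤ ∑ i ∈ big, (√(1 - a i) - √(Y / n)) ^ 2 := Finset.sum_nonneg fun i _ => sq_nonneg _
  have hz2 : 0 ≤ (q : ℝ) * (√(1 - Real.pi / 4) - √(Y / n)) ^ 2 := by positivity
  have hYn : Y / n = 1 - m / n := by rw [hYd, sub_div, div_self hn0.ne']
  have hq0 : q = 0 := by
    by_contra hq
    have h6 : (q : ℝ) * (√(1 - Real.pi / 4) - √(Y / n)) ^ 2 = 0 := by linarith
    have h7 : √(1 - Real.pi / 4) - √(Y / n) = 0 := by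
      rcases _root_.mul_eq_zero.1 h6 with h | h
      · exact absurd (Nat.cast_eq_zero.1 h) hq
      · exact pow_eq_zero_iff two_ne_zero |>.1 h
    rw [sub_eq_zero.1 h7, hσ2, hYn] at hz0
    have : m / n * n = m := div_mul_cancel₀ m hn0.ne'
    nlinarith
  have hsm : small = ∅ := by
    rw [hq0, ht] at hsum_small
    by_contra hne
    have := Finset.sum_pos (fun i hi => (hsa i hi).1) (Finset.nonempty_iff_ne_empty.2 hne)
    rw [hsum_small] at this
    simp at this
  have hbs : big = s := by
    rw [hbig, Finset.filter_eq_self]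
    intro i hi hle
    have : i ∈ small := Finset.mem_filter.2 ⟨hi, hle⟩
    rw [hsm] at this
    exact absurd this (Finset.notMem_empty i)
  have hcard : n = s.card := by rw [hn, hq0, hbs, add_zero]
  rw [← hcard]
  refine ⟨hmn, hnpi', fun i hi => ?_⟩
  have h8 : ∑ i ∈ big, (√(1 - a i) - √(Y / n)) ^ 2 = 0 := by linarith
  have h9 := (Finset.sum_eq_zero_iff_of_nonneg fun i _ => sq_nonneg _).1 h8 i (hbs ▸ hi)
  have h10 : √(1 - a i) = √(Y / n) := sub_eq_zero.1 (pow_eq_zero_iff two_ne_zero |>.1 h9)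
  have h11 := Real.sq_sqrt (sub_nonneg.2 (ha i hi).2)
  rw [h10, hσ2, hYn] at h11
  linarith

lemma cornerRadius_le_half {a : ℝ} (h : Real.pi / 4 ≤ a) (h1 : a ≤ 1) :
    cornerRadius a ≤ 1 / 2 := by
  have e := cornerRadius_sq h1
  have h2 : cornerRadius a ^ 2 ≤ (1 / 2) ^ 2 := by
    refine le_of_mul_le_mul_left (?_ : (4 - Real.pi) * _ ≤ (4 - Real.pi) * _) four_sub_pi_pos
    rw [e]; linarith
  exact (sq_le_sq₀ (cornerRadius_nonneg a) (by norm_num)).1 h2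

lemma mul_eq_stackEnergy {m K : ℝ} (hK : 0 < K) :
    K * (4 - 2 * √((4 - Real.pi) * (1 - m / K))) = stackEnergy m K := by
  have e : K * (K - m) = K ^ 2 * (1 - m / K) := by field_simp
  rw [stackEnergy, e, Real.sqrt_mul (sq_nonneg K), Real.sqrt_sq hK.le,
    Real.sqrt_mul four_sub_pi_pos.le]
  ring

/-- A stack of `K` equal rounded squares is a competitor. -/
lemma exists_stack {m : ℝ} (hm : 0 < m) {K : ℕ} (h1 : m < K) (h2 : Real.pi * K ≤ 4 * m) :
    0 ≤ stackEnergy m K ∧ ∃ v, Admissible euclNorm unitSquare m v ∧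
      anisoTV euclNorm v ≤ ENNReal.ofReal (stackEnergy m K) := by
  have hK : (0 : ℝ) < K := hm.trans h1
  have ha1 : m / K < 1 := (div_lt_one hK).2 h1
  have ha : Real.pi / 4 ≤ m / K := by rw [le_div_iff₀ hK]; linarith
  have hr0 := cornerRadius_pos ha1
  have hr := cornerRadius_le_half ha ha1.le
  have hsq := cornerRadius_sq ha1.le
  have hE := mul_eq_stackEnergy (m := m) hK
  rw [sqrt_mul_eq_cornerRadius ha1.le] at hE
  set r := cornerRadius (m / K)
  have hTV := anisoTV_roundDist_le hr0 hr hK.le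
  have hR : MeasurableSet {x | roundDist r x < r} := (isOpen_roundDist_lt r r).measurableSet
  have hsub := roundDist_lt_subset_unitSquare hr0
  have hvol := volume_real_roundDist_lt_self hr hr0
  rw [mul_assoc 2, hE] at hTV
  have hfin : volume {x | roundDist r x < r} ≠ ⊤ := fun h => by
    rw [Measure.real, h, ENNReal.toReal_top, hsq] at hvol
    have := div_pos hm hK
    linarith
  refine ⟨?_, _, ⟨⟨?_, (hTV.trans_lt ENNReal.ofReal_lt_top).ne⟩, ?_, ?_, ?_⟩, hTV⟩
  · rw [← hE]
    have h3 := mul_le_mul_of_nonneg_left hr four_sub_pi_pos.le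
    have := Real.pi_pos
    exact mul_nonneg hK.le (by linarith)
  · have : IntegrableOn (fun _ => (K : ℝ)) {x | roundDist r x < r} := integrableOn_const hfin
    exact this.integrable_indicator hR
  · exact Eventually.of_forall fun x hx => indicator_of_notMem (fun h => hx (hsub h)) _
  · refine Eventually.of_forall fun x => ?_
    by_cases hx : x ∈ {x | roundDist r x < r}
    · exact ⟨K, indicator_of_mem hx _⟩
    · exact ⟨0, by rw [indicator_of_notMem hx, Nat.cast_zero]⟩
  · rw [setIntegral_indicator hR, inter_eq_self_of_subset_right hsub, setIntegral_const, hvol, hsq,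
      smul_eq_mul]
    field_simp
    ring

lemma anisoTV_congr {φ : (Fin 2 → ℝ) → ℝ} {u v : (Fin 2 → ℝ) → ℝ} (h : u =ᵐ[volume] v) :
    anisoTV φ u = anisoTV φ v :=
  iSup_congr fun η => iSup_congr fun _ => congrArg ENNReal.ofReal <|
    integral_congr_ae <| h.mono fun x hx => congrArg (· * diverg η x) hx

/-- An admissible function has a measurable representative vanishing outside the square. -/
lemma Admissible.exists_measurable {m : ℝ} {u : (Fin 2 → ℝ) → ℝ}
    (hu : Admissible euclNorm unitSquare m u) :
    ∃ v, Measurable v ∧ v =ᵐ[volume] u ∧ ∀ x ∉ unitSquare, v x = 0 := by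
  have hm := hu.1.1.aemeasurable
  refine ⟨unitSquare.indicator (hm.mk u), hm.measurable_mk.indicator measurableSet_unitSquare, ?_,
    fun x hx => indicator_of_notMem hx _⟩
  filter_upwards [hm.ae_eq_mk, hu.2.1] with x h1 h2
  by_cases hx : x ∈ unitSquare
  · rw [indicator_of_mem hx, h1]
  · rw [indicator_of_notMem hx, h2 hx]

lemma volume_unitSquare : volume unitSquare = 1 := by
  rw [unitSquare, Real.volume_pi_Ioo]
  simp

/-- Layer cake formula for integer valued functions. -/
lemma sum_volume_superlevel {v : (Fin 2 → ℝ) → ℝ} (hv : Measurable v)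
    (h0 : ∀ x ∉ unitSquare, v x = 0) (hnat : ∀ᵐ x, ∃ k : ℕ, v x = k) {J : ℕ}
    (hJ : ∀ᵐ x, v x ≤ J) :
    ∑ j ∈ Finset.range J, volume.real {x | (j : ℝ) + 1 ≤ v x} = ∫ x in unitSquare, v x := by
  have hE : ∀ j : ℕ, MeasurableSet {x | (j : ℝ) + 1 ≤ v x} := fun j =>
    measurableSet_le measurable_const hv
  have hsub : ∀ j : ℕ, {x | (j : ℝ) + 1 ≤ v x} ⊆ unitSquare := fun j x hx => by
    by_contra h
    have : (j : ℝ) + 1 ≤ v x := hx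
    rw [h0 x h] at this
    linarith [(Nat.cast_nonneg j : (0 : ℝ) ≤ j)]
  have hfin : ∀ j : ℕ, volume {x | (j : ℝ) + 1 ≤ v x} ≠ ⊤ := fun j =>
    measure_ne_top_of_subset (hsub j) (by rw [volume_unitSquare]; exact one_ne_top)
  have hcake : v =ᵐ[volume] fun x => ∑ j ∈ Finset.range J,
      {x | (j : ℝ) + 1 ≤ v x}.indicator (fun _ => (1 : ℝ)) x := by
    filter_upwards [hnat, hJ] with x ⟨k, hk⟩ hx
    have hkJ : k ≤ J := by rw [hk] at hx; exact_mod_cast hx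
    have e : ∀ j ∈ Finset.range J, {x | (j : ℝ) + 1 ≤ v x}.indicator (fun _ => (1 : ℝ)) x =
        if j ∈ Finset.range k then 1 else 0 := fun j _ => by
      have : ((j : ℝ) + 1 ≤ k) ↔ j ∈ Finset.range k := by
        rw [Finset.mem_range]; exact_mod_cast Iff.rfl
      simp only [indicator_apply, mem_ofPred_eq, hk, this]
    rw [Finset.sum_congr rfl e, Finset.sum_ite_mem, Finset.inter_eq_right.2
      (Finset.range_mono hkJ), hk]
    simp
  rw [setIntegral_eq_integral_of_forall_compl_eq_zero h0, integral_congr_ae hcake,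
    integral_finsetSum]
  · refine Finset.sum_congr rfl fun j _ => ?_
    rw [integral_indicator (hE j), setIntegral_const, smul_eq_mul, mul_one]
  · intro j _
    have : IntegrableOn (fun _ => (1 : ℝ)) {x | (j : ℝ) + 1 ≤ v x} := integrableOn_const (hfin j)
    exact this.integrable_indicator (hE j)

lemma isCalib_zero : IsCalib (fun _ _ => 0) fun _ => 0 where
  meas _ := measurable_const
  bound _ := by norm_num
  locInt := locallyIntegrable_zero
  weak ψ _ _ := by simp [gradPair]

lemma sum_le_of_calib {J : ℕ} {E : ℕ → Set (Fin 2 → ℝ)} {T : ℝ} {c : ℕ → ℝ}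
    (H : ∀ ξ : ℕ → Fin 2 → (Fin 2 → ℝ) → ℝ, ∀ g : ℕ → (Fin 2 → ℝ) → ℝ,
      (∀ j, IsCalib (ξ j) (g j)) → ∑ j ∈ Finset.range J, ∫ x in E j, g j x ≤ T)
    (hc : ∀ j < J, ∀ ε > 0, ∃ ξ g, IsCalib ξ g ∧ c j - ε ≤ ∫ x in E j, g x) :
    ∑ j ∈ Finset.range J, c j ≤ T := by
  have key : ∀ ε > 0, ∑ j ∈ Finset.range J, c j ≤ T + J * ε := fun ε hε => by
    have h : ∀ j, ∃ ξ g, IsCalib ξ g ∧ (j < J → c j - ε ≤ ∫ x in E j, g x) := fun j => by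
      by_cases hj : j < J
      · obtain ⟨ξ, g, h1, h2⟩ := hc j hj ε hε
        exact ⟨ξ, g, h1, fun _ => h2⟩
      · exact ⟨_, _, isCalib_zero, fun h => absurd h hj⟩
    choose ξ g h1 h2 using h
    have h3 := Finset.sum_le_sum fun j hj => h2 j (Finset.mem_range.1 hj)
    rw [Finset.sum_sub_distrib, Finset.sum_const, Finset.card_range, nsmul_eq_mul] at h3
    linarith [H ξ g h1]
  refine le_of_forall_pos_le_add fun δ hδ => (key (δ / (J + 1)) (by positivity)).trans ?_
  have : (J : ℝ) * (δ / (J + 1)) ≤ δ := by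
    rw [mul_div_assoc', div_le_iff₀ (by positivity)]
    nlinarith
  linarith

/-- The superlevel sets of a minimizer are equal rounded squares. -/
lemma superlevel_of_minimizer {m : ℝ} (hm : 4 < m) {u v : (Fin 2 → ℝ) → ℝ}
    (hu : IsMinimizer euclNorm unitSquare m u) {J : ℕ} (hJ : IsEssSup u J) (hv : Measurable v)
    (hvu : v =ᵐ[volume] u) (h0 : ∀ x ∉ unitSquare, v x = 0) :
    m < J ∧ Real.pi * J < 4 * m ∧
      (∀ K : ℕ, m < K → Real.pi * K ≤ 4 * m → stackEnergy m J ≤ stackEnergy m K) ∧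
      ∀ j < J, {x | (j : ℝ) + 1 ≤ v x} =ᵐ[volume]
        ({x | roundDist (cornerRadius (m / J)) x < cornerRadius (m / J)} : Set (Fin 2 → ℝ)) := by
  obtain ⟨⟨⟨hint, -⟩, -, hnat, hmass⟩, hmin⟩ := hu
  have hvint : Integrable v := hint.congr hvu.symm
  have hvnat : ∀ᵐ x, ∃ k : ℕ, v x = k := by
    filter_upwards [hvu, hnat] with x h1 h2
    rwa [h1]
  have hvJ : ∀ᵐ x, v x ≤ J := by
    filter_upwards [hvu, hJ.1] with x h1 h2
    rwa [h1]
  have hvs : HasCompactSupport v := by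
    refine HasCompactSupport.of_support_subset_isCompact
      (isCompact_univ_pi fun _ => isCompact_Icc : IsCompact (univ.pi fun _ => Icc (0 : ℝ) 1)) ?_
    intro x hx
    by_contra h
    exact hx (h0 x fun h' => h (pi_mono (fun _ _ => Ioo_subset_Icc_self) h'))
  set E : ℕ → Set (Fin 2 → ℝ) := fun j => {x | (j : ℝ) + 1 ≤ v x} with hEdef
  have hE : ∀ j, MeasurableSet (E j) := fun j => measurableSet_le measurable_const hv
  have hsub : ∀ j, E j ⊆ unitSquare := fun j x hx => by
    by_contra h
    have : (j : ℝ) + 1 ≤ v x := hx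
    rw [h0 x h] at this
    linarith [(Nat.cast_nonneg j : (0 : ℝ) ≤ j)]
  have hfin : ∀ j, volume (E j) ≠ ⊤ := fun j =>
    measure_ne_top_of_subset (hsub j) (by rw [volume_unitSquare]; exact one_ne_top)
  have hle : ∀ j, volume.real (E j) ≤ 1 := fun j => by
    refine (measureReal_mono (hsub j) (by rw [volume_unitSquare]; exact one_ne_top)).trans ?_
    rw [Measure.real, volume_unitSquare, ENNReal.toReal_one]
  have hpos : ∀ j < J, 0 < volume.real (E j) := fun j hj => by
    refine ENNReal.toReal_pos (fun h => ?_) (hfin j)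
    have h1 : ∀ᵐ x, u x ≤ j := by
      filter_upwards [measure_eq_zero_iff_ae_notMem.1 h, hvnat, hvu] with x hx ⟨k, hk⟩ hxu
      have h2 : ¬ (j : ℝ) + 1 ≤ v x := hx
      rw [hk] at h2
      rw [← hxu, hk]
      have : ¬ j + 1 ≤ k := fun h => h2 (by exact_mod_cast h)
      exact_mod_cast (by omega : k ≤ j)
    exact absurd (Nat.cast_le.1 (hJ.2 j h1)) (not_le.2 hj)
  have hsum : ∑ j ∈ Finset.range J, volume.real (E j) = m := by
    rw [sum_volume_superlevel hv h0 hvnat hvJ, ← hmass]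
    exact integral_congr_ae (ae_restrict_of_ae hvu)
  have hcal : ∀ K : ℕ, m < K → Real.pi * K ≤ 4 * m →
      ∀ ξ : ℕ → Fin 2 → (Fin 2 → ℝ) → ℝ, ∀ g : ℕ → (Fin 2 → ℝ) → ℝ,
      (∀ j, IsCalib (ξ j) (g j)) →
        ∑ j ∈ Finset.range J, ∫ x in E j, g j x ≤ stackEnergy m K := fun K hK1 hK2 ξ g hc => by
    obtain ⟨hK0, w, hw, hwTV⟩ := exists_stack (by linarith) hK1 hK2
    refine (ENNReal.ofReal_le_ofReal_iff hK0).1 ?_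
    refine (ofReal_sum_calib_le hvint hvs hvnat J hc).trans ?_
    rw [anisoTV_congr hvu]
    exact (hmin w hw).trans hwTV
  have hprof : ∀ j < J, ∀ ε > 0, ∃ ξ g, IsCalib ξ g ∧
      squareProfile (volume.real (E j)) - ε ≤ ∫ x in E j, g x := fun j hj ε hε =>
    exists_calib_profile (hE j) (hsub j) (hpos j hj) hε
  have hH : ∀ K : ℕ, m < K → Real.pi * K ≤ 4 * m →
      ∑ j ∈ Finset.range J, squareProfile (volume.real (E j)) ≤ stackEnergy m K :=
    fun K hK1 hK2 => sum_le_of_calib (hcal K hK1 hK2) hprof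
  obtain ⟨hmJ, hJm, harea⟩ := eq_div_card_of_optimal (Finset.range J)
    (fun j => volume.real (E j)) hm
    (fun j hj => ⟨hpos j (Finset.mem_range.1 hj), hle j⟩) hsum hH
  rw [Finset.card_range] at hmJ hJm harea
  have hJ0 : (0 : ℝ) < J := by linarith
  have hlow : Real.pi / 4 < m / J := by rw [lt_div_iff₀ hJ0]; linarith
  have hstack : ∑ j ∈ Finset.range J, squareProfile (volume.real (E j)) = stackEnergy m J := by
    rw [Finset.sum_congr rfl fun j hj => congrArg squareProfile (harea j hj), Finset.sum_const,
      Finset.card_range, nsmul_eq_mul, ← mul_eq_stackEnergy hJ0, squareProfile,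
      if_neg (not_le.2 hlow)]
  refine ⟨hmJ, hJm, fun K hK1 hK2 => hstack ▸ hH K hK1 hK2, fun i hi => ?_⟩
  have hi' := Finset.mem_range.2 hi
  have hai : volume.real (E i) = m / J := harea i hi'
  rw [← hai]
  refine ae_eq_roundDist_of_optimal (hE i) (hsub i) (hai ▸ hlow)
    (hai ▸ (div_lt_one hJ0).2 hmJ) fun ξ g hc => ?_
  have h := sum_le_of_calib (c := Function.update (fun j => squareProfile (volume.real (E j))) i
    (∫ x in E i, g x)) (hcal J hmJ hJm.le) fun j hj ε hε => by
      rcases eq_or_ne j i with rfl | hne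
      · exact ⟨ξ, g, hc, by rw [Function.update_self]; linarith⟩
      · rw [Function.update_of_ne hne]
        exact hprof j hj ε hε
  rw [Finset.sum_update_of_mem hi', ← hstack, Finset.sum_eq_add_sum_sdiff_singleton_of_mem hi'] at h
  linarith

/-- Minimizers of problem (1) in the unit square with the Euclidean
norm, for `m > 4` (case (iii) of Proposition 5.1): the number of levels is
`⌊(2+√π)/(2√π)·m⌋` or `⌊(2+√π)/(2√π)·m⌋ + 1`, and all level sets are the plaquette
`Ω^r` with `r = √((1 − m/j̄)/(4−π))`. -/
theorem square_euclidean_large_mass (m : ℝ) (hm : 4 < m)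
    (u : (Fin 2 → ℝ) → ℝ) (hu : IsMinimizer euclNorm unitSquare m u)
    (jbar : ℕ) (hjbar : IsEssSup u jbar) :
    ((jbar : ℤ) = ⌊(2 + Real.sqrt Real.pi) / (2 * Real.sqrt Real.pi) * m⌋ ∨
      (jbar : ℤ) = ⌊(2 + Real.sqrt Real.pi) / (2 * Real.sqrt Real.pi) * m⌋ + 1) ∧
    ∀ j : ℕ, 1 ≤ j → j ≤ jbar →
      closure (densityPoints {x | (j : ℝ) ≤ u x}) =
        closure (plaquette euclNorm unitSquare
          (Real.sqrt ((1 - m / (jbar : ℝ)) / (4 - Real.pi)))) := by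
  obtain ⟨v, hv, hvu, h0⟩ := hu.1.exists_measurable
  obtain ⟨hmJ, hJm, hopt, hlev⟩ := superlevel_of_minimizer hm hu hjbar hv hvu h0
  refine ⟨eq_floor_of_optimal hm hmJ hJm hopt, fun j hj1 hj2 => ?_⟩
  have hJ0 : (0 : ℝ) < jbar := by linarith
  have hr0 : 0 < cornerRadius (m / jbar) := cornerRadius_pos ((div_lt_one hJ0).2 hmJ)
  have hr : cornerRadius (m / jbar) ≤ 1 / 2 :=
    (cornerRadius_lt_half (by rw [lt_div_iff₀ hJ0]; linarith)).le
  rw [show √((1 - m / (jbar : ℝ)) / (4 - Real.pi)) = cornerRadius (m / jbar) from rfl,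
    plaquette_unitSquare hr0 hr]
  refine closure_densityPoints (isOpen_roundDist_lt _ _) (EventuallyEq.trans ?_ (hlev (j - 1) ?_))
  · have e : ((j - 1 : ℕ) : ℝ) + 1 = j := by
      rw [Nat.cast_sub hj1, Nat.cast_one, sub_add_cancel]
    rw [e]
    exact hvu.symm.mono fun x hx => congrArg ((j : ℝ) ≤ ·) hx
  · omega

end
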